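/- Let X be a combinatorial d-manifold whose geometric carrier is a Z₂-homology d-sphere, and let X₁ be an induced subcomplex of X which is a combinatorial d-ball. Put L = C(X₁,X) and X₂ = N(L,X). Then X₂ is Z₂-acyclic. -/

import Mathlib

/- Formalization of definitions from:
   B. Bagchi, B. Datta, "Combinatorial triangulations of homology spheres". -/

open Finset

noncomputable section

attribute [local instance] Classical.propDecidable

namespace HomologySpheres

variable {V : Type*} [DecidableEq V] {W : Type*} [DecidableEq W]

/-- The vertex set of a finite family of finite sets. -/
def verts (K : Finset (Finset V)) : Finset V := K.sup id

/-- An (abstract, finite) simplicial complex: a nonempty collection of nonempty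
finite sets closed under taking nonempty subsets. -/
def IsComplex (K : Finset (Finset V)) : Prop :=
  K.Nonempty ∧ ∅ ∉ K ∧ ∀ s ∈ K, ∀ t : Finset V, t ⊆ s → t.Nonempty → t ∈ K

/-- The facets (maximal faces) of `K`. -/
def facets (K : Finset (Finset V)) : Finset (Finset V) :=
  K.filter fun s => ∀ t ∈ K, s ⊆ t → t = s

/-- `K` is pure of dimension `d`: every maximal face has `d + 1` vertices. -/
def IsPure (d : ℕ) (K : Finset (Finset V)) : Prop :=
  ∀ s ∈ facets K, s.card = d + 1

/-- The link of a face `σ` in `K`. -/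
def link (K : Finset (Finset V)) (σ : Finset V) : Finset (Finset V) :=
  K.filter fun τ => Disjoint τ σ ∧ τ ∪ σ ∈ K

/-- `L` is an induced (full) subcomplex of `K`. -/
def IsInduced (K L : Finset (Finset V)) : Prop :=
  L ⊆ K ∧ ∀ s ∈ K, s ⊆ verts L → s ∈ L

/-- The simplicial complement `C(L, K)`: the induced subcomplex of `K` on
`V(K) \ V(L)`. -/
def simpComplement (L K : Finset (Finset V)) : Finset (Finset V) :=
  K.filter fun s => s ⊆ verts K \ verts L

/-- The simplicial neighbourhood `N(L, K)`: the subcomplex of `K` whose maximal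
faces are the maximal faces of `K` meeting `V(L)`. -/
def simpNbhd (L K : Finset (Finset V)) : Finset (Finset V) :=
  K.filter fun s => ∃ t ∈ facets K, s ⊆ t ∧ (t ∩ verts L).Nonempty

/-- `fvec K i` is the number of `i`-dimensional faces of `K`. -/
def fvec (K : Finset (Finset V)) (i : ℕ) : ℕ :=
  (K.filter fun s => s.card = i + 1).card

/-- The number of facets of cardinality `d + 1` containing a given `(d-1)`-face
(the degree of the face in a (weak) pseudomanifold of dimension `d`). -/
def degOf (K : Finset (Finset V)) (d : ℕ) (s : Finset V) : ℕ :=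
  (K.filter fun t => s ⊆ t ∧ t.card = d + 1).card

/-- Simplicial isomorphism (via a vertex bijection carrying faces to faces). -/
def Iso (K : Finset (Finset V)) (L : Finset (Finset W)) : Prop :=
  ∃ f : V → W, Set.InjOn f ↑(verts K) ∧ L = K.image (Finset.image f)

/-- The join of two simplicial complexes (on disjoint vertex sets). -/
def sjoin (K L : Finset (Finset V)) : Finset (Finset V) :=
  K ∪ L ∪ (K ×ˢ L).image fun p => p.1 ∪ p.2

/-- The standard ball on vertex set `A`: all nonempty subsets of `A`. -/
def stdBall (A : Finset V) : Finset (Finset V) := A.powerset.erase ∅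

/-- The standard sphere on vertex set `A`: all nonempty proper subsets of `A`. -/
def stdSphere (A : Finset V) : Finset (Finset V) := (A.powerset.erase ∅).erase A

/-- `τ` is a free face of `K`, with `σ` the unique face properly containing it. -/
def IsFreeFace (K : Finset (Finset V)) (τ σ : Finset V) : Prop :=
  τ ∈ K ∧ σ ∈ K ∧ τ ⊂ σ ∧ ∀ ρ ∈ K, τ ⊂ ρ → ρ = σ

/-- An elementary collapse removes a free face together with the unique face
properly containing it. -/
def ElemCollapse (K K' : Finset (Finset V)) : Prop :=
  ∃ τ σ : Finset V, IsFreeFace K τ σ ∧ K' = (K.erase τ).erase σ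

/-- `K` collapses to `L` by a sequence of elementary collapses. -/
def CollapsesTo (K L : Finset (Finset V)) : Prop :=
  Relation.ReflTransGen ElemCollapse K L

/-- `K` is collapsible: it collapses to a single vertex. -/
def Collapsible (K : Finset (Finset V)) : Prop :=
  ∃ v : V, CollapsesTo K {{v}}

/-! ### Simplicial homology with `ℤ/2` coefficients (augmented chain complex).
A chain of level `n` is a `ZMod 2`-valued function supported on the faces of
cardinality `n` (the empty set, of cardinality `0`, serves as the `(-1)`-simplex
of the augmented complex).  Reduced homology in dimension `q` lives at level
`q + 1`. -/

/-- `c` is a chain of level `n` of `K` (over `ℤ/2`). -/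
def z2chainOK (K : Finset (Finset V)) (n : ℕ) (c : Finset V → ZMod 2) : Prop :=
  ∀ s : Finset V, c s ≠ 0 → s.card = n ∧ (s ∈ K ∨ s = ∅)

/-- The mod-2 boundary operator. -/
def z2bdry (K : Finset (Finset V)) (c : Finset V → ZMod 2) : Finset V → ZMod 2 :=
  fun t => ∑ v ∈ verts K \ t, c (insert v t)

/-- `K` is `ℤ/2`-acyclic: all reduced homology with `ℤ/2` coefficients vanishes,
i.e. in the augmented mod-2 chain complex every cycle is a boundary. -/
def Z2Acyclic (K : Finset (Finset V)) : Prop :=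
  ∀ (n : ℕ) (c : Finset V → ZMod 2), z2chainOK K n c → z2bdry K c = 0 →
    ∃ c', z2chainOK K (n + 1) c' ∧ z2bdry K c' = c

/-- `K` has the reduced `ℤ/2`-homology of the `d`-sphere: reduced homology
vanishes in all dimensions except `d` (level `d + 1`), where it is `ℤ/2`
(there is a cycle `z` which is not a boundary, and modulo boundaries every
cycle is `0` or `z`). -/
def Z2HomologySphere (d : ℕ) (K : Finset (Finset V)) : Prop :=
  (∀ (n : ℕ) (c : Finset V → ZMod 2), n ≠ d + 1 → z2chainOK K n c →
    z2bdry K c = 0 → ∃ c', z2chainOK K (n + 1) c' ∧ z2bdry K c' = c) ∧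
  (∃ z : Finset V → ZMod 2, z2chainOK K (d + 1) z ∧ z2bdry K z = 0 ∧
    (∀ c', z2chainOK K (d + 2) c' → z2bdry K c' ≠ z) ∧
    (∀ z', z2chainOK K (d + 1) z' → z2bdry K z' = 0 →
      (∃ c', z2chainOK K (d + 2) c' ∧ z2bdry K c' = z') ∨
      (∃ c', z2chainOK K (d + 2) c' ∧ z2bdry K c' = z + z')))

/-! ### Integral simplicial homology via ordered chains (Munkres §13: ordered
simplicial homology, allowing repeated vertices, agrees with simplicial
homology). An ordered `m`-tuple chain corresponds to dimension `m - 1`; the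
unique `0`-tuple is the `(-1)`-simplex of the augmented complex. -/

/-- `c` is an ordered chain of `K` over `ℤ`: supported on tuples whose image is
a face (the empty tuple being allowed in level `0`). -/
def zchainOK (K : Finset (Finset V)) {m : ℕ} (c : (Fin m → V) → ℤ) : Prop :=
  ∀ x : Fin m → V, c x ≠ 0 → (Finset.univ.image x ∈ K ∨ m = 0)

/-- The integral boundary operator on ordered chains. -/
def zbdry (K : Finset (Finset V)) {m : ℕ} (c : (Fin (m + 1) → V) → ℤ) :
    (Fin m → V) → ℤ :=
  fun y => ∑ i : Fin (m + 1), (-1 : ℤ) ^ (i : ℕ) * ∑ v ∈ verts K, c (i.insertNth v y)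

/-- `K` has the reduced integral homology of the `d`-sphere: reduced homology
vanishes in all dimensions except `d`, where it is infinite cyclic (there is a
cycle `z` such that every cycle is, modulo boundaries, a unique multiple of `z`). -/
def ZHomologySphere (d : ℕ) (K : Finset (Finset V)) : Prop :=
  (∀ c : (Fin 0 → V) → ℤ, ∃ c' : (Fin 1 → V) → ℤ, zchainOK K c' ∧ zbdry K c' = c) ∧
  (∀ (m : ℕ) (c : (Fin (m + 1) → V) → ℤ), m ≠ d → zchainOK K c → zbdry K c = 0 →
    ∃ c' : (Fin (m + 2) → V) → ℤ, zchainOK K c' ∧ zbdry K c' = c) ∧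
  (∃ z : (Fin (d + 1) → V) → ℤ, zchainOK K z ∧ zbdry K z = 0 ∧
    ∀ z' : (Fin (d + 1) → V) → ℤ, zchainOK K z' → zbdry K z' = 0 →
      ∃! k : ℤ, ∃ c'' : (Fin (d + 2) → V) → ℤ,
        zchainOK K c'' ∧ zbdry K c'' = z' - k • z)

/-- A weak pseudomanifold of dimension `d`: pure, and every `(d-1)`-face is in
exactly two facets. -/
def IsWeakPseudomanifold (d : ℕ) (K : Finset (Finset V)) : Prop :=
  IsComplex K ∧ IsPure d K ∧ ∀ s ∈ K, s.card = d → degOf K d s = 2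

/-- Adjacency of facets along a common `(d-1)`-face. -/
def FacetAdj (d : ℕ) (K : Finset (Finset V)) (s t : Finset V) : Prop :=
  s ∈ K ∧ t ∈ K ∧ s.card = d + 1 ∧ t.card = d + 1 ∧ (s ∩ t).card = d

/-- A pseudomanifold: a weak pseudomanifold in which any two facets are joined
by a chain of facets, consecutive ones sharing a `(d-1)`-face. -/
def IsPseudomanifold (d : ℕ) (K : Finset (Finset V)) : Prop :=
  IsWeakPseudomanifold d K ∧ ∀ s ∈ K, ∀ t ∈ K, s.card = d + 1 → t.card = d + 1 →
    Relation.ReflTransGen (FacetAdj d K) s t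

/-- A weak pseudomanifold with boundary. -/
def IsWeakPseudomanifoldWithBdry (d : ℕ) (K : Finset (Finset V)) : Prop :=
  IsComplex K ∧ IsPure d K ∧
  (∀ s ∈ K, s.card = d → degOf K d s = 1 ∨ degOf K d s = 2) ∧
  (∃ s ∈ K, s.card = d ∧ degOf K d s = 1)

/-- The boundary complex: all faces of degree-one `(d-1)`-faces. -/
def bdryComplex (d : ℕ) (K : Finset (Finset V)) : Finset (Finset V) :=
  K.filter fun t => ∃ s ∈ K, t ⊆ s ∧ s.card = d ∧ degOf K d s = 1

/-- `K` is connected (any two vertices joined by a path of edges). -/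
def SConnected (K : Finset (Finset V)) : Prop :=
  ∀ u ∈ verts K, ∀ v ∈ verts K,
    Relation.ReflTransGen (fun a b : V => ({a, b} : Finset V) ∈ K) u v

/-! ### Geometric realizations, subdivisions and combinatorial equivalence. -/

/-- A geometric simplicial complex in `ℝ^ℕ`: finitely many geometric simplices
(affinely independent vertex sets), closed under faces, any two of which meet
in a common face. -/
structure GComplex where
  faces : Finset (Finset (ℕ → ℝ))
  nonempty : faces.Nonempty
  empty_not_mem : ∅ ∉ faces
  down_closed : ∀ s ∈ faces, ∀ t : Finset (ℕ → ℝ), t ⊆ s → t.Nonempty → t ∈ faces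
  indep : ∀ s ∈ faces,
    AffineIndependent ℝ (fun x : {y : ℕ → ℝ // y ∈ s} => (x : ℕ → ℝ))
  glue : ∀ s ∈ faces, ∀ t ∈ faces,
    convexHull ℝ (s : Set (ℕ → ℝ)) ∩ convexHull ℝ (t : Set (ℕ → ℝ)) =
      convexHull ℝ ((s ∩ t : Finset (ℕ → ℝ)) : Set (ℕ → ℝ))

/-- The geometric carrier (underlying polyhedron) of a geometric complex. -/
def GComplex.carrier (G : GComplex) : Set (ℕ → ℝ) :=
  ⋃ s ∈ G.faces, convexHull ℝ (s : Set (ℕ → ℝ))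

/-- `G` realizes the abstract complex `K` via the vertex map `f`. -/
def RealizesMap (G : GComplex) (K : Finset (Finset V)) (f : V → ℕ → ℝ) : Prop :=
  Set.InjOn f ↑(verts K) ∧ G.faces = K.image (Finset.image f)

/-- `G` is a geometric realization of the abstract complex `K`. -/
def Realizes (G : GComplex) (K : Finset (Finset V)) : Prop :=
  ∃ f : V → ℕ → ℝ, RealizesMap G K f

/-- `G'` is a subdivision of `G`: same carrier, and every simplex of `G'` is
contained in a simplex of `G`. -/
def Subdivides (G' G : GComplex) : Prop :=
  G'.carrier = G.carrier ∧
  ∀ s ∈ G'.faces, ∃ t ∈ G.faces,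
    convexHull ℝ (s : Set (ℕ → ℝ)) ⊆ convexHull ℝ (t : Set (ℕ → ℝ))

/-- Combinatorial equivalence: `K` and `L` admit isomorphic subdivisions. -/
def CombEquiv (K : Finset (Finset V)) (L : Finset (Finset W)) : Prop :=
  ∃ G1 G1' G2 G2' : GComplex, Realizes G1 K ∧ Realizes G2 L ∧
    Subdivides G1' G1 ∧ Subdivides G2' G2 ∧ Iso G1'.faces G2'.faces

/-- A combinatorial `d`-ball: combinatorially equivalent to the standard ball. -/
def IsCombBall (d : ℕ) (K : Finset (Finset V)) : Prop :=
  ∃ A : Finset ℕ, A.card = d + 1 ∧ CombEquiv K (stdBall A)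

/-- A combinatorial `d`-sphere: combinatorially equivalent to the standard sphere. -/
def IsCombSphere (d : ℕ) (K : Finset (Finset V)) : Prop :=
  ∃ A : Finset ℕ, A.card = d + 2 ∧ CombEquiv K (stdSphere A)

/-- A combinatorial `d`-manifold: every vertex link is a combinatorial
`(d-1)`-sphere. -/
def IsCombManifold (d : ℕ) (K : Finset (Finset V)) : Prop :=
  IsComplex K ∧ ∀ v ∈ verts K, IsCombSphere (d - 1) (link K {v})

/-- A combinatorial `d`-manifold with boundary. -/
def IsCombManifoldWithBdry (d : ℕ) (K : Finset (Finset V)) : Prop :=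
  IsComplex K ∧
  (∀ v ∈ verts K, IsCombSphere (d - 1) (link K {v}) ∨
    IsCombBall (d - 1) (link K {v})) ∧
  (∃ v ∈ verts K, IsCombBall (d - 1) (link K {v}))

/-- A pl `k`-ball: a polyhedron carried by some geometric complex whose face
structure is a combinatorial `k`-ball. -/
def IsPLBall (k : ℕ) (P : Set (ℕ → ℝ)) : Prop :=
  ∃ G : GComplex, G.carrier = P ∧ IsCombBall k G.faces

/-- Elementary polyhedral collapse: `P = P' ∪ B` with `B` a pl `k`-ball and
`P' ∩ B` a pl `(k-1)`-ball. -/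
def PolyElemCollapse (P P' : Set (ℕ → ℝ)) : Prop :=
  ∃ k : ℕ, 1 ≤ k ∧ ∃ B : Set (ℕ → ℝ),
    IsPLBall k B ∧ P = P' ∪ B ∧ IsPLBall (k - 1) (P' ∩ B)

/-- Polyhedral collapse. -/
def PolyCollapsesTo (P Q : Set (ℕ → ℝ)) : Prop :=
  Relation.ReflTransGen PolyElemCollapse P Q

/-- Carrier of a subcomplex under a vertex realization map `f`. -/
def subCarrier (f : V → ℕ → ℝ) (L : Finset (Finset V)) : Set (ℕ → ℝ) :=
  ⋃ s ∈ L, convexHull ℝ ((s.image f : Finset (ℕ → ℝ)) : Set (ℕ → ℝ))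

/-! ### Bistellar moves. -/

/-- The core `β = {x ∈ A : A \ {x} ∈ X}` of a `(d+2)`-set `A`. -/
def bcore (X : Finset (Finset V)) (A : Finset V) : Finset V :=
  A.filter fun x => A.erase x ∈ X

/-- `κ_A` is a bistellar `i`-move on the `d`-dimensional complex `X`:
`A` has `d + 2` elements and contains at least one and at most `d + 1` facets
of `X`; with `β` the core of `A` and `α = A \ β` an `i`-face of `X`, one has
`β ∉ X`, and either `α` is a facet of `X` or `Lk_X(α)` has vertex set `β`. -/
def BistellarIMove (d i : ℕ) (X : Finset (Finset V)) (A : Finset V) : Prop :=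
  A.card = d + 2 ∧
  0 < ((facets X).filter fun σ => σ ⊆ A).card ∧
  ((facets X).filter fun σ => σ ⊆ A).card ≤ d + 1 ∧
  bcore X A ∉ X ∧
  A \ bcore X A ∈ X ∧ (A \ bcore X A).card = i + 1 ∧
  (A \ bcore X A ∈ facets X ∨ verts (link X (A \ bcore X A)) = bcore X A)

/-! ### The explicit small complexes of the paper. -/

/-- The complex generated by a list of facets: all nonempty subsets thereof. -/
def genBy (F : Finset (Finset ℕ)) : Finset (Finset ℕ) :=
  F.sup fun s => s.powerset.erase ∅

/-- The standard 2-sphere `S²₄`. -/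
def S24 : Finset (Finset ℕ) := stdSphere {1, 2, 3, 4}

/-- The join `S¹₃ * S⁰₂`. -/
def S13S02 : Finset (Finset ℕ) := sjoin (stdSphere {1, 2, 3}) (stdSphere {4, 5})

/-- The octahedron `S⁰₂ * S⁰₂ * S⁰₂`. -/
def Octa : Finset (Finset ℕ) :=
  sjoin (stdSphere {1, 2}) (sjoin (stdSphere {3, 4}) (stdSphere {5, 6}))

/-- The 6-vertex real projective plane `ℝP²₆`. -/
def RP26 : Finset (Finset ℕ) :=
  genBy {{1, 2, 3}, {1, 2, 4}, {1, 3, 5}, {1, 4, 6}, {1, 5, 6},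
         {2, 3, 6}, {2, 4, 5}, {2, 5, 6}, {3, 4, 5}, {3, 4, 6}}

/-- `Σ₁`: the 6-vertex 2-sphere with a vertex of degree 3 and one of degree 5. -/
def Sigma1 : Finset (Finset ℕ) :=
  genBy {{1, 2, 5}, {1, 2, 6}, {1, 5, 6}, {2, 3, 5},
         {2, 3, 6}, {3, 4, 5}, {3, 4, 6}, {4, 5, 6}}

/-- The double pyramid `S¹₅ * S⁰₂`. -/
def S15S02 : Finset (Finset ℕ) :=
  sjoin (genBy {{1, 2}, {2, 3}, {3, 4}, {4, 5}, {1, 5}}) (stdSphere {6, 7})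

/-- `Σ₂` (7-vertex 2-sphere with 10 triangles). -/
def Sigma2 : Finset (Finset ℕ) :=
  genBy {{1, 2, 6}, {1, 2, 7}, {1, 6, 7}, {2, 3, 6}, {2, 3, 7},
         {3, 4, 6}, {3, 4, 7}, {4, 5, 6}, {4, 5, 7}, {5, 6, 7}}

/-- `Σ₃` (7-vertex 2-sphere with 10 triangles). -/
def Sigma3 : Finset (Finset ℕ) :=
  genBy {{1, 2, 6}, {1, 2, 7}, {1, 6, 7}, {2, 3, 4}, {2, 3, 7},
         {2, 4, 6}, {3, 4, 7}, {4, 5, 6}, {4, 5, 7}, {5, 6, 7}}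

/-- `Σ₄` (7-vertex 2-sphere with 10 triangles). -/
def Sigma4 : Finset (Finset ℕ) :=
  genBy {{1, 2, 4}, {1, 2, 7}, {1, 4, 5}, {1, 5, 6}, {1, 6, 7},
         {2, 3, 4}, {2, 3, 7}, {3, 4, 7}, {4, 5, 7}, {5, 6, 7}}

/-- `Σ₅` (7-vertex 2-sphere with 10 triangles). -/
def Sigma5 : Finset (Finset ℕ) :=
  genBy {{1, 2, 3}, {1, 2, 6}, {1, 3, 5}, {1, 5, 6}, {2, 3, 4},
         {2, 4, 6}, {3, 4, 5}, {4, 5, 7}, {4, 6, 7}, {5, 6, 7}}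

/-- `Υ₁ = S²₄ ∪ S²₄`: two tetrahedral spheres sharing exactly one vertex. -/
def Upsilon1 : Finset (Finset ℕ) :=
  stdSphere {1, 2, 3, 7} ∪ stdSphere {4, 5, 6, 7}

/-- `Υ₂ = S²₄ ∪ (S⁰₂ * S¹₃)`: a tetrahedral sphere and a join, where the two
common vertices span an edge of the `S²₄`. -/
def Upsilon2 : Finset (Finset ℕ) :=
  stdSphere {4, 5, 6, 7} ∪ sjoin (stdSphere {6, 7}) (stdSphere {1, 2, 3})

/-- The complex `R` obtained from `ℝP²₆` by the generalized bistellar 1-move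
`κ_A`, `A = {1, 2, 5, 6}` (all such choices of `A` yield isomorphic complexes). -/
def Rcomplex : Finset (Finset ℕ) :=
  genBy {{1, 2, 3}, {1, 2, 4}, {1, 2, 5}, {1, 2, 6}, {1, 3, 5},
         {1, 4, 6}, {2, 3, 6}, {2, 4, 5}, {3, 4, 5}, {3, 4, 6}}


section Chains

variable {α : Type*} [DecidableEq α]

/-- Boundary operator on finitely supported mod 2 chains. -/
def bd : (Finset α →₀ ZMod 2) →ₗ[ZMod 2] (Finset α →₀ ZMod 2) :=
  Finsupp.linearCombination (ZMod 2) (fun s => ∑ v ∈ s, Finsupp.single (s.erase v) (1 : ZMod 2))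

/-- Chains of `K` of level `n`. -/
def Ch (K : Set (Finset α)) (n : ℕ) : Submodule (ZMod 2) (Finset α →₀ ZMod 2) :=
  Finsupp.supported (ZMod 2) (ZMod 2) {s | s ∈ K ∧ s.card = n}

/-- Downward closed families. -/
def DC (K : Set (Finset α)) : Prop := ∀ s ∈ K, ∀ t, t ⊆ s → t ∈ K

/-- Vanishing of the homology at level `n`. -/
def Hv (K : Set (Finset α)) (n : ℕ) : Prop :=
  ∀ c ∈ Ch K n, bd c = 0 → ∃ e ∈ Ch K (n + 1), bd e = c

def Acyc (K : Set (Finset α)) : Prop := ∀ n, Hv K n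

lemma two_add (c : Finset α →₀ ZMod 2) : c + c = 0 := by
  ext s; simpa using CharTwo.add_self_eq_zero (c s)

lemma bd_single (s : Finset α) :
    bd (Finsupp.single s (1 : ZMod 2)) = ∑ v ∈ s, Finsupp.single (s.erase v) (1 : ZMod 2) := by
  simp [bd]

lemma bd_bd_single (s : Finset α) : bd (bd (Finsupp.single s (1 : ZMod 2))) = 0 := by
  rw [bd_single, map_sum]
  simp_rw [bd_single]
  rw [Finset.sum_sigma']
  refine Finset.sum_involution (fun p _ => ⟨p.2, p.1⟩) ?_ ?_ ?_ ?_
  · rintro ⟨a, b⟩ h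
    simp only
    rw [Finset.erase_right_comm]
    exact two_add _
  · rintro ⟨a, b⟩ h _ heq
    simp at h heq
    exact h.2.1 heq.1
  · rintro ⟨a, b⟩ h
    simp at h ⊢
    exact ⟨h.2.2, fun h' => h.2.1 h'.symm, h.1⟩
  · rintro ⟨a, b⟩ h
    rfl

lemma bd_bd (c : Finset α →₀ ZMod 2) : bd (bd c) = 0 := by
  have : (bd ∘ₗ bd : (Finset α →₀ ZMod 2) →ₗ[ZMod 2] (Finset α →₀ ZMod 2)) = 0 := by
    ext s : 2
    simp [bd_bd_single]
  exact LinearMap.congr_fun this c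

lemma Ch_mono {K L : Set (Finset α)} (h : K ⊆ L) (n : ℕ) : Ch K n ≤ Ch L n :=
  Finsupp.supported_mono (fun _ hs => ⟨h hs.1, hs.2⟩)

lemma Ch_single {K : Set (Finset α)} {n : ℕ} {s : Finset α} (h : s ∈ K) (hn : s.card = n) :
    Finsupp.single s (1 : ZMod 2) ∈ Ch K n :=
  Finsupp.single_mem_supported _ _ ⟨h, hn⟩

lemma Ch_inter {K L : Set (Finset α)} {n : ℕ} {c : Finset α →₀ ZMod 2}
    (h : c ∈ Ch K n) (h' : c ∈ Ch L n) : c ∈ Ch (K ∩ L) n := by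
  rw [Ch, Finsupp.mem_supported] at *
  exact fun s hs => ⟨⟨(h hs).1, (h' hs).1⟩, (h hs).2⟩

/-- A linear map sends `Ch K n` to `p` if it does so on basis elements. -/
lemma Ch_map {K : Set (Finset α)} {n : ℕ} {M : Type*} [AddCommGroup M] [Module (ZMod 2) M]
    (f : (Finset α →₀ ZMod 2) →ₗ[ZMod 2] M) (p : Submodule (ZMod 2) M)
    (h : ∀ s ∈ K, s.card = n → f (Finsupp.single s 1) ∈ p) {c} (hc : c ∈ Ch K n) : f c ∈ p := by
  have : Ch K n ≤ p.comap f := by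
    rw [Ch, Finsupp.supported_eq_span_single, Submodule.span_le]
    rintro _ ⟨s, hs, rfl⟩
    exact h s hs.1 hs.2
  exact this hc

lemma bd_mem {K : Set (Finset α)} (hK : DC K) {n : ℕ} {c} (hc : c ∈ Ch K (n + 1)) :
    bd c ∈ Ch K n := by
  refine Ch_map bd (Ch K n) (fun s hs hn => ?_) hc
  rw [bd_single]
  refine Submodule.sum_mem _ (fun v hv => Ch_single (hK s hs _ (Finset.erase_subset _ _)) ?_)
  rw [Finset.card_erase_of_mem hv, hn]; rfl

lemma bd_zero_level {K : Set (Finset α)} {c} (hc : c ∈ Ch K 0) : bd c = 0 := by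
  have := Ch_map (K := K) (n := 0) bd ⊥ (fun s hs hn => ?_) hc
  · simpa using this
  · rw [bd_single, Finset.card_eq_zero.1 hn]; simp

lemma Ch_split {A B : Set (Finset α)} {n : ℕ} {c} (hc : c ∈ Ch (A ∪ B) n) :
    ∃ a ∈ Ch A n, ∃ b ∈ Ch B n, c = a + b := by
  have h : Ch (A ∪ B) n = Ch A n ⊔ Ch B n := by
    rw [Ch, Ch, Ch, ← Finsupp.supported_union]
    congr 1; ext s; simp [or_and_right]
  rw [h, Submodule.mem_sup] at hc
  obtain ⟨a, ha, b, hb, h⟩ := hc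
  exact ⟨a, ha, b, hb, h.symm⟩

lemma eq_of_add_zero {a b : Finset α →₀ ZMod 2} (h : a + b = 0) : a = b := by
  have := two_add b
  rw [← h] at this
  exact (add_right_cancel this).symm

lemma cyc_inter {A B : Set (Finset α)} (hA : DC A) (hB : DC B) {n : ℕ} {a b}
    (ha : a ∈ Ch A n) (hb : b ∈ Ch B n) (h : bd a = bd b) (hI : Acyc (A ∩ B)) :
    ∃ e ∈ Ch (A ∩ B) n, bd e = bd a := by
  rcases n with _ | n
  · exact ⟨0, Submodule.zero_mem _, by rw [bd_zero_level ha, map_zero]⟩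
  · obtain ⟨e, he, h'⟩ := hI n (bd a) (Ch_inter (bd_mem hA ha) (h ▸ bd_mem hB hb)) (bd_bd a)
    exact ⟨e, he, h'⟩

lemma MV {A B : Set (Finset α)} (hA : DC A) (hB : DC B) (hBa : Acyc B) (hI : Acyc (A ∩ B))
    (n : ℕ) : Hv (A ∪ B) n ↔ Hv A n := by
  constructor
  · intro h c hc hc0
    obtain ⟨e, he, hec⟩ := h c (Ch_mono Set.subset_union_left n hc) hc0
    obtain ⟨a, ha, b, hb, rfl⟩ := Ch_split he
    rw [map_add] at hec
    have h1 : bd b = c + bd a := by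
      rw [← hec, add_comm (bd a), add_assoc, two_add, add_zero]
    have h2 : bd b ∈ Ch (A ∩ B) n :=
      Ch_inter (h1 ▸ Submodule.add_mem _ hc (bd_mem hA ha)) (bd_mem hB hb)
    obtain ⟨f, hf, hfb⟩ := hI n _ h2 (bd_bd b)
    refine ⟨a + f, Submodule.add_mem _ ha (Ch_mono Set.inter_subset_left _ hf), ?_⟩
    rw [map_add, hfb, hec]
  · intro h c hc hc0
    obtain ⟨a, ha, b, hb, rfl⟩ := Ch_split hc
    rw [map_add] at hc0
    obtain ⟨e, he, hea⟩ := cyc_inter hA hB ha hb (eq_of_add_zero hc0) hI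
    obtain ⟨x, hx, hx'⟩ := h (a + e) (Submodule.add_mem _ ha (Ch_mono Set.inter_subset_left _ he))
      (by rw [map_add, hea, two_add])
    obtain ⟨y, hy, hy'⟩ := hBa n (b + e)
      (Submodule.add_mem _ hb (Ch_mono Set.inter_subset_right _ he))
      (by rw [map_add, hea, add_comm, hc0])
    refine ⟨x + y, Submodule.add_mem _ (Ch_mono Set.subset_union_left _ hx)
      (Ch_mono Set.subset_union_right _ hy), ?_⟩
    rw [map_add, hx', hy', add_add_add_comm, two_add, add_zero]

/-- The cone operator. -/
def cone (a : α) : (Finset α →₀ ZMod 2) →ₗ[ZMod 2] (Finset α →₀ ZMod 2) :=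
  Finsupp.linearCombination (ZMod 2)
    (fun s => if a ∈ s then 0 else Finsupp.single (insert a s) (1 : ZMod 2))

lemma cone_single (a : α) (s : Finset α) : cone a (Finsupp.single s (1 : ZMod 2)) =
    if a ∈ s then 0 else Finsupp.single (insert a s) (1 : ZMod 2) := by
  simp [cone]

lemma bd_cone_single (a : α) (s : Finset α) :
    bd (cone a (Finsupp.single s (1 : ZMod 2))) + cone a (bd (Finsupp.single s (1 : ZMod 2))) =
      Finsupp.single s (1 : ZMod 2) := by
  rw [cone_single, bd_single, map_sum]
  simp_rw [cone_single]
  split_ifs with h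
  · rw [map_zero, zero_add, Finset.sum_eq_single_of_mem a h]
    · simp [Finset.insert_erase h]
    · intro b _ hb
      rw [if_pos]
      exact Finset.mem_erase.2 ⟨fun h => hb h.symm, h⟩
  · rw [bd_single, Finset.sum_insert h, Finset.erase_insert h, add_assoc, ← Finset.sum_add_distrib,
      Finset.sum_eq_zero, add_zero]
    intro v hv
    have hav : a ≠ v := fun h' => h (h' ▸ hv)
    rw [if_neg (fun h' => h (Finset.mem_of_mem_erase h')), Finset.erase_insert_of_ne hav]
    exact two_add _

lemma bd_cone (a : α) (c : Finset α →₀ ZMod 2) : bd (cone a c) + cone a (bd c) = c := by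
  have : (bd ∘ₗ cone a + cone a ∘ₗ bd : (Finset α →₀ ZMod 2) →ₗ[ZMod 2] (Finset α →₀ ZMod 2))
      = LinearMap.id := by
    ext s : 2
    simpa using bd_cone_single a s
  exact LinearMap.congr_fun this c

lemma Hv_cone {K : Set (Finset α)} (a : α) (n : ℕ)
    (h : ∀ s ∈ K, s.card = n → a ∉ s → insert a s ∈ K) : Hv K n := by
  intro c hc h0
  refine ⟨cone a c, ?_, ?_⟩
  · refine Ch_map (cone a) (Ch K (n + 1)) (fun s hs hn => ?_) hc
    rw [cone_single]
    split_ifs with ha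
    · exact Submodule.zero_mem _
    · exact Ch_single (h s hs hn ha) (by rw [Finset.card_insert_of_notMem ha, hn])
  · have := bd_cone a c
    rwa [h0, map_zero, add_zero] at this

lemma Acyc_cone {K : Set (Finset α)} (a : α) (h : ∀ s ∈ K, insert a s ∈ K) : Acyc K :=
  fun n => Hv_cone a n (fun s hs _ _ => h s hs)

lemma Acyc_empty : Acyc (∅ : Set (Finset α)) := by
  intro n c hc _
  refine ⟨0, Submodule.zero_mem _, ?_⟩
  have : c = 0 := by
    rw [Ch, Finsupp.mem_supported] at hc
    simpa using hc
  rw [this, map_zero]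

/-- Removing a vertex with acyclic link does not change homology vanishing. -/
lemma Hv_vertex {K : Set (Finset α)} (hK : DC K) (w : α)
    (hl : Acyc {s | w ∉ s ∧ insert w s ∈ K}) (n : ℕ) :
    Hv K n ↔ Hv {s ∈ K | w ∉ s} n := by
  have e1 : K = {s ∈ K | w ∉ s} ∪ {s | insert w s ∈ K} := by
    ext s
    simp only [Set.mem_union, Set.mem_ofPred_eq]
    constructor
    · intro hs
      by_cases hw : w ∈ s
      · right; rwa [Finset.insert_eq_of_mem hw]
      · left; exact ⟨hs, hw⟩
    · rintro (h | h)
      · exact h.1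
      · exact hK _ h _ (Finset.subset_insert _ _)
  have e2 : {s ∈ K | w ∉ s} ∩ {s | insert w s ∈ K} = {s | w ∉ s ∧ insert w s ∈ K} := by
    ext s
    simp only [Set.mem_inter_iff, Set.mem_ofPred_eq]
    constructor
    · rintro ⟨⟨_, h⟩, h'⟩; exact ⟨h, h'⟩
    · rintro ⟨h, h'⟩; exact ⟨⟨hK _ h' _ (Finset.subset_insert _ _), h⟩, h'⟩
  conv_lhs => rw [e1]
  refine MV ?_ ?_ ?_ (by rw [e2]; exact hl) n
  · rintro s ⟨hs, hw⟩ t hts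
    exact ⟨hK s hs t hts, fun h => hw (hts h)⟩
  · intro s hs t hts
    exact hK _ hs _ (Finset.insert_subset_insert _ hts)
  · exact Acyc_cone w (fun s hs => by simpa using hs)

end Chains
section Transport

variable {α β : Type*} [DecidableEq α] [DecidableEq β]

/-- Push forward of chains along a vertex map. -/
def push (f : α → β) : (Finset α →₀ ZMod 2) →ₗ[ZMod 2] (Finset β →₀ ZMod 2) :=
  Finsupp.lmapDomain (ZMod 2) (ZMod 2) (Finset.image f)

lemma push_single (f : α → β) (s : Finset α) :
    push f (Finsupp.single s (1 : ZMod 2)) = Finsupp.single (s.image f) 1 := by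
  simp [push]

lemma push_bd {f : α → β} {S : Set α} (hf : Set.InjOn f S) {n : ℕ} {c}
    (hc : c ∈ Ch {s : Finset α | ↑s ⊆ S} n) : bd (push f c) = push f (bd c) := by
  have := Ch_map (bd ∘ₗ push f - push f ∘ₗ bd) ⊥ (fun s hs _ => ?_) hc
  · simpa [sub_eq_zero] using this
  · simp only [LinearMap.sub_apply, LinearMap.comp_apply, Submodule.mem_bot, sub_eq_zero]
    rw [push_single, bd_single, bd_single, map_sum]
    rw [Finset.sum_image (fun x hx y hy h => hf (hs hx) (hs hy) h)]
    refine Finset.sum_congr rfl (fun v hv => ?_)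
    rw [push_single]
    congr 1
    ext y
    simp only [Finset.mem_erase, Finset.mem_image]
    constructor
    · rintro ⟨h, x, hx, rfl⟩
      exact ⟨x, ⟨fun h' => h (by rw [h']), hx⟩, rfl⟩
    · rintro ⟨x, ⟨h, hx⟩, rfl⟩
      exact ⟨fun h' => h (hf (hs hx) (hs hv) h'), x, hx, rfl⟩

lemma Hv_push {f : α → β} {g : β → α} {S : Set α} (hg : ∀ x ∈ S, g (f x) = x)
    {K : Set (Finset α)} (hK : ∀ s ∈ K, ↑s ⊆ S) {n : ℕ} (h : Hv K n) :
    Hv (Finset.image f '' K) n := by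
  have hf : Set.InjOn f S := fun x hx y hy h => by rw [← hg x hx, h, hg y hy]
  have hgi : Set.InjOn g (f '' S) := by
    rintro _ ⟨x, hx, rfl⟩ _ ⟨y, hy, rfl⟩ h
    rw [hg x hx, hg y hy] at h; rw [h]
  have hgf : ∀ s ∈ K, (s.image f).image g = s := by
    intro s hs
    rw [Finset.image_image]
    conv_rhs => rw [← Finset.image_id (s := s)]
    exact Finset.image_congr (fun x hx => hg x (hK s hs hx))
  have hcard : ∀ s ∈ K, (s.image f).card = s.card := fun s hs =>
    Finset.card_image_of_injOn (hf.mono (hK s hs))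
  intro c hc hc0
  have hc1 : c ∈ Ch {s : Finset β | ↑s ⊆ f '' S} n := by
    refine Ch_mono ?_ n hc
    rintro _ ⟨s, hs, rfl⟩
    simp only [Set.mem_ofPred_eq, Finset.coe_image]
    exact Set.image_mono (hK s hs)
  have hc2 : push g c ∈ Ch K n := by
    refine Ch_map _ (Ch K n) ?_ hc
    rintro _ ⟨s, hs, rfl⟩ hn
    rw [push_single, hgf s hs]
    exact Ch_single hs (by rw [← hcard s hs, hn])
  obtain ⟨e, he, hec⟩ := h (push g c) hc2 (by rw [push_bd hgi hc1, hc0, map_zero])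
  refine ⟨push f e, ?_, ?_⟩
  · refine Ch_map _ _ ?_ he
    intro s hs hn
    rw [push_single]
    exact Ch_single ⟨s, hs, rfl⟩ (by rw [hcard s hs, hn])
  · rw [push_bd hf (Ch_mono hK _ he), hec]
    have := Ch_map (push f ∘ₗ push g - LinearMap.id) ⊥ ?_ hc
    · simpa [sub_eq_zero] using this
    · rintro _ ⟨s, hs, rfl⟩ _
      simp [push_single, hgf s hs]

lemma Hv_push_iff {f : α → β} {g : β → α} {S : Set α} (hg : ∀ x ∈ S, g (f x) = x)
    {K : Set (Finset α)} (hK : ∀ s ∈ K, ↑s ⊆ S) (n : ℕ) :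
    Hv (Finset.image f '' K) n ↔ Hv K n := by
  refine ⟨fun h => ?_, Hv_push hg hK⟩
  have h' := Hv_push (f := g) (g := f) (S := f '' S) (by
    rintro _ ⟨x, hx, rfl⟩; rw [hg x hx]) (K := Finset.image f '' K) (by
    rintro _ ⟨s, hs, rfl⟩
    rw [Finset.coe_image]
    exact Set.image_mono (hK s hs)) h
  have : Finset.image g '' (Finset.image f '' K) = K := by
    ext s
    simp only [Set.mem_image, exists_exists_and_eq_and]
    have hgf : ∀ s ∈ K, (s.image f).image g = s := by
      intro s hs
      rw [Finset.image_image]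
      conv_rhs => rw [← Finset.image_id (s := s)]
      exact Finset.image_congr (fun x hx => hg x (hK s hs hx))
    constructor
    · rintro ⟨t, ht, rfl⟩; rwa [hgf t ht]
    · intro hs; exact ⟨s, hs, hgf s hs⟩
  rwa [this] at h'

end Transport

section Dowker

variable {A B : Type*} [DecidableEq A] [DecidableEq B] (R : A → B → Prop)

def DE (A0 : Set A) (W : Finset B) : Set (Finset (A ⊕ B)) :=
  {σ | (∀ a, Sum.inl a ∈ σ → a ∈ A0) ∧ (∀ b, Sum.inr b ∈ σ → b ∈ W) ∧
    (∀ a b, Sum.inl a ∈ σ → Sum.inr b ∈ σ → R a b) ∧ ∃ a ∈ A0, ∀ b, Sum.inr b ∈ σ → R a b}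

def DF (A0 : Set A) (W : Finset B) : Set (Finset (A ⊕ B)) :=
  {σ | σ ∈ DE R A0 W ∧ ∃ b, ∀ a, Sum.inl a ∈ σ → R a b}

lemma DE_DC (A0 : Set A) (W : Finset B) : DC (DE R A0 W) := by
  rintro s ⟨h1, h2, h3, a, ha, h4⟩ t hts
  exact ⟨fun a h => h1 a (hts h), fun b h => h2 b (hts h), fun a b h h' => h3 a b (hts h) (hts h'),
    a, ha, fun b h => h4 b (hts h)⟩

lemma DF_DC (A0 : Set A) (W : Finset B) : DC (DF R A0 W) := by
  rintro s ⟨h1, b, hb⟩ t hts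
  exact ⟨DE_DC R A0 W s h1 t hts, b, fun a h => hb a (hts h)⟩

lemma DE_link (A0 : Set A) (W : Finset B) (w : B) (hw : w ∉ W) :
    {σ | Sum.inr w ∉ σ ∧ insert (Sum.inr w) σ ∈ DE R A0 (insert w W)} =
      DE R {a ∈ A0 | R a w} W := by
  ext σ
  simp only [DE, Set.mem_ofPred_eq, Finset.mem_insert, reduceCtorEq, false_or, Sum.inr.injEq]
  constructor
  · rintro ⟨h0, h1, h2, h3, a, ha, h4⟩
    refine ⟨fun a h => ⟨h1 a h, h3 a w h (Or.inl rfl)⟩, fun b h => ?_,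
      fun a b h h' => h3 a b h (Or.inr h'), a, ⟨ha, h4 w (Or.inl rfl)⟩, fun b h => h4 b (Or.inr h)⟩
    rcases h2 b (Or.inr h) with rfl | h'
    · exact absurd h h0
    · exact h'
  · rintro ⟨h1, h2, h3, a, ha, h4⟩
    refine ⟨fun h => hw (h2 w h), fun a h => (h1 a h).1, ?_, ?_, a, ha.1, ?_⟩
    · rintro b (rfl | h)
      · exact Or.inl rfl
      · exact Or.inr (h2 b h)
    · rintro a b h (rfl | h')
      · exact (h1 a h).2
      · exact h3 a b h h'
    · rintro b (rfl | h)
      · exact ha.2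
      · exact h4 b h

lemma DF_link (A0 : Set A) (W : Finset B) (w : B) (hw : w ∉ W) :
    {σ | Sum.inr w ∉ σ ∧ insert (Sum.inr w) σ ∈ DF R A0 (insert w W)} =
      DE R {a ∈ A0 | R a w} W := by
  rw [← DE_link R A0 W w hw]
  ext σ
  simp only [DF, Set.mem_ofPred_eq]
  constructor
  · rintro ⟨h0, h1, h2⟩; exact ⟨h0, h1⟩
  · rintro ⟨h0, h1⟩
    refine ⟨h0, h1, w, fun a h => h1.2.2.1 a w h ?_⟩
    simp

lemma DE_del (A0 : Set A) (W : Finset B) (w : B) (hw : w ∉ W) :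
    {σ ∈ DE R A0 (insert w W) | Sum.inr w ∉ σ} = DE R A0 W := by
  ext σ
  simp only [DE, Set.mem_ofPred_eq, Finset.mem_insert]
  constructor
  · rintro ⟨⟨h1, h2, h3⟩, h0⟩
    refine ⟨h1, fun b h => ?_, h3⟩
    rcases h2 b h with rfl | h'
    · exact absurd h h0
    · exact h'
  · rintro ⟨h1, h2, h3⟩
    exact ⟨⟨h1, fun b h => Or.inr (h2 b h), h3⟩, fun h => hw (h2 w h)⟩

lemma DF_del (A0 : Set A) (W : Finset B) (w : B) (hw : w ∉ W) :
    {σ ∈ DF R A0 (insert w W) | Sum.inr w ∉ σ} = DF R A0 W := by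
  ext σ
  have := Set.ext_iff.1 (DE_del R A0 W w hw) σ
  simp only [Set.mem_ofPred_eq] at this
  simp only [DF, Set.mem_ofPred_eq, ← this]
  tauto

lemma DE_acyc (W : Finset B) : ∀ A0 : Set A, Acyc (DE R A0 W) := by
  induction W using Finset.induction_on with
  | empty =>
    intro A0
    rcases A0.eq_empty_or_nonempty with rfl | ⟨a0, ha0⟩
    · have he : DE R (∅ : Set A) ∅ = ∅ := by
        ext σ
        simp [DE]
      rw [he]
      exact Acyc_empty
    · refine Acyc_cone (Sum.inl a0) ?_
      rintro σ ⟨h1, h2, h3, h4⟩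
      have h2' : ∀ b, Sum.inr b ∉ σ := fun b h => by simpa using h2 b h
      refine ⟨?_, ?_, ?_, a0, ha0, ?_⟩
      · intro a h
        rcases Finset.mem_insert.1 h with h | h
        · cases h; exact ha0
        · exact h1 a h
      all_goals simp [h2']
  | insert w W hw ih =>
    intro A0 n
    rw [Hv_vertex (DE_DC R A0 _) (Sum.inr w) (by rw [DE_link R A0 W w hw]; exact ih _),
      DE_del R A0 W w hw]
    exact ih A0 n

lemma DF_Hv (W : Finset B) (A0 : Set A) (n : ℕ) : Hv (DF R A0 W) n ↔ Hv (DF R A0 ∅) n := by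
  induction W using Finset.induction_on with
  | empty => rfl
  | insert w W hw ih =>
    rw [Hv_vertex (DF_DC R A0 _) (Sum.inr w)
      (by rw [DF_link R A0 W w hw]; exact DE_acyc R _ _), DF_del R A0 W w hw]
    exact ih

/-- One half of Dowker's theorem. -/
lemma Dowker_half (W : Finset B) (A0 : Set A) (hA : A0.Nonempty) (n : ℕ) :
    Hv (DF R A0 W) n ↔ Hv {J : Finset A | ↑J ⊆ A0 ∧ ∃ b, ∀ a ∈ J, R a b} n := by
  obtain ⟨a0, ha0⟩ := hA
  rw [DF_Hv, ← Hv_push_iff (f := (Sum.inl : A → A ⊕ B)) (g := Sum.elim id (fun _ => a0))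
    (S := Set.univ) (by simp) (by simp)]
  have : DF R A0 ∅ = Finset.image Sum.inl '' {J : Finset A | ↑J ⊆ A0 ∧ ∃ b, ∀ a ∈ J, R a b} := by
    ext σ
    constructor
    · rintro ⟨⟨h1, h2, h3, h4⟩, b, h5⟩
      refine ⟨σ.toLeft, ⟨fun a h => h1 a (by simpa using h), b, fun a h => h5 a (by simpa using h)⟩,
        ?_⟩
      ext x
      rcases x with a | b
      · simp
      · simp only [Finset.mem_image, reduceCtorEq, and_false, exists_false, false_iff]
        intro h; simpa using h2 b h
    · rintro ⟨J, ⟨h1, b, h2⟩, rfl⟩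
      refine ⟨⟨?_, ?_, ?_, a0, ha0, ?_⟩, b, ?_⟩
      · intro a h; exact h1 (by simpa using h)
      · simp
      · simp
      · simp
      · intro a h; exact h2 a (by simpa using h)
  rw [this]

/-- Dowker's theorem for a finite relation. -/
lemma Dowker (A0 : Finset A) (B0 : Finset B) (hA : A0.Nonempty) (hB : B0.Nonempty)
    (hR : ∀ a b, R a b → a ∈ A0 ∧ b ∈ B0) (n : ℕ) :
    Hv {J : Finset A | ∃ b, ∀ a ∈ J, R a b} n ↔ Hv {s : Finset B | ∃ a, ∀ b ∈ s, R a b} n := by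
  have e1 : {J : Finset A | ↑J ⊆ (A0 : Set A) ∧ ∃ b, ∀ a ∈ J, R a b} =
      {J : Finset A | ∃ b, ∀ a ∈ J, R a b} := by
    ext J
    simp only [Set.mem_ofPred_eq, and_iff_right_iff_imp]
    rintro ⟨b, hb⟩ a ha
    exact (hR a b (hb a ha)).1
  have e2 : {J : Finset B | ↑J ⊆ (B0 : Set B) ∧ ∃ a, ∀ b ∈ J, R a b} =
      {J : Finset B | ∃ a, ∀ b ∈ J, R a b} := by
    ext J
    simp only [Set.mem_ofPred_eq, and_iff_right_iff_imp]
    rintro ⟨b, hb⟩ a ha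
    exact (hR b a (hb a ha)).2
  rw [← e1, ← e2, ← Dowker_half R B0 A0 hA n, ← Dowker_half (fun b a => R a b) A0 B0 hB n,
    ← Hv_push_iff (f := (Sum.swap : A ⊕ B → B ⊕ A)) (g := Sum.swap) (S := Set.univ)
      (by simp) (by simp)]
  have hmem : ∀ (σ : Finset (A ⊕ B)), σ ∈ DF R A0 B0 →
      σ.image Sum.swap ∈ DF (fun b a => R a b) (B0 : Set B) A0 := by
    rintro σ ⟨⟨h1, h2, h3, a, ha, h4⟩, b, h5⟩
    have hl : ∀ b : B, (Sum.inl b : B ⊕ A) ∈ σ.image Sum.swap ↔ (Sum.inr b : A ⊕ B) ∈ σ := by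
      intro b; simp
    have hr : ∀ b : A, (Sum.inr b : B ⊕ A) ∈ σ.image Sum.swap ↔ (Sum.inl b : A ⊕ B) ∈ σ := by
      intro b; simp
    refine ⟨⟨?_, ?_, ?_, ?_⟩, a, ?_⟩
    · intro b h; exact h2 b ((hl b).1 h)
    · intro b h; exact h1 b ((hr b).1 h)
    · intro b a h h'; exact h3 a b ((hr a).1 h') ((hl b).1 h)
    · by_cases hb : ∃ a', Sum.inl a' ∈ σ
      · obtain ⟨a', ha'⟩ := hb
        exact ⟨b, (hR _ _ (h5 a' ha')).2, fun a h => h5 a ((hr a).1 h)⟩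
      · push Not at hb
        obtain ⟨b0, hb0⟩ := hB
        exact ⟨b0, hb0, fun a h => absurd ((hr a).1 h) (hb a)⟩
    · intro b h; exact h4 b ((hl b).1 h)
  have hmem' : ∀ (σ : Finset (B ⊕ A)), σ ∈ DF (fun b a => R a b) (B0 : Set B) A0 →
      σ.image Sum.swap ∈ DF R (A0 : Set A) B0 := by
    rintro σ ⟨⟨h1, h2, h3, a, ha, h4⟩, b, h5⟩
    have hl : ∀ b : A, (Sum.inl b : A ⊕ B) ∈ σ.image Sum.swap ↔ (Sum.inr b : B ⊕ A) ∈ σ := by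
      intro b; simp
    have hr : ∀ b : B, (Sum.inr b : A ⊕ B) ∈ σ.image Sum.swap ↔ (Sum.inl b : B ⊕ A) ∈ σ := by
      intro b; simp
    refine ⟨⟨?_, ?_, ?_, ?_⟩, a, ?_⟩
    · intro b h; exact h2 b ((hl b).1 h)
    · intro b h; exact h1 b ((hr b).1 h)
    · intro b a h h'; exact h3 a b ((hr a).1 h') ((hl b).1 h)
    · by_cases hb : ∃ a', Sum.inl a' ∈ σ
      · obtain ⟨a', ha'⟩ := hb
        exact ⟨b, (hR _ _ (h5 a' ha')).1, fun a h => h5 a ((hr a).1 h)⟩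
      · push Not at hb
        obtain ⟨b0, hb0⟩ := hA
        exact ⟨b0, hb0, fun a h => absurd ((hr a).1 h) (hb a)⟩
    · intro b h; exact h4 b ((hl b).1 h)
  have : Finset.image Sum.swap '' DF R (A0 : Set A) B0 = DF (fun b a => R a b) (B0 : Set B) A0 := by
    ext σ
    constructor
    · rintro ⟨τ, hτ, rfl⟩; exact hmem τ hτ
    · intro h
      refine ⟨σ.image Sum.swap, hmem' σ h, ?_⟩
      rw [Finset.image_image]
      simp
  rw [this]

end Dowker

section Nerve

variable {ι E : Type*} [DecidableEq ι] [AddCommGroup E] [Module ℝ E]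

def Nv (C : ι → Set E) (I : Set ι) (Q : Set E) : Set (Finset ι) :=
  {J | ↑J ⊆ I ∧ ∃ x ∈ Q, ∀ j ∈ J, x ∈ C j}

lemma Nv_DC (C : ι → Set E) (I : Set ι) (Q : Set E) : DC (Nv C I Q) := by
  rintro s ⟨h1, x, hx, h2⟩ t hts
  exact ⟨fun a h => h1 (hts h), x, hx, fun j h => h2 j (hts h)⟩

lemma affine_zero {h : E →ᵃ[ℝ] ℝ} {x y : E} (hx : 0 ≤ h x) (hy : h y ≤ 0) :
    ∃ a b : ℝ, 0 ≤ a ∧ 0 ≤ b ∧ a + b = 1 ∧ h (a • x + b • y) = 0 := by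
  have hcomb : ∀ a b : ℝ, a + b = 1 → h (a • x + b • y) = a * h x + b * h y := by
    intro a b hab
    have := Convex.combo_affine_apply (f := h) (x := x) (y := y) hab
    simpa using this
  by_cases hxy : h x - h y = 0
  · exact ⟨1, 0, by norm_num, le_rfl, by norm_num, by rw [hcomb 1 0 (by norm_num)]; linarith⟩
  · have hpos : 0 < h x - h y := lt_of_le_of_ne (by linarith) (Ne.symm hxy)
    refine ⟨-h y / (h x - h y), h x / (h x - h y), by apply div_nonneg <;> linarith,
      by apply div_nonneg <;> linarith, by field_simp; ring, ?_⟩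
    rw [hcomb _ _ (by field_simp; ring)]
    field_simp; ring

lemma affine_comb (h : E →ᵃ[ℝ] ℝ) (x y : E) {a b : ℝ} (hab : a + b = 1) :
    h (a • x + b • y) = a * h x + b * h y := by
  have := Convex.combo_affine_apply (f := h) (x := x) (y := y) hab
  simpa using this

lemma generic_point (l : List (E →ᵃ[ℝ] ℝ)) {Q : Set E} (hQ : Convex ℝ Q) (hne : Q.Nonempty)
    (h1 : ∀ h ∈ l, (∀ x ∈ Q, 0 ≤ h x) ∨ (∀ x ∈ Q, h x ≤ 0)) :
    ∃ x ∈ Q, ∀ h ∈ l, h x = 0 → ∀ y ∈ Q, h y = 0 := by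
  induction l with
  | nil => obtain ⟨x, hx⟩ := hne; exact ⟨x, hx, by simp⟩
  | cons h l ih =>
    obtain ⟨x, hx, hxl⟩ := ih (fun g hg => h1 g (List.mem_cons_of_mem _ hg))
    by_cases hz : h x = 0 → ∀ y ∈ Q, h y = 0
    · exact ⟨x, hx, by simpa using ⟨hz, hxl⟩⟩
    · push Not at hz
      obtain ⟨hx0, y, hy, hy0⟩ := hz
      refine ⟨(1/2 : ℝ) • x + (1/2 : ℝ) • y,
        hQ hx hy (by norm_num) (by norm_num) (by norm_num), ?_⟩
      intro g hg hg0
      rw [affine_comb g x y (by norm_num)] at hg0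
      rcases List.mem_cons.1 hg with rfl | hg'
      · rw [hx0] at hg0
        exact absurd (by linarith) hy0
      · apply hxl g hg'
        rcases h1 g hg with h | h
        · linarith [h x hx, h y hy]
        · linarith [h x hx, h y hy]

/-- The nerve of a finite polyhedral cover of a convex set is acyclic. -/
lemma Acyc_Nv (C : ι → Set E) (I : Set ι) (hC : ∀ i ∈ I, Convex ℝ (C i))
    (l : List (E →ᵃ[ℝ] ℝ)) (l2 : List (E →ᵃ[ℝ] ℝ)) : ∀ (Q : Set E), Convex ℝ Q →
    (∀ i ∈ I, ∀ x ∈ Q, x ∈ C i → ∀ y ∈ Q,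
      (∀ h ∈ l, (0 ≤ h x → 0 ≤ h y) ∧ (h x ≤ 0 → h y ≤ 0)) → y ∈ C i) →
    (∀ x ∈ Q, ∃ i ∈ I, x ∈ C i) →
    (∀ h ∈ l, h ∈ l2 ∨ (∀ x ∈ Q, 0 ≤ h x) ∨ (∀ x ∈ Q, h x ≤ 0)) →
    Acyc (Nv C I Q) := by
  induction l2 with
  | nil =>
    intro Q hQ hdef hcov hl
    rcases Q.eq_empty_or_nonempty with rfl | hne
    · have he : Nv C I ∅ = ∅ := by
        ext σ
        simp [Nv]
      rw [he]
      exact Acyc_empty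
    · have hl' : ∀ h ∈ l, (∀ x ∈ Q, 0 ≤ h x) ∨ (∀ x ∈ Q, h x ≤ 0) := fun h hh => by
        simpa using hl h hh
      obtain ⟨x, hx, hxl⟩ := generic_point l hQ hne hl'
      obtain ⟨i, hi, hxi⟩ := hcov x hx
      refine Acyc_cone i ?_
      rintro J ⟨hJ, y, hy, hyJ⟩
      refine ⟨by rw [Finset.coe_insert]; exact Set.insert_subset hi hJ, y, hy, ?_⟩
      intro j hj
      rcases Finset.mem_insert.1 hj with rfl | hj
      · refine hdef _ hi x hx hxi y hy (fun h hh => ?_)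
        have hz := hxl h hh
        rcases hl' h hh with h' | h'
        · refine ⟨fun _ => h' y hy, fun h0 => ?_⟩
          rw [hz (le_antisymm h0 (h' x hx)) y hy]
        · refine ⟨fun h0 => ?_, fun _ => h' y hy⟩
          rw [hz (le_antisymm (h' x hx) h0) y hy]
      · exact hyJ j hj
  | cons h l2 ih =>
    intro Q hQ hdef hcov hl
    have key : ∀ P : Set E, Convex ℝ P → ((∀ x ∈ P, 0 ≤ h x) ∨ (∀ x ∈ P, h x ≤ 0)) →
        Acyc (Nv C I (Q ∩ P)) := by
      intro P hP hP'
      refine ih (Q ∩ P) (hQ.inter hP) ?_ ?_ ?_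
      · intro i hi x hx hxi y hy; exact hdef i hi x hx.1 hxi y hy.1
      · intro x hx; exact hcov x hx.1
      · intro g hg
        rcases hl g hg with h' | h' | h'
        · rcases List.mem_cons.1 h' with rfl | h'
          · right
            rcases hP' with h' | h'
            · left; exact fun x hx => h' x hx.2
            · right; exact fun x hx => h' x hx.2
          · exact Or.inl h'
        · exact Or.inr (Or.inl fun x hx => h' x hx.1)
        · exact Or.inr (Or.inr fun x hx => h' x hx.1)
    have cp : Convex ℝ {x | 0 ≤ h x} := by
      intro x hx y hy a b ha hb hab
      simp only [Set.mem_ofPred_eq] at *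
      rw [affine_comb h x y hab]; positivity
    have cn : Convex ℝ {x | h x ≤ 0} := by
      intro x hx y hy a b ha hb hab
      simp only [Set.mem_ofPred_eq] at *
      rw [affine_comb h x y hab]; nlinarith
    have c0 : Convex ℝ {x | h x = 0} := by
      intro x hx y hy a b ha hb hab
      simp only [Set.mem_ofPred_eq] at *
      rw [affine_comb h x y hab, hx, hy]; simp
    have e1 : Nv C I Q = Nv C I (Q ∩ {x | 0 ≤ h x}) ∪ Nv C I (Q ∩ {x | h x ≤ 0}) := by
      ext J
      constructor
      · rintro ⟨hJ, x, hx, hxJ⟩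
        rcases le_total 0 (h x) with h' | h'
        · exact Or.inl ⟨hJ, x, ⟨hx, h'⟩, hxJ⟩
        · exact Or.inr ⟨hJ, x, ⟨hx, h'⟩, hxJ⟩
      · rintro (⟨hJ, x, hx, hxJ⟩ | ⟨hJ, x, hx, hxJ⟩) <;> exact ⟨hJ, x, hx.1, hxJ⟩
    have e2 : Nv C I (Q ∩ {x | 0 ≤ h x}) ∩ Nv C I (Q ∩ {x | h x ≤ 0}) =
        Nv C I (Q ∩ {x | h x = 0}) := by
      ext J
      constructor
      · rintro ⟨⟨hJ, x, hx, hxJ⟩, ⟨_, y, hy, hyJ⟩⟩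
        obtain ⟨a, b, ha, hb, hab, h0⟩ := affine_zero hx.2 hy.2
        refine ⟨hJ, a • x + b • y, ⟨hQ hx.1 hy.1 ha hb hab, h0⟩, fun j hj => ?_⟩
        exact hC j (hJ hj) (hxJ j hj) (hyJ j hj) ha hb hab
      · rintro ⟨hJ, x, hx, hxJ⟩
        have h0 : h x = 0 := hx.2
        exact ⟨⟨hJ, x, ⟨hx.1, h0.ge⟩, hxJ⟩, ⟨hJ, x, ⟨hx.1, h0.le⟩, hxJ⟩⟩
    intro n
    rw [e1, MV (Nv_DC _ _ _) (Nv_DC _ _ _) (key _ cn (Or.inr fun x hx => hx))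
      (by rw [e2]; exact key _ c0 (Or.inl fun x hx => (show h x = 0 from hx).ge)) n]
    exact key _ cp (Or.inl fun x hx => hx) n

end Nerve
section Geom

variable {E : Type*} [AddCommGroup E] [Module ℝ E] [DecidableEq E]

/-- Affinely independent finite sets. -/
def Ind (s : Finset E) : Prop := AffineIndependent ℝ (fun x : {y : E // y ∈ s} => (x : E))

/-- The convex hull of a finite set. -/
def hull (s : Finset E) : Set E := convexHull ℝ (s : Set E)

lemma hull_mono {s t : Finset E} (h : s ⊆ t) : hull s ⊆ hull t :=
  convexHull_mono (by exact_mod_cast h)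

lemma subset_hull {s : Finset E} {a : E} (h : a ∈ s) : a ∈ hull s :=
  subset_convexHull ℝ _ (by exact_mod_cast h)

lemma hull_convex (s : Finset E) : Convex ℝ (hull s) := convex_convexHull ℝ _

lemma hull_sub {s : Finset E} {Q : Set E} (hQ : Convex ℝ Q) (h : ∀ a ∈ s, a ∈ Q) : hull s ⊆ Q :=
  convexHull_min (fun a ha => h a (by exact_mod_cast ha)) hQ

lemma hull_empty : hull (∅ : Finset E) = ∅ := by simp [hull]

lemma exists_coords {s : Finset E} (hs : Ind s) : ∃ c : E → (E →ᵃ[ℝ] ℝ),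
    (∀ a ∈ s, c a a = 1) ∧ (∀ a, ∀ b ∈ s, a ≠ b → c a b = 0) ∧
    ∀ y, ∃ fs : Finset E, ∑ i ∈ fs, c i y = 1 ∧ ∑ i ∈ fs, c i y • i = y ∧ ∀ i ∉ fs, c i y = 0 := by
  have hs' : AffineIndependent ℝ (fun p : (s : Set E) => (p : E)) := hs
  obtain ⟨T, hsT, hT, htop⟩ := exists_subset_affineIndependent_affineSpan_eq_top hs'
  let b : AffineBasis T ℝ E := ⟨Subtype.val, hT, by simpa using htop⟩
  have hb : ∀ i : T, b i = i := fun i => rfl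
  let c : E → (E →ᵃ[ℝ] ℝ) := fun v => if h : v ∈ T then b.coord ⟨v, h⟩ else 0
  have hc : ∀ (i : T), c i = b.coord i := fun i => by simp [c, i.2]
  have hc0 : ∀ i, i ∉ T → c i = 0 := fun i h => by simp [c, h]
  refine ⟨c, ?_, ?_, ?_⟩
  · intro a ha
    have := b.coord_apply_eq ⟨a, hsT ha⟩
    rw [← hc, hb] at this
    exact this
  · intro a x hx hax
    by_cases ha : a ∈ T
    · have := b.coord_apply_ne (i := ⟨a, ha⟩) (j := ⟨x, hsT hx⟩) (by simpa using hax)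
      rw [← hc, hb] at this
      exact this
    · rw [hc0 a ha]; rfl
  · intro y
    have hy : y ∈ affineSpan ℝ (Set.range b) := by rw [b.tot]; trivial
    obtain ⟨fs, w, hw, rfl⟩ := eq_affineCombination_of_mem_affineSpan hy
    have h1 : ∀ i ∈ fs, c i (fs.affineCombination ℝ b w) = w i := fun i hi => by
      rw [hc, b.coord_apply_combination_of_mem hi hw]
    refine ⟨fs.map (Function.Embedding.subtype _), ?_, ?_, ?_⟩
    · rw [Finset.sum_map, ← hw]
      exact Finset.sum_congr rfl h1
    · rw [Finset.sum_map]
      conv_rhs => rw [Finset.affineCombination_eq_linear_combination _ _ _ hw]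
      exact Finset.sum_congr rfl (fun i hi => by
        rw [Function.Embedding.coe_subtype, h1 i hi, hb])
    · intro i hi
      by_cases hiT : i ∈ T
      · have : (⟨i, hiT⟩ : T) ∉ fs := fun h => hi (by simpa using ⟨hiT, h⟩)
        have := b.coord_apply_combination_of_notMem this hw
        rw [← hc] at this
        exact this
      · rw [hc0 i hiT]; rfl

/-- Barycentric coordinates with respect to an affinely independent set. -/
def co (s : Finset E) : E → (E →ᵃ[ℝ] ℝ) :=
  if hs : Ind s then (exists_coords hs).choose else fun _ => 0

lemma co_spec {s : Finset E} (hs : Ind s) :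
    (∀ a ∈ s, co s a a = 1) ∧ (∀ a, ∀ b ∈ s, a ≠ b → co s a b = 0) ∧
    ∀ y, ∃ fs : Finset E, ∑ i ∈ fs, co s i y = 1 ∧ ∑ i ∈ fs, co s i y • i = y ∧
      ∀ i ∉ fs, co s i y = 0 := by
  rw [co, dif_pos hs]
  exact (exists_coords hs).choose_spec

lemma co_same {s : Finset E} (hs : Ind s) {a} (ha : a ∈ s) : co s a a = 1 := (co_spec hs).1 a ha

lemma co_ne {s : Finset E} (hs : Ind s) {a b} (hb : b ∈ s) (h : a ≠ b) : co s a b = 0 :=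
  (co_spec hs).2.1 a b hb h

lemma co_sum {s : Finset E} (hs : Ind s) {x} (hx : ∀ a ∉ s, co s a x = 0) :
    ∑ a ∈ s, co s a x = 1 ∧ ∑ a ∈ s, co s a x • a = x := by
  obtain ⟨fs, h1, h2, h3⟩ := (co_spec hs).2.2 x
  have e1 : ∑ a ∈ s, co s a x = ∑ i ∈ fs, co s i x :=
    (Finset.sum_subset (Finset.subset_union_left (s₁ := s) (s₂ := fs)) (fun i _ hi => hx i hi)).trans
      (Finset.sum_subset (Finset.subset_union_right (s₁ := s) (s₂ := fs))
        (fun i _ hi => h3 i hi)).symm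
  have e2 : ∑ a ∈ s, co s a x • a = ∑ i ∈ fs, co s i x • i :=
    (Finset.sum_subset (Finset.subset_union_left (s₁ := s) (s₂ := fs))
      (fun i _ hi => by rw [hx i hi, zero_smul])).trans
      (Finset.sum_subset (Finset.subset_union_right (s₁ := s) (s₂ := fs))
        (fun i _ hi => by rw [h3 i hi, zero_smul])).symm
  exact ⟨e1.trans h1, e2.trans h2⟩

lemma aff_sum (h : E →ᵃ[ℝ] ℝ) {ι : Type*} (s : Finset ι) (w : ι → ℝ) (p : ι → E)
    (hw : ∑ i ∈ s, w i = 1) : h (∑ i ∈ s, w i • p i) = ∑ i ∈ s, w i * h (p i) := by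
  have := s.map_affineCombination p w hw h
  rw [Finset.affineCombination_eq_linear_combination _ _ _ hw,
    Finset.affineCombination_eq_linear_combination _ _ _ hw] at this
  simpa using this

lemma cvx_nonneg (h : E →ᵃ[ℝ] ℝ) : Convex ℝ {x | 0 ≤ h x} := by
  intro x hx y hy a b ha hb hab
  simp only [Set.mem_ofPred_eq] at *
  rw [affine_comb h x y hab]; positivity

lemma cvx_zero (h : E →ᵃ[ℝ] ℝ) : Convex ℝ {x | h x = 0} := by
  intro x hx y hy a b ha hb hab
  simp only [Set.mem_ofPred_eq] at *
  rw [affine_comb h x y hab, hx, hy]; simp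

lemma cvx_pos (h : E →ᵃ[ℝ] ℝ) : Convex ℝ {x | 0 < h x} := by
  intro x hx y hy a b ha hb hab
  simp only [Set.mem_ofPred_eq] at *
  rw [affine_comb h x y hab]
  rcases ha.eq_or_lt with rfl | ha'
  · have : b = 1 := by linarith
    subst this; linarith
  · have := mul_pos ha' hx
    have := mul_nonneg hb hy.le
    linarith

lemma mem_hull_iff {s : Finset E} (hs : Ind s) {x : E} :
    x ∈ hull s ↔ (∀ a ∉ s, co s a x = 0) ∧ ∀ a ∈ s, 0 ≤ co s a x := by
  constructor
  · intro hx
    refine ⟨fun a ha => ?_, fun a ha => ?_⟩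
    · exact hull_sub (cvx_zero (co s a)) (fun b hb => co_ne hs hb (fun h => ha (h ▸ hb))) hx
    · refine hull_sub (cvx_nonneg (co s a)) (fun b hb => ?_) hx
      by_cases h : a = b
      · subst h; rw [Set.mem_ofPred_eq, co_same hs ha]; norm_num
      · rw [Set.mem_ofPred_eq, co_ne hs hb h]
  · rintro ⟨h1, h2⟩
    obtain ⟨h3, h4⟩ := co_sum hs h1
    rw [← h4]
    exact (hull_convex s).sum_mem h2 h3 (fun i hi => subset_hull hi)

lemma mem_hull_sub_iff {s u : Finset E} (hs : Ind s) (hu : u ⊆ s) {x : E} :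
    x ∈ hull u ↔ x ∈ hull s ∧ ∀ a ∈ s, a ∉ u → co s a x = 0 := by
  constructor
  · intro hx
    refine ⟨hull_mono hu hx, fun a ha hau => ?_⟩
    exact hull_sub (cvx_zero (co s a)) (fun b hb => co_ne hs (hu hb) (fun h => hau (h ▸ hb))) hx
  · rintro ⟨h1, h2⟩
    obtain ⟨h3, h4⟩ := (mem_hull_iff hs).1 h1
    obtain ⟨h5, h6⟩ := co_sum hs h3
    rw [← Finset.sum_subset hu (fun i hi hi' => h2 i hi hi')] at h5
    rw [← Finset.sum_subset hu (fun i hi hi' => by rw [h2 i hi hi', zero_smul])] at h6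
    rw [← h6]
    exact (hull_convex u).sum_mem (fun i hi => h4 i (hu hi)) h5 (fun i hi => subset_hull hi)

/-- Relative interior of a simplex. -/
def ri (s : Finset E) : Set E := {x | x ∈ hull s ∧ ∀ a ∈ s, 0 < co s a x}

lemma Ind_mono {s u : Finset E} (hs : Ind s) (hu : u ⊆ s) : Ind u := by
  have := AffineIndependent.mono (k := ℝ) (s := (u : Set E)) (t := (s : Set E)) hs
    (by exact_mod_cast hu)
  exact this

lemma co_sub {s u : Finset E} (hs : Ind s) (hu : u ⊆ s) {x : E} (hx : x ∈ hull u) {a}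
    (ha : a ∈ u) : co u a x = co s a x := by
  have hu' := Ind_mono hs hu
  obtain ⟨h5, h6⟩ := co_sum hu' ((mem_hull_iff hu').1 hx).1
  conv_rhs => rw [← h6]
  rw [aff_sum _ _ _ _ h5, Finset.sum_eq_single a]
  · rw [co_same hs (hu ha), mul_one]
  · intro b hb hba
    rw [co_ne hs (hu hb) hba.symm, mul_zero]
  · intro h; exact absurd ha h

lemma exists_ri {s : Finset E} (hs : Ind s) {x} (hx : x ∈ hull s) :
    ∃ u ⊆ s, u.Nonempty ∧ x ∈ ri u := by
  have hx' := (mem_hull_iff hs).1 hx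
  have hxu : x ∈ hull (s.filter fun a => 0 < co s a x) := by
    rw [mem_hull_sub_iff hs (Finset.filter_subset _ _)]
    refine ⟨hx, fun a ha h => le_antisymm ?_ (hx'.2 a ha)⟩
    simpa [ha] using h
  refine ⟨s.filter fun a => 0 < co s a x, Finset.filter_subset _ _, ?_, hxu, ?_⟩
  · rw [Finset.nonempty_iff_ne_empty]
    intro h
    rw [h, hull_empty] at hxu
    exact hxu
  · intro a ha
    rw [co_sub hs (Finset.filter_subset _ _) hxu ha]
    exact (Finset.mem_filter.1 ha).2

lemma face_of_ri {t u f : Finset E} (ht : Ind t) (hu : u ⊆ t) (hf : Ind f)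
    (hft : ∀ a ∈ f, a ∈ hull t) {x} (hx : x ∈ ri f) (hxu : x ∈ hull u) : ∀ a ∈ f, a ∈ hull u := by
  intro a ha
  rw [mem_hull_sub_iff ht hu] at hxu ⊢
  refine ⟨hft a ha, fun b hb hbu => ?_⟩
  have h0 := hxu.2 b hb hbu
  obtain ⟨h5, h6⟩ := co_sum hf ((mem_hull_iff hf).1 hx.1).1
  rw [← h6, aff_sum _ _ _ _ h5] at h0
  rw [Finset.sum_eq_zero_iff_of_nonneg (fun i hi => mul_nonneg (hx.2 i hi).le
    (((mem_hull_iff ht).1 (hft i hi)).2 b hb))] at h0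
  rcases mul_eq_zero.1 (h0 a ha) with h | h
  · exact absurd h (hx.2 a ha).ne'
  · exact h

lemma POLY {s t : Finset E} (hs : Ind s) : ∃ l : List (E →ᵃ[ℝ] ℝ),
    ∀ x ∈ hull s, ∀ y ∈ hull t, (∀ h ∈ l, (0 ≤ h x → 0 ≤ h y) ∧ (h x ≤ 0 → h y ≤ 0)) →
      y ∈ hull s := by
  choose fs h1 h2 h3 using (co_spec hs).2.2
  refine ⟨((s ∪ t.biUnion fs).toList.map (co s)), fun x hx y hy hxy => ?_⟩
  have hx' := (mem_hull_iff hs).1 hx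
  rw [mem_hull_iff hs]
  have hl : ∀ a ∈ s ∪ t.biUnion fs,
      (0 ≤ co s a x → 0 ≤ co s a y) ∧ (co s a x ≤ 0 → co s a y ≤ 0) := fun a ha =>
    hxy _ (List.mem_map.2 ⟨a, by simpa using ha, rfl⟩)
  refine ⟨fun a ha => ?_, fun a ha => ?_⟩
  · by_cases h : a ∈ t.biUnion fs
    · obtain ⟨h4, h5⟩ := hl a (Finset.mem_union_right _ h)
      rw [hx'.1 a ha] at h4 h5
      exact le_antisymm (h5 le_rfl) (h4 le_rfl)
    · refine hull_sub (cvx_zero (co s a)) (fun b hb => ?_) hy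
      refine h3 b a (fun h' => h ?_)
      exact Finset.mem_biUnion.2 ⟨b, hb, h'⟩
  · exact (hl a (Finset.mem_union_left _ ha)).1 (hx'.2 a ha)

lemma Nv_add (I : Finset (Finset E)) (hI : ∀ s ∈ I, Ind s) (w : Finset E) (hw : w ∉ I)
    (hc : ∀ x ∈ hull w, ∃ i ∈ I, x ∈ hull i) (n : ℕ) :
    Hv (Nv hull ((insert w I : Finset (Finset E)) : Set (Finset E)) Set.univ) n ↔
      Hv (Nv hull (I : Set (Finset E)) Set.univ) n := by
  rw [Hv_vertex (Nv_DC _ _ _) w]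
  · have : {s ∈ Nv hull ((insert w I : Finset (Finset E)) : Set (Finset E)) Set.univ | w ∉ s} =
        Nv hull (I : Set (Finset E)) Set.univ := by
      ext J
      constructor
      · rintro ⟨⟨h1, h2⟩, h3⟩
        refine ⟨fun j hj => ?_, h2⟩
        have := h1 hj
        rw [Finset.coe_insert] at this
        rcases this with rfl | h
        · exact absurd hj h3
        · exact h
      · rintro ⟨h1, h2⟩
        refine ⟨⟨fun j hj => ?_, h2⟩, fun h => hw (h1 h)⟩
        rw [Finset.coe_insert]
        exact Or.inr (h1 hj)
    rw [this]
  · have : {J | w ∉ J ∧ insert w J ∈ Nv hull ((insert w I : Finset (Finset E)) : Set (Finset E))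
        Set.univ} = Nv hull (I : Set (Finset E)) (hull w) := by
      ext J
      constructor
      · rintro ⟨h3, h1, x, _, h2⟩
        refine ⟨fun j hj => ?_, x, h2 w (Finset.mem_insert_self _ _),
          fun j hj => h2 j (Finset.mem_insert_of_mem hj)⟩
        have := h1 (Finset.mem_coe.2 (Finset.mem_insert_of_mem hj))
        rw [Finset.coe_insert] at this
        rcases this with rfl | h
        · exact absurd hj h3
        · exact h
      · rintro ⟨h1, x, hx, h2⟩
        refine ⟨fun h => hw (h1 h), ?_, x, trivial, ?_⟩
        · rw [Finset.coe_insert, Finset.coe_insert]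
          exact Set.insert_subset_insert h1
        · intro j hj
          rcases Finset.mem_insert.1 hj with rfl | hj
          · exact hx
          · exact h2 j hj
    rw [this]
    have hp : ∀ s : Finset E, ∃ l : List (E →ᵃ[ℝ] ℝ), s ∈ I → ∀ x ∈ hull s, ∀ y ∈ hull w,
        (∀ h ∈ l, (0 ≤ h x → 0 ≤ h y) ∧ (h x ≤ 0 → h y ≤ 0)) → y ∈ hull s := by
      intro s
      by_cases hs : s ∈ I
      · obtain ⟨l, hl⟩ := POLY (t := w) (hI s hs)
        exact ⟨l, fun _ => hl⟩
      · exact ⟨[], fun h => absurd h hs⟩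
    choose l hl using hp
    refine Acyc_Nv hull _ (fun i _ => hull_convex i) (I.toList.flatMap l) (I.toList.flatMap l)
      (hull w) (hull_convex w) ?_ hc (fun h hh => Or.inl hh)
    intro i hi x hx hxi y hy hxy
    refine hl i hi x hxi y hy (fun h hh => hxy h ?_)
    exact List.mem_flatMap.2 ⟨i, by simpa using hi, hh⟩

lemma Nv_union (I : Finset (Finset E)) (hI : ∀ s ∈ I, Ind s) (J : Finset (Finset E))
    (hJ : ∀ s ∈ J, Ind s) (hc : ∀ w ∈ J, ∀ x ∈ hull w, ∃ i ∈ I, x ∈ hull i) (n : ℕ) :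
    Hv (Nv hull ((J ∪ I : Finset (Finset E)) : Set (Finset E)) Set.univ) n ↔
      Hv (Nv hull (I : Set (Finset E)) Set.univ) n := by
  induction J using Finset.induction_on with
  | empty => simp
  | insert w J hw ih =>
    rw [Finset.insert_union]
    have ih' := ih (fun s hs => hJ s (Finset.mem_insert_of_mem hs))
      (fun s hs => hc s (Finset.mem_insert_of_mem hs))
    by_cases h : w ∈ J ∪ I
    · rw [Finset.insert_eq_of_mem h]; exact ih'
    · rw [Nv_add _ _ w h, ih']
      · intro x hx
        obtain ⟨i, hi, hxi⟩ := hc w (Finset.mem_insert_self _ _) x hx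
        exact ⟨i, Finset.mem_union_right _ hi, hxi⟩
      · intro s hs
        rcases Finset.mem_union.1 hs with h | h
        · exact hJ s (Finset.mem_insert_of_mem h)
        · exact hI s h

end Geom

section GC

/-- The ambient space. -/
abbrev EE := ℕ → ℝ

lemma GComplex.ind (G : GComplex) {s} (hs : s ∈ G.faces) : Ind s := G.indep s hs

lemma GComplex.ext_ri (G : GComplex) {s t} (hs : s ∈ G.faces) (ht : t ∈ G.faces) {x : EE}
    (hx : x ∈ ri s) (hxt : x ∈ hull t) : s ⊆ t := by
  have h : x ∈ hull (s ∩ t) := by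
    have := G.glue s hs t ht
    have h2 : x ∈ hull s ∩ hull t := ⟨hx.1, hxt⟩
    unfold hull at h2 ⊢
    rw [this] at h2
    convert h2
  have h3 := (mem_hull_sub_iff (G.ind hs) Finset.inter_subset_left).1 h
  intro a ha
  by_contra hat
  exact (hx.2 a ha).ne' (h3.2 a ha (fun h => hat (Finset.mem_inter.1 h).2))

/-- Subdivision invariance of homology. -/
lemma Nv_vert (G : GComplex) (S : Finset (Finset EE)) (hS : S ⊆ G.faces) (hne : S.Nonempty)
    (hdc : ∀ s ∈ S, ∀ t ⊆ s, t.Nonempty → t ∈ S) (n : ℕ) :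
    Hv (Nv hull (S : Set (Finset EE)) Set.univ) n ↔ Hv {s | s ∈ S ∨ s = ∅} n := by
  have e1 : Nv hull (S : Set (Finset EE)) Set.univ =
      {J : Finset (Finset EE) | ∃ v, ∀ s ∈ J, s ∈ S ∧ v ∈ s} := by
    ext J
    constructor
    · rintro ⟨h1, x, _, h2⟩
      rcases J.eq_empty_or_nonempty with rfl | ⟨j, hj⟩
      · exact ⟨0, by simp⟩
      · obtain ⟨u, hu, hune, hxu⟩ := exists_ri (G.ind (hS (h1 hj))) (h2 j hj)
        have huG := G.down_closed j (hS (h1 hj)) u hu hune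
        obtain ⟨v, hv⟩ := hune
        exact ⟨v, fun s hs => ⟨h1 hs, G.ext_ri huG (hS (h1 hs)) hxu (h2 s hs) hv⟩⟩
    · rintro ⟨v, hv⟩
      exact ⟨fun s hs => (hv s hs).1, v, trivial, fun s hs => subset_hull (hv s hs).2⟩
  have e2 : {s : Finset EE | s ∈ S ∨ s = ∅} =
      {σ : Finset EE | ∃ s, ∀ v ∈ σ, s ∈ S ∧ v ∈ s} := by
    ext σ
    constructor
    · rintro (h | rfl)
      · exact ⟨σ, fun v hv => ⟨h, hv⟩⟩
      · exact ⟨∅, by simp⟩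
    · rintro ⟨s, hs⟩
      rcases σ.eq_empty_or_nonempty with rfl | hσ
      · exact Or.inr rfl
      · obtain ⟨v, hv⟩ := hσ
        exact Or.inl (hdc s (hs v hv).1 σ (fun w hw => (hs w hw).2) ⟨v, hv⟩)
  rw [e1, e2]
  obtain ⟨s0, hs0⟩ := hne
  have hs0' : s0.Nonempty := by
    rw [Finset.nonempty_iff_ne_empty]; rintro rfl; exact G.empty_not_mem (hS hs0)
  obtain ⟨v0, hv0⟩ := hs0'
  refine Dowker (fun s v => s ∈ S ∧ v ∈ s) S (S.biUnion id) ⟨s0, hs0⟩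
    ⟨v0, Finset.mem_biUnion.2 ⟨s0, hs0, hv0⟩⟩ (fun a b h => ⟨h.1, ?_⟩) n
  exact Finset.mem_biUnion.2 ⟨a, h.1, h.2⟩

lemma SUB (G G' : GComplex) (S S' : Finset (Finset EE)) (hS : S ⊆ G.faces) (hS' : S' ⊆ G'.faces)
    (hne : S.Nonempty) (hne' : S'.Nonempty)
    (hdc : ∀ s ∈ S, ∀ t ⊆ s, t.Nonempty → t ∈ S) (hdc' : ∀ s ∈ S', ∀ t ⊆ s, t.Nonempty → t ∈ S')
    (h1 : ∀ s ∈ S, ∀ x ∈ hull s, ∃ t ∈ S', x ∈ hull t)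
    (h2 : ∀ s ∈ S', ∀ x ∈ hull s, ∃ t ∈ S, x ∈ hull t) (n : ℕ) :
    Hv {s | s ∈ S ∨ s = ∅} n ↔ Hv {s | s ∈ S' ∨ s = ∅} n := by
  rw [← Nv_vert G S hS hne hdc, ← Nv_vert G' S' hS' hne' hdc',
    ← Nv_union S (fun s hs => G.ind (hS hs)) S' (fun s hs => G'.ind (hS' hs)) h2,
    ← Nv_union S' (fun s hs => G'.ind (hS' hs)) S (fun s hs => G.ind (hS hs)) h1,
    Finset.union_comm]

end GC
section Flats

variable {E : Type*} [AddCommGroup E] [Module ℝ E] [DecidableEq E]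

/-- Sets closed under taking lines. -/
def Flat (A : Set E) : Prop := ∀ x ∈ A, ∀ y ∈ A, ∀ c : ℝ, (1 - c) • x + c • y ∈ A

/-- The affine span of an affinely independent set, by equations. -/
def spn (s : Finset E) : Set E := {x | ∀ a ∉ s, co s a x = 0}

lemma spn_flat (s : Finset E) : Flat (spn s) := by
  intro x hx y hy c a ha
  rw [affine_comb _ x y (by ring), hx a ha, hy a ha]; ring

lemma spn_eq {s : Finset E} (hs : Ind s) : spn s = (affineSpan ℝ (s : Set E) : Set E) := by
  ext x
  constructor
  · intro hx
    obtain ⟨h1, h2⟩ := co_sum hs hx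
    rw [← h2, ← Finset.affineCombination_eq_linear_combination s (fun x => x) _ h1]
    have := affineCombination_mem_affineSpan_image (k := ℝ) (s := s) (w := fun a => co s a x)
      h1 (s' := (s : Set E)) (fun i hi hi' => absurd hi hi') (fun x : E => x)
    simpa using this
  · intro hx a ha
    refine affineSpan_induction (p := fun x => co s a x = 0) hx
      (fun x hx => co_ne hs hx (fun h => ha (h ▸ hx))) ?_
    intro c u v w hu hv hw
    rw [AffineMap.map_vadd, map_smul, AffineMap.linearMap_vsub, hu, hv, hw]
    simp

lemma affineSpan_flat (s : Set E) : Flat (affineSpan ℝ s : Set E) := by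
  intro x hx y hy c
  have := AffineMap.lineMap_mem c hx hy
  rwa [AffineMap.lineMap_apply_module] at this

lemma hull_spn {s : Finset E} (hs : Ind s) {x} (hx : x ∈ hull s) : x ∈ spn s :=
  ((mem_hull_iff hs).1 hx).1

lemma card_le_of_span {s t : Finset E} (hs : Ind s)
    (h : ∀ a ∈ s, a ∈ affineSpan ℝ (t : Set E)) : s.card ≤ t.card :=
  AffineIndependent.card_le_card_of_subset_affineSpan (k := ℝ) hs (fun a ha => h a ha)

lemma card_le_of_spn {s t : Finset E} (hs : Ind s) (ht : Ind t)
    (h : ∀ a ∈ s, a ∈ spn t) : s.card ≤ t.card :=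
  card_le_of_span hs (fun a ha => by have := h a ha; rw [spn_eq ht] at this; exact this)

lemma spn_sub {s t : Finset E} (hs : Ind s) (ht : Ind t) (h : ∀ a ∈ s, a ∈ spn t)
    (hc : s.card = t.card) : spn t ⊆ spn s := by
  rcases t.eq_empty_or_nonempty with rfl | htne
  · rw [Finset.card_empty, Finset.card_eq_zero] at hc; rw [hc]
  have hle : affineSpan ℝ (s : Set E) ≤ affineSpan ℝ (t : Set E) := by
    rw [affineSpan_le]
    intro a ha
    rw [← spn_eq ht]; exact h a ha
  have hs' : AffineIndependent ℝ (fun x : (s : Set E) => (x : E)) := hs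
  have ht' : AffineIndependent ℝ (fun x : (t : Set E) => (x : E)) := ht
  have hpos : 0 < t.card := htne.card_pos
  have hfd : FiniteDimensional ℝ (affineSpan ℝ (t : Set E)).direction :=
    finiteDimensional_direction_affineSpan_of_finite ℝ t.finite_toSet
  have hr : Module.finrank ℝ (affineSpan ℝ (t : Set E)).direction = t.card - 1 := by
    rw [direction_affineSpan]
    have := ht'.finrank_vectorSpan (n := t.card - 1) (by simp; omega)
    rwa [Subtype.range_coe] at this
  have := hs'.affineSpan_eq_of_le_of_card_eq_finrank_add_one (sp := affineSpan ℝ (t : Set E))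
    (by rw [Subtype.range_coe]; exact hle) (by rw [hr]; simp; omega)
  rw [Subtype.range_coe] at this
  rw [spn_eq hs, spn_eq ht, this]

lemma flat_line {A : Set E} (hA : Flat A) {x y : E} {c d : ℝ} (hcd : c ≠ d)
    (hc : (1 - c) • x + c • y ∈ A) (hd : (1 - d) • x + d • y ∈ A) (e : ℝ) :
    (1 - e) • x + e • y ∈ A := by
  have h := hA _ hc _ hd ((e - c) / (d - c))
  have hne : d - c ≠ 0 := sub_ne_zero.2 hcd.symm
  convert h using 1
  rw [smul_add, smul_add, smul_smul, smul_smul, smul_smul, smul_smul]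
  have : ∀ (p q r s : ℝ), (p • x + q • y) + (r • x + s • y) = (p + r) • x + (q + s) • y := by
    intro p q r s; module
  rw [this]
  congr 2
  · field_simp; ring
  · field_simp; ring

/-- Generic points: a convex set is not covered by proper flats. -/
lemma COV {Q : Set E} (hQ : Convex ℝ Q) (hne : Q.Nonempty) {ι : Type*} (I : Finset ι)
    (A : ι → Set E) (hA : ∀ i ∈ I, Flat (A i)) : ∃ x ∈ Q, ∀ i ∈ I, x ∈ A i → Q ⊆ A i := by
  classical
  induction I using Finset.induction_on with
  | empty => obtain ⟨x, hx⟩ := hne; exact ⟨x, hx, by simp⟩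
  | insert j I hj ih =>
    obtain ⟨x, hx, hxI⟩ := ih (fun i hi => hA i (Finset.mem_insert_of_mem hi))
    by_cases hxj : x ∈ A j → Q ⊆ A j
    · exact ⟨x, hx, by simpa using ⟨hxj, hxI⟩⟩
    · push Not at hxj
      obtain ⟨hxj, hnot⟩ := hxj
      rw [Set.not_subset] at hnot
      obtain ⟨y, hy, hyj⟩ := hnot
      have hfin : (⋃ i ∈ {i ∈ I | x ∉ A i}, {c : ℝ | (1 - c) • x + c • y ∈ A i}).Finite := by
        refine Set.Finite.biUnion (Finset.finite_toSet _) (fun i hi => ?_)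
        apply Set.Subsingleton.finite
        intro c hc d hd
        by_contra hcd
        obtain ⟨hiI, hxi⟩ := Finset.mem_filter.1 (Finset.mem_coe.1 hi)
        have := flat_line (hA i (Finset.mem_insert_of_mem hiI)) hcd hc hd 0
        simp at this
        exact hxi this
      obtain ⟨c, hc, hcn⟩ := (Set.Ioo_infinite (show (0 : ℝ) < 1 by norm_num)).exists_notMem_finite
        hfin
      refine ⟨(1 - c) • x + c • y, hQ hx hy (by linarith [hc.2]) hc.1.le (by ring), ?_⟩
      intro i hi hci
      rcases Finset.mem_insert.1 hi with rfl | hiI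
      · exfalso
        apply hyj
        have := flat_line (hA i (Finset.mem_insert_self _ _)) (x := x) (y := y) hc.1.ne
          (by simpa using hxj) hci 1
        simpa using this
      · by_cases hxi : x ∈ A i
        · exact hxI i hiI hxi
        · exfalso
          apply hcn
          simp only [Set.mem_iUnion]
          exact ⟨i, by simp [hiI, hxi], hci⟩

/-- Open polyhedral sets. -/
def WW (l : List (E →ᵃ[ℝ] ℝ)) : Set E := {x | ∀ h ∈ l, 0 < h x}

lemma WW_convex (l : List (E →ᵃ[ℝ] ℝ)) : Convex ℝ (WW l) := by
  intro x hx y hy a b ha hb hab h hh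
  exact cvx_pos h (hx h hh) (hy h hh) ha hb hab

lemma WW_open (l : List (E →ᵃ[ℝ] ℝ)) {x : E} (hx : x ∈ WW l) (y : E) :
    ∃ ε : ℝ, 0 < ε ∧ ε < 1 ∧ ∀ δ : ℝ, |δ| ≤ ε → (1 - δ) • x + δ • y ∈ WW l := by
  induction l with
  | nil => exact ⟨1/2, by norm_num, by norm_num, fun δ _ h hh => by simp at hh⟩
  | cons h l ih =>
    obtain ⟨ε, h0, h1, h2⟩ := ih (fun g hg => hx g (List.mem_cons_of_mem _ hg))
    have hpos : 0 < h x := hx h List.mem_cons_self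
    have hden : 0 < |h y - h x| + 1 := by positivity
    refine ⟨min ε (h x / (2 * (|h y - h x| + 1))), lt_min h0 (by positivity),
      lt_of_le_of_lt (min_le_left _ _) h1, ?_⟩
    intro δ hδ g hg
    rcases List.mem_cons.1 hg with rfl | hg
    · rw [affine_comb _ x y (by ring)]
      have hδ2 := hδ.trans (min_le_right _ _)
      rw [le_div_iff₀ (by positivity)] at hδ2
      have h3 : |δ * (g y - g x)| ≤ |δ| * (|g y - g x| + 1) := by
        rw [abs_mul]
        exact mul_le_mul_of_nonneg_left (by linarith) (abs_nonneg _)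
      have h4 := neg_abs_le (δ * (g y - g x))
      nlinarith
    · exact h2 δ (hδ.trans (min_le_left _ _)) g hg

lemma ri_iff {s : Finset E} (hs : Ind s) {x} :
    x ∈ ri s ↔ x ∈ spn s ∧ x ∈ WW (s.toList.map (co s)) := by
  constructor
  · rintro ⟨h1, h2⟩
    refine ⟨hull_spn hs h1, fun h hh => ?_⟩
    obtain ⟨a, ha, rfl⟩ := List.mem_map.1 hh
    exact h2 a (by simpa using ha)
  · rintro ⟨h1, h2⟩
    have h3 : ∀ a ∈ s, 0 < co s a x := fun a ha =>
      h2 _ (List.mem_map.2 ⟨a, by simpa using ha, rfl⟩)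
    exact ⟨(mem_hull_iff hs).2 ⟨h1, fun a ha => (h3 a ha).le⟩, h3⟩

lemma ri_convex {s : Finset E} (hs : Ind s) : Convex ℝ (ri s) := by
  intro x hx y hy a b ha hb hab
  rw [ri_iff hs] at *
  refine ⟨?_, WW_convex _ hx.2 hy.2 ha hb hab⟩
  have := spn_flat s x hx.1 y hy.1 b
  rwa [show 1 - b = a by linarith] at this

lemma riW_open {s : Finset E} (hs : Ind s) (l : List (E →ᵃ[ℝ] ℝ)) {x : E} (hx : x ∈ ri s)
    (hxl : x ∈ WW l) {y : E} (hy : y ∈ spn s) :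
    ∃ ε : ℝ, 0 < ε ∧ ε < 1 ∧ ∀ δ : ℝ, |δ| ≤ ε →
      (1 - δ) • x + δ • y ∈ ri s ∧ (1 - δ) • x + δ • y ∈ WW l := by
  have hx' := (ri_iff hs).1 hx
  obtain ⟨ε, h0, h1, h2⟩ := WW_open (s.toList.map (co s) ++ l) (x := x) (by
    intro h hh
    rcases List.mem_append.1 hh with hh | hh
    · exact hx'.2 h hh
    · exact hxl h hh) y
  refine ⟨ε, h0, h1, fun δ hδ => ?_⟩
  have h3 := h2 δ hδ
  refine ⟨(ri_iff hs).2 ⟨spn_flat s x hx'.1 y hy δ, fun h hh => ?_⟩, fun h hh => ?_⟩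
  · exact h3 h (List.mem_append_left _ hh)
  · exact h3 h (List.mem_append_right _ hh)

lemma ri_nonempty {s : Finset E} (hs : Ind s) (hne : s.Nonempty) : (ri s).Nonempty := by
  have hc : (0 : ℝ) < s.card := by exact_mod_cast hne.card_pos
  have hsum : ∑ _i ∈ s, (1 / (s.card : ℝ)) = 1 := by
    rw [Finset.sum_const, nsmul_eq_mul]; field_simp
  refine ⟨∑ a ∈ s, (1 / (s.card : ℝ)) • a, ?_, ?_⟩
  · exact (hull_convex s).sum_mem (fun i _ => by positivity) hsum (fun i hi => subset_hull hi)
  · intro a ha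
    rw [aff_sum (co s a) s (fun _ => 1 / (s.card : ℝ)) (fun x => x) hsum,
      Finset.sum_eq_single a]
    · rw [co_same hs ha]; positivity
    · intro b hb hba
      rw [co_ne hs hb hba.symm, mul_zero]
    · intro h; exact absurd ha h

/-- Mixing a point of the relative interior with a point of the hull. -/
lemma ri_mix {s : Finset E} (hs : Ind s) {x y : E} (hx : x ∈ ri s) (hy : y ∈ hull s) {c : ℝ}
    (h0 : 0 < c) (h1 : c ≤ 1) : (1 - c) • y + c • x ∈ ri s := by
  refine ⟨hull_convex s hy hx.1 (by linarith) h0.le (by ring), fun a ha => ?_⟩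
  rw [affine_comb _ _ _ (by ring)]
  have h2 := ((mem_hull_iff hs).1 hy).2 a ha
  have h3 := hx.2 a ha
  have h4 := mul_pos h0 h3
  have h5 := mul_nonneg (show 0 ≤ 1 - c by linarith) h2
  linarith

lemma ri_W_nonempty {s : Finset E} (hs : Ind s) (l : List (E →ᵃ[ℝ] ℝ)) {a : E} (ha : a ∈ hull s)
    (hal : a ∈ WW l) : (ri s ∩ WW l).Nonempty := by
  have hne : s.Nonempty := by
    rw [Finset.nonempty_iff_ne_empty]; rintro rfl; rw [hull_empty] at ha; exact ha
  obtain ⟨x, hx⟩ := ri_nonempty hs hne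
  obtain ⟨ε, h0, h1, h2⟩ := WW_open l hal x
  exact ⟨_, ri_mix hs hx ha h0 h1.le, h2 ε (by rw [abs_of_pos h0])⟩

lemma SPAN {s : Finset E} (hs : Ind s) (l : List (E →ᵃ[ℝ] ℝ)) (hne : (ri s ∩ WW l).Nonempty)
    {A : Set E} (hA : Flat A) (h : ri s ∩ WW l ⊆ A) : ∀ v ∈ s, v ∈ A := by
  intro v hv
  obtain ⟨x, hx, hxl⟩ := hne
  obtain ⟨ε, h0, h1, h2⟩ := riW_open hs l hx hxl (hull_spn hs (subset_hull hv))
  have h3 := h (h2 ε (by rw [abs_of_pos h0]))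
  have h4 := h ⟨hx, hxl⟩
  have := flat_line hA (x := x) (y := v) h0.ne (by simpa using h4) h3 1
  simpa using this

lemma separate {g : Finset E} (hg : Ind g) {p : E} (hp : p ∉ hull g) :
    ∃ h : E →ᵃ[ℝ] ℝ, 0 < h p ∧ ∀ x ∈ hull g, ¬ 0 < h x := by
  rw [mem_hull_iff hg] at hp
  by_cases h1 : ∀ a ∉ g, co g a p = 0
  · have : ∃ a ∈ g, co g a p < 0 := by
      by_contra hcon
      push Not at hcon
      exact hp ⟨h1, hcon⟩
    obtain ⟨a, ha, hap⟩ := this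
    refine ⟨-co g a, by simpa using hap, fun x hx => ?_⟩
    have := ((mem_hull_iff hg).1 hx).2 a ha
    simpa using this
  · push Not at h1
    obtain ⟨a, ha, hap⟩ := h1
    rcases lt_or_gt_of_ne hap with h | h
    · refine ⟨-co g a, by simpa using h, fun x hx => ?_⟩
      have := ((mem_hull_iff hg).1 hx).1 a ha
      simp [this]
    · refine ⟨co g a, h, fun x hx => ?_⟩
      have := ((mem_hull_iff hg).1 hx).1 a ha
      simp [this]

lemma overlap_pt {r : Finset E} {b1 b2 : E} (h1 : b1 ∉ r) (h2 : b2 ∉ r) (hf1 : Ind (insert b1 r))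
    (hf2 : Ind (insert b2 r)) (hb : b1 ∈ spn (insert b2 r)) (hpos : 0 < co (insert b2 r) b2 b1) :
    ∃ x, x ∈ ri (insert b1 r) ∧ x ∈ hull (insert b2 r) := by
  rcases r.eq_empty_or_nonempty with rfl | hne
  · obtain ⟨x, hx⟩ := ri_nonempty hf1 (by simp)
    obtain ⟨h5, h6⟩ := co_sum hf2 hb
    simp only [insert_empty_eq, Finset.sum_singleton] at h5 h6
    rw [h5, one_smul] at h6
    subst h6
    exact ⟨x, hx, hx.1⟩
  · have hr : Ind r := Ind_mono hf1 (Finset.subset_insert _ _)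
    obtain ⟨x, hx⟩ := ri_nonempty hr hne
    have hx1 : x ∈ hull (insert b1 r) := hull_mono (Finset.subset_insert _ _) hx.1
    have hx2 : x ∈ hull (insert b2 r) := hull_mono (Finset.subset_insert _ _) hx.1
    obtain ⟨ε, e0, e1, e2⟩ := WW_open (r.toList.map (co (insert b2 r))) (x := x) (by
      intro h hh
      obtain ⟨a, ha, rfl⟩ := List.mem_map.1 hh
      have ha' : a ∈ r := by simpa using ha
      rw [← co_sub hf2 (Finset.subset_insert _ _) hx.1 ha']
      exact hx.2 a ha') b1
    refine ⟨(1 - ε) • x + ε • b1, ⟨?_, ?_⟩, ?_⟩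
    · exact hull_convex _ hx1 (subset_hull (Finset.mem_insert_self _ _)) (by linarith) e0.le
        (by ring)
    · intro a ha
      rw [affine_comb _ _ _ (by ring)]
      rcases Finset.mem_insert.1 ha with rfl | ha'
      · rw [co_same hf1 (Finset.mem_insert_self _ _)]
        have := ((mem_hull_iff hf1).1 hx1).2 a ha
        have := mul_nonneg (show 0 ≤ 1 - ε by linarith) this
        linarith
      · rw [co_ne hf1 (Finset.mem_insert_self _ _) (fun h => h1 (h ▸ ha')),
          ← co_sub hf1 (Finset.subset_insert _ _) hx.1 ha']
        have := mul_pos (show 0 < 1 - ε by linarith) (hx.2 a ha')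
        linarith
    · rw [mem_hull_iff hf2]
      refine ⟨spn_flat _ x (hull_spn hf2 hx2) b1 hb ε, fun a ha => ?_⟩
      rcases Finset.mem_insert.1 ha with rfl | ha'
      · rw [affine_comb _ _ _ (by ring)]
        have := ((mem_hull_iff hf2).1 hx2).2 a ha
        have := mul_nonneg (show 0 ≤ 1 - ε by linarith) this
        have := mul_pos e0 hpos
        linarith
      · refine (e2 ε (by rw [abs_of_pos e0]) _ (List.mem_map.2 ⟨a, by simpa using ha', rfl⟩)).le

/-- Evaluate an affine map vanishing on `r` on the span of `insert b r`. -/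
lemma eval_off {r : Finset E} {b : E} (hb : b ∉ r) (hf : Ind (insert b r)) (h : E →ᵃ[ℝ] ℝ)
    (hr : ∀ a ∈ r, h a = 0) {x} (hx : x ∈ spn (insert b r)) :
    h x = co (insert b r) b x * h b := by
  obtain ⟨h5, h6⟩ := co_sum hf hx
  conv_lhs => rw [← h6]
  rw [aff_sum _ _ _ _ h5, Finset.sum_insert hb, Finset.sum_eq_zero, add_zero]
  intro a ha
  rw [hr a ha, mul_zero]

end Flats
section CSubDef

/-- Combinatorial properties of the carrier map of a subdivision. -/
structure CSub {α β : Type*} [DecidableEq α] [DecidableEq β] (n : ℕ) (S : Finset (Finset α))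
    (S' : Finset (Finset β)) (φ : Finset β → Finset α) : Prop where
  emp : φ ∅ = ∅
  mem : ∀ f ∈ S', φ f ∈ S
  mono : ∀ g ∈ S', ∀ f ⊆ g, φ f ⊆ φ g
  card : ∀ f ∈ S', f.card ≤ (φ f).card
  dim : ∀ t ∈ S, t.card ≤ n + 1
  g1 : ∀ s', (s' ∈ S' ∨ s' = ∅) → ∀ t ∈ S, φ s' ⊆ t → ∃ f ∈ S', s' ⊆ f ∧ φ f = t ∧ f.card = t.card
  g2a : ∀ r ∈ S', r.card = n → (φ r).card = n + 1 →
    ∃ f1 f2, f1 ≠ f2 ∧ ∀ f, (f ∈ S' ∧ r ⊆ f ∧ f.card = n + 1) ↔ (f = f1 ∨ f = f2)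
  g2b : ∀ r, (r ∈ S' ∨ r = ∅) → r.card = n → (φ r).card = n → ∀ t ∈ S, φ r ⊆ t → t.card = n + 1 →
    ∀ f1 ∈ S', ∀ f2 ∈ S', r ⊆ f1 → r ⊆ f2 → f1.card = n + 1 → f2.card = n + 1 →
      φ f1 = t → φ f2 = t → f1 = f2
  g3 : ∀ s', (s' ∈ S' ∨ s' = ∅) → ∀ t ∈ S, t.card = n + 1 → ∀ z : Finset β → ZMod 2,
    (∀ r ∈ S', s' ⊆ r → r.card = n → φ r = t → ∀ f1 ∈ S', ∀ f2 ∈ S', r ⊆ f1 → r ⊆ f2 →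
      f1.card = n + 1 → f2.card = n + 1 → φ f1 = t → φ f2 = t → z f1 = z f2) →
    ∀ f1 ∈ S', ∀ f2 ∈ S', s' ⊆ f1 → s' ⊆ f2 →
      f1.card = n + 1 → f2.card = n + 1 → φ f1 = t → φ f2 = t → z f1 = z f2

end CSubDef

section Carrier

variable {G G' : GComplex}

lemma GComplex.face_ne (G : GComplex) {s} (hs : s ∈ G.faces) : s.Nonempty := by
  rw [Finset.nonempty_iff_ne_empty]; rintro rfl; exact G.empty_not_mem hs

lemma exists_carrier (h : Subdivides G' G) {f} (hf : f ∈ G'.faces) :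
    ∃ t ∈ G.faces, (∀ a ∈ f, a ∈ hull t) ∧ ∀ x ∈ ri f, x ∈ ri t := by
  obtain ⟨t0, ht0, hft0⟩ := h.2 f hf
  have hft : ∀ a ∈ f, a ∈ hull t0 := fun a ha => hft0 (subset_hull ha)
  obtain ⟨x, hx⟩ := ri_nonempty (G'.ind hf) (G'.face_ne hf)
  obtain ⟨u, hu, hune, hxu⟩ := exists_ri (G.ind ht0) (hull_sub (hull_convex t0) hft hx.1)
  have huG := G.down_closed t0 ht0 u hu hune
  have hfu := face_of_ri (G.ind ht0) hu (G'.ind hf) hft hx hxu.1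
  refine ⟨u, huG, hfu, fun y hy => ⟨hull_sub (hull_convex u) hfu hy.1, fun a ha => ?_⟩⟩
  have hnn := ((mem_hull_iff (G.ind huG)).1 (hull_sub (hull_convex u) hfu hy.1)).2 a ha
  refine lt_of_le_of_ne hnn (fun h0 => ?_)
  have hy0 : y ∈ hull (u.erase a) := by
    rw [mem_hull_sub_iff (G.ind huG) (Finset.erase_subset _ _)]
    refine ⟨hull_sub (hull_convex u) hfu hy.1, fun b hb hb' => ?_⟩
    have : b = a := by
      by_contra hne; exact hb' (Finset.mem_erase.2 ⟨hne, hb⟩)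
    rw [this, ← h0]
  have h1 := face_of_ri (G.ind huG) (Finset.erase_subset a u) (G'.ind hf) hfu hy hy0
  have h2 := hull_sub (hull_convex _) h1 hx.1
  rw [mem_hull_sub_iff (G.ind huG) (Finset.erase_subset _ _)] at h2
  exact (hxu.2 a ha).ne' (h2.2 a ha (by simp))

/-- The carrier map. -/
def car (h : Subdivides G' G) (f : Finset EE) : Finset EE :=
  if hf : f ∈ G'.faces then (exists_carrier h hf).choose else ∅

variable (h : Subdivides G' G)

lemma car_emp : car h ∅ = ∅ := by
  rw [car, dif_neg G'.empty_not_mem]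

lemma car_spec {f} (hf : f ∈ G'.faces) :
    car h f ∈ G.faces ∧ (∀ a ∈ f, a ∈ hull (car h f)) ∧ ∀ x ∈ ri f, x ∈ ri (car h f) := by
  rw [car, dif_pos hf]
  exact (exists_carrier h hf).choose_spec

lemma car_le {f} (hf : f ∈ G'.faces ∨ f = ∅) {t} (ht : t ∈ G.faces) :
    (∀ a ∈ f, a ∈ hull t) ↔ car h f ⊆ t := by
  rcases hf with hf | rfl
  · obtain ⟨h1, h2, h3⟩ := car_spec h hf
    constructor
    · intro h4
      obtain ⟨x, hx⟩ := ri_nonempty (G'.ind hf) (G'.face_ne hf)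
      exact G.ext_ri h1 ht (h3 x hx) (hull_sub (hull_convex t) h4 hx.1)
    · intro h4 a ha
      exact hull_mono h4 (h2 a ha)
  · rw [car_emp]; simp

lemma car_mono {g} (hg : g ∈ G'.faces) {f} (hfg : f ⊆ g) : car h f ⊆ car h g := by
  rcases f.eq_empty_or_nonempty with rfl | hne
  · rw [car_emp]; simp
  · obtain ⟨h1, h2, h3⟩ := car_spec h hg
    rw [← car_le h (Or.inl (G'.down_closed g hg f hfg hne)) h1]
    exact fun a ha => h2 a (hfg ha)

lemma car_card {f} (hf : f ∈ G'.faces) : f.card ≤ (car h f).card := by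
  obtain ⟨h1, h2, h3⟩ := car_spec h hf
  exact card_le_of_spn (G'.ind hf) (G.ind h1) (fun a ha => hull_spn (G.ind h1) (h2 a ha))

lemma car_of_ri {t} (ht : t ∈ G.faces) {x} (hx : x ∈ ri t) :
    ∃ f ∈ G'.faces, x ∈ ri f ∧ car h f = t := by
  have hxc : x ∈ G'.carrier := by
    rw [h.1]
    exact Set.mem_biUnion (show t ∈ (G.faces : Set (Finset EE)) from ht) hx.1
  obtain ⟨g, hg, hxg⟩ := Set.mem_iUnion₂.1 hxc
  obtain ⟨f, hfg, hne, hxf⟩ := exists_ri (G'.ind hg) (show x ∈ hull g from hxg)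
  have hf := G'.down_closed g hg f hfg hne
  obtain ⟨h1, h2, h3⟩ := car_spec h hf
  refine ⟨f, hf, hxf, ?_⟩
  exact Finset.Subset.antisymm (G.ext_ri h1 ht (h3 x hxf) hx.1)
    (G.ext_ri ht h1 hx (h3 x hxf).1)

lemma car_cover {t} (ht : t ∈ G.faces) {x} (hx : x ∈ hull t) :
    ∃ f ∈ G'.faces, x ∈ hull f ∧ car h f ⊆ t := by
  obtain ⟨u, hu, hne, hxu⟩ := exists_ri (G.ind ht) hx
  obtain ⟨f, hf, hxf, rfl⟩ := car_of_ri h (G.down_closed t ht u hu hne) hxu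
  exact ⟨f, hf, hxf.1, hu⟩

lemma W_exists {s : Finset EE} (hs : s ∈ G'.faces ∨ s = ∅) : ∃ l : List (EE →ᵃ[ℝ] ℝ),
    (∀ g ∈ G'.faces, ∀ x ∈ hull g, x ∈ WW l → s ⊆ g) ∧
    ∀ Q : Set EE, Convex ℝ Q → Q.Nonempty → (∀ a ∈ s, a ∈ Q) → (Q ∩ WW l).Nonempty := by
  rcases hs with hs | rfl
  · obtain ⟨p, hp⟩ := ri_nonempty (G'.ind hs) (G'.face_ne hs)
    have : ∀ g : Finset EE, ∃ k : EE →ᵃ[ℝ] ℝ, 0 < k p ∧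
        (g ∈ G'.faces → p ∉ hull g → ∀ x ∈ hull g, ¬ 0 < k x) := by
      intro g
      by_cases hg : g ∈ G'.faces ∧ p ∉ hull g
      · obtain ⟨k, h1, h2⟩ := separate (G'.ind hg.1) hg.2
        exact ⟨k, h1, fun _ _ => h2⟩
      · exact ⟨AffineMap.const ℝ EE 1, by simp, fun h1 h2 => absurd ⟨h1, h2⟩ hg⟩
    choose k hk1 hk2 using this
    refine ⟨G'.faces.toList.map k, ?_, ?_⟩
    · intro g hg x hx hxW
      by_cases hpg : p ∈ hull g
      · exact G'.ext_ri hs hg hp hpg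
      · exact absurd (hxW (k g) (List.mem_map.2 ⟨g, by simpa using hg, rfl⟩)) (hk2 g hg hpg x hx)
    · intro Q hQ _ hsQ
      refine ⟨p, hull_sub hQ hsQ hp.1, ?_⟩
      intro h hh
      obtain ⟨g, _, rfl⟩ := List.mem_map.1 hh
      exact hk1 g
  · refine ⟨[], by simp, fun Q _ hne _ => ?_⟩
    obtain ⟨x, hx⟩ := hne
    exact ⟨x, hx, by intro h hh; simp at hh⟩

lemma hull_nonempty {s : Finset EE} (hs : s.Nonempty) : (hull s).Nonempty := by
  obtain ⟨a, ha⟩ := hs; exact ⟨a, subset_hull ha⟩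

lemma sub_g1 {s : Finset EE} (hs : s ∈ G'.faces ∨ s = ∅) {t} (ht : t ∈ G.faces)
    (hst : car h s ⊆ t) : ∃ f ∈ G'.faces, s ⊆ f ∧ car h f = t ∧ f.card = t.card := by
  rw [← car_le h hs ht] at hst
  obtain ⟨l, hl1, hl2⟩ := W_exists hs
  obtain ⟨a, ha, hal⟩ := hl2 (hull t) (hull_convex t) (hull_nonempty (G.face_ne ht)) hst
  have hne := ri_W_nonempty (G.ind ht) l ha hal
  obtain ⟨x, hx, hgen⟩ := COV ((ri_convex (G.ind ht)).inter (WW_convex l)) hne G'.faces spn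
    (fun i _ => spn_flat i)
  obtain ⟨f, hf, hxf, hft⟩ := car_of_ri h ht hx.1
  refine ⟨f, hf, hl1 f hf x hxf.1 hx.2, hft, ?_⟩
  have hsub := hgen f hf (hull_spn (G'.ind hf) hxf.1)
  have := SPAN (G.ind ht) l hne (spn_flat f) hsub
  refine le_antisymm ?_ (card_le_of_spn (G.ind ht) (G'.ind hf) this)
  rw [← hft]; exact car_card h hf

lemma sub_span {f} (hf : f ∈ G'.faces) (hc : f.card = (car h f).card) {x}
    (hx : x ∈ hull (car h f)) : x ∈ spn f := by
  obtain ⟨h1, h2, h3⟩ := car_spec h hf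
  exact spn_sub (G'.ind hf) (G.ind h1) (fun a ha => hull_spn (G.ind h1) (h2 a ha)) hc
    (hull_spn (G.ind h1) hx)

lemma exists_insert {r f : Finset EE} {n : ℕ} (hrf : r ⊆ f) (hr : r.card = n)
    (hf : f.card = n + 1) : ∃ b, b ∉ r ∧ f = insert b r := by
  have : (f \ r).card = 1 := by
    rw [Finset.card_sdiff_of_subset hrf]; omega
  obtain ⟨b, hb⟩ := Finset.card_eq_one.1 this
  have hb' : b ∈ f \ r := by rw [hb]; simp
  refine ⟨b, (Finset.mem_sdiff.1 hb').2, ?_⟩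
  rw [← Finset.sdiff_union_of_subset hrf, hb]; rfl

lemma overlap {r : Finset EE} {b1 b2 : EE} (h1 : b1 ∉ r) (h2 : b2 ∉ r)
    (hf1 : insert b1 r ∈ G'.faces) (hf2 : insert b2 r ∈ G'.faces) (hb : b1 ∈ spn (insert b2 r))
    (hpos : 0 < co (insert b2 r) b2 b1) : insert b1 r = insert b2 r := by
  obtain ⟨x, hx1, hx2⟩ := overlap_pt h1 h2 (G'.ind hf1) (G'.ind hf2) hb hpos
  refine Finset.eq_of_subset_of_card_le (G'.ext_ri hf1 hf2 hx1 hx2) ?_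
  rw [Finset.card_insert_of_notMem h1, Finset.card_insert_of_notMem h2]

lemma sub_g2b {n : ℕ} {r : Finset EE} (hr : r ∈ G'.faces ∨ r = ∅) (hrn : r.card = n)
    (hcn : (car h r).card = n) {t} (ht : t ∈ G.faces) (hrt : car h r ⊆ t) (htn : t.card = n + 1)
    {f1 f2} (hf1 : f1 ∈ G'.faces) (hf2 : f2 ∈ G'.faces) (hr1 : r ⊆ f1) (hr2 : r ⊆ f2)
    (hc1 : f1.card = n + 1) (hc2 : f2.card = n + 1) (e1 : car h f1 = t) (e2 : car h f2 = t) :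
    f1 = f2 := by
  obtain ⟨b1, hb1, rfl⟩ := exists_insert hr1 hrn hc1
  obtain ⟨b2, hb2, rfl⟩ := exists_insert hr2 hrn hc2
  obtain ⟨a, ha, hta⟩ := exists_insert hrt hcn htn
  have hat : a ∈ t := by rw [hta]; simp
  have hru : ∀ x ∈ r, x ∈ hull (car h r) := by
    rcases hr with hr | rfl
    · exact (car_spec h hr).2.1
    · simp
  have hz : ∀ x ∈ r, co t a x = 0 := fun x hx =>
    ((mem_hull_sub_iff (G.ind ht) hrt).1 (hru x hx)).2 a hat ha
  have key : ∀ b, insert b r ∈ G'.faces → car h (insert b r) = t → b ∉ r → 0 < co t a b := by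
    intro b hf e hb
    have hin := (car_spec h hf).2.1
    rw [e] at hin
    have hbt := hin b (Finset.mem_insert_self _ _)
    refine lt_of_le_of_ne (((mem_hull_iff (G.ind ht)).1 hbt).2 a hat) (fun h0 => ?_)
    obtain ⟨x, hx⟩ := ri_nonempty (G'.ind hf) (G'.face_ne hf)
    have hx2 := (car_spec h hf).2.2 x hx
    rw [e] at hx2
    have hall : ∀ y ∈ insert b r, co t a y = 0 := by
      intro y hy
      rcases Finset.mem_insert.1 hy with rfl | hy
      · exact h0.symm
      · exact hz y hy
    exact (hx2.2 a hat).ne' (hull_sub (cvx_zero (co t a)) hall hx.1)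
  have k1 := key b1 hf1 e1 hb1
  have k2 := key b2 hf2 e2 hb2
  have hsp : b1 ∈ spn (insert b2 r) := by
    apply sub_span h hf2 (by rw [hc2, e2, htn])
    rw [e2, ← e1]
    exact (car_spec h hf1).2.1 b1 (Finset.mem_insert_self _ _)
  refine overlap hb1 hb2 hf1 hf2 hsp ?_
  have := eval_off hb2 (G'.ind hf2) (co t a) hz hsp
  rw [this] at k1
  exact pos_of_mul_pos_left k1 k2.le

lemma sub_g2a {n : ℕ} (hdim : ∀ t ∈ G.faces, t.card ≤ n + 1) {r : Finset EE} (hr : r ∈ G'.faces)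
    (hrn : r.card = n) (hcn : (car h r).card = n + 1) :
    ∃ f1 f2, f1 ≠ f2 ∧ ∀ f, (f ∈ G'.faces ∧ r ⊆ f ∧ f.card = n + 1) ↔ (f = f1 ∨ f = f2) := by
  obtain ⟨ht, hrt, hrri⟩ := car_spec h hr
  set t := car h r with htdef
  have hft : ∀ f ∈ G'.faces, r ⊆ f → car h f = t := by
    intro f hf hrf
    refine (Finset.eq_of_subset_of_card_le (car_mono h hf hrf) ?_).symm
    have := hdim _ (car_spec h hf).1
    exact this.trans hcn.ge
  obtain ⟨f1, hf1, hrf1, e1, hc1⟩ := sub_g1 h (Or.inl hr) ht (le_of_eq htdef.symm)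
  obtain ⟨b1, hb1, rfl⟩ := exists_insert hrf1 hrn (hc1.trans hcn)
  have hsp1 : ∀ x ∈ hull t, x ∈ spn (insert b1 r) := by
    intro x hx
    apply sub_span h hf1 (by rw [hc1, e1])
    rwa [e1]
  have hzr : ∀ a ∈ r, co (insert b1 r) b1 a = 0 := fun a ha =>
    co_ne (G'.ind hf1) (Finset.mem_insert_of_mem ha) (fun h => hb1 (h ▸ ha))
  obtain ⟨l, hl1, hl2⟩ := W_exists (Or.inl hr)
  obtain ⟨a, ha, hal⟩ := hl2 (hull r) (hull_convex r) (hull_nonempty (G'.face_ne hr))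
    (fun a ha => subset_hull ha)
  obtain ⟨p, hp, hpl⟩ := ri_W_nonempty (G'.ind hr) l ha hal
  have hb1t : b1 ∈ hull t := by
    rw [← e1]; exact (car_spec h hf1).2.1 b1 (Finset.mem_insert_self _ _)
  obtain ⟨ε, e0, eps1, h2⟩ := riW_open (G.ind ht) l (hrri p hp) hpl (hull_spn (G.ind ht) hb1t)
  have hq := h2 (-ε) (by rw [abs_neg, abs_of_pos e0])
  obtain ⟨f2, hf2, hqf2, e2⟩ := car_of_ri h ht hq.1
  have hrf2 := hl1 f2 hf2 _ hqf2.1 hq.2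
  have hhq : co (insert b1 r) b1 ((1 - -ε) • p + (-ε) • b1) < 0 := by
    rw [affine_comb _ _ _ (by ring), co_same (G'.ind hf1) (Finset.mem_insert_self _ _),
      show co (insert b1 r) b1 p = 0 from hull_sub (cvx_zero _) hzr hp.1]
    linarith
  have hc2 : f2.card = n + 1 := by
    have hle := car_card h hf2
    rw [e2, hcn] at hle
    have hge := Finset.card_le_card hrf2
    by_contra hne
    have : f2 = r := (Finset.eq_of_subset_of_card_le hrf2 (by omega)).symm
    rw [this] at hqf2
    exact hhq.ne (hull_sub (cvx_zero _) hzr hqf2.1)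
  obtain ⟨b2, hb2, rfl⟩ := exists_insert hrf2 hrn hc2
  have hb2t : ∀ {b}, insert b r ∈ G'.faces → b ∈ hull t := by
    intro b hb
    rw [← hft _ hb (Finset.subset_insert _ _)]
    exact (car_spec h hb).2.1 b (Finset.mem_insert_self _ _)
  have hsp2 : ∀ x ∈ hull t, x ∈ spn (insert b2 r) := by
    intro x hx
    apply sub_span h hf2 (by rw [hc2, e2, hcn])
    rwa [e2]
  have hhb2 : co (insert b1 r) b1 b2 < 0 := by
    have := eval_off hb2 (G'.ind hf2) (co (insert b1 r) b1) hzr (hull_spn (G'.ind hf2) hqf2.1)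
    rw [this] at hhq
    have hpos := hqf2.2 b2 (Finset.mem_insert_self _ _)
    by_contra hcon
    push Not at hcon
    have := mul_nonneg hpos.le hcon
    linarith
  refine ⟨insert b1 r, insert b2 r, ?_, ?_⟩
  · intro he
    have : b2 ∈ insert b1 r := by rw [he]; exact Finset.mem_insert_self _ _
    have h3 := ((mem_hull_iff (G'.ind hf1)).1 (subset_hull this)).2 b1 (Finset.mem_insert_self _ _)
    linarith
  · intro f
    constructor
    · rintro ⟨hf, hrf, hcf⟩
      obtain ⟨b3, hb3, rfl⟩ := exists_insert hrf hrn hcf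
      have hb3t := hb2t hf
      rcases lt_trichotomy (co (insert b1 r) b1 b3) 0 with h3 | h3 | h3
      · right
        refine overlap hb3 hb2 hf hf2 (hsp2 _ hb3t) ?_
        have := eval_off hb2 (G'.ind hf2) (co (insert b1 r) b1) hzr (hsp2 _ hb3t)
        rw [this] at h3
        by_contra hcon
        push Not at hcon
        have := mul_nonneg_of_nonpos_of_nonpos hcon hhb2.le
        linarith
      · exfalso
        have hin : ∀ a ∈ insert b3 r, a ∈ affineSpan ℝ (r : Set EE) := by
          intro a ha
          rcases Finset.mem_insert.1 ha with rfl | ha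
          · have hsp := hsp1 _ hb3t
            obtain ⟨h5, h6⟩ := co_sum (G'.ind hf1) hsp
            rw [Finset.sum_insert hb1, h3, zero_add] at h5
            rw [Finset.sum_insert hb1, h3, zero_smul, zero_add] at h6
            rw [← h6, ← Finset.affineCombination_eq_linear_combination r (fun x => x) _ h5]
            have := affineCombination_mem_affineSpan_image (k := ℝ) (s := r)
              (w := fun i => co (insert b1 r) i a)
              h5 (s' := (r : Set EE)) (fun i hi hi' => absurd hi hi') (fun x : EE => x)
            simpa using this
          · exact subset_affineSpan ℝ _ ha
        have := card_le_of_span (G'.ind hf) hin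
        omega
      · left
        exact overlap hb3 hb1 hf hf1 (hsp1 _ hb3t) h3
    · rintro (rfl | rfl)
      · exact ⟨hf1, hrf1, hc1.trans hcn⟩
      · exact ⟨hf2, hrf2, hc2⟩

lemma hull_line_closed {f : Finset EE} (hf : Ind f) (x y : EE) :
    IsClosed {c : ℝ | (1 - c) • x + c • y ∈ hull f} := by
  have : {c : ℝ | (1 - c) • x + c • y ∈ hull f} =
      (⋂ a ∈ {a : EE | a ∉ f}, {c : ℝ | (1 - c) * co f a x + c * co f a y = 0}) ∩
      ⋂ a ∈ {a : EE | a ∈ f}, {c : ℝ | 0 ≤ (1 - c) * co f a x + c * co f a y} := by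
    ext c
    have hh : ∀ a, co f a ((1 - c) • x + c • y) = (1 - c) * co f a x + c * co f a y :=
      fun a => affine_comb _ _ _ (by ring)
    simp only [Set.mem_ofPred_eq, mem_hull_iff hf, hh, Set.mem_inter_iff, Set.mem_iInter]
  rw [this]
  refine IsClosed.inter ?_ ?_
  · refine isClosed_biInter (fun a _ => isClosed_eq (by fun_prop) (by fun_prop))
  · refine isClosed_biInter (fun a _ => isClosed_le (by fun_prop) (by fun_prop))

lemma sub_g3 {n : ℕ} {s : Finset EE} (hs : s ∈ G'.faces ∨ s = ∅)
    {t} (ht : t ∈ G.faces) (htn : t.card = n + 1) (z : Finset EE → ZMod 2)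
    (hz : ∀ r ∈ G'.faces, s ⊆ r → r.card = n → car h r = t → ∀ f1 ∈ G'.faces, ∀ f2 ∈ G'.faces,
      r ⊆ f1 → r ⊆ f2 → f1.card = n + 1 → f2.card = n + 1 → car h f1 = t → car h f2 = t →
      z f1 = z f2)
    {f1 f2} (hf1 : f1 ∈ G'.faces) (hf2 : f2 ∈ G'.faces) (hs1 : s ⊆ f1) (hs2 : s ⊆ f2)
    (hc1 : f1.card = n + 1) (hc2 : f2.card = n + 1) (e1 : car h f1 = t) (e2 : car h f2 = t) :
    z f1 = z f2 := by
  obtain ⟨l, hl1, hl2⟩ := W_exists hs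
  have hW : ∀ f ∈ G'.faces, s ⊆ f → (ri f ∩ WW l).Nonempty := by
    intro f hf hsf
    obtain ⟨a, ha, hal⟩ := hl2 (hull f) (hull_convex f) (hull_nonempty (G'.face_ne hf))
      (fun a ha => subset_hull (hsf ha))
    exact ri_W_nonempty (G'.ind hf) l ha hal
  obtain ⟨x, hx, hxl⟩ := hW f1 hf1 hs1
  have hne2 := hW f2 hf2 hs2
  obtain ⟨y, ⟨hy, hyl⟩, hgen⟩ := COV ((ri_convex (G'.ind hf2)).inter (WW_convex l)) hne2
    (G'.faces.filter fun g => g.card < n)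
    (fun g => (affineSpan ℝ ((insert x g : Finset EE) : Set EE) : Set EE))
    (fun i _ => affineSpan_flat _)
  have hy' : ∀ g ∈ G'.faces, g.card < n →
      y ∉ (affineSpan ℝ ((insert x g : Finset EE) : Set EE) : Set EE) := by
    intro g hg hgn hyg
    have h1 := hgen g (Finset.mem_filter.2 ⟨hg, hgn⟩) hyg
    have h2 := SPAN (G'.ind hf2) l hne2 (affineSpan_flat _) h1
    have h3 := card_le_of_span (G'.ind hf2) h2
    have h4 := Finset.card_insert_le x g
    omega
  have hseg : ∀ c ∈ Set.Icc (0 : ℝ) 1, ∃ g ∈ G'.faces, s ⊆ g ∧ car h g = t ∧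
      (g.card = n ∨ g.card = n + 1) ∧ (1 - c) • x + c • y ∈ ri g := by
    intro c hc
    have hxt := (car_spec h hf1).2.2 x hx
    have hyt := (car_spec h hf2).2.2 y hy
    rw [e1] at hxt
    rw [e2] at hyt
    have hct := ri_convex (G.ind ht) hxt hyt (by linarith [hc.2] : 0 ≤ 1 - c) hc.1 (by ring)
    have hcW := WW_convex l hxl hyl (by linarith [hc.2] : 0 ≤ 1 - c) hc.1 (by ring)
    obtain ⟨g, hg, hxg, eg⟩ := car_of_ri h ht hct
    refine ⟨g, hg, hl1 g hg _ hxg.1 hcW, eg, ?_, hxg⟩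
    have hle := car_card h hg
    rw [eg, htn] at hle
    by_contra hcon
    have hlt : g.card < n := by omega
    by_cases hc0 : c = 0
    · rw [hc0] at hxg
      simp only [sub_zero, one_smul, zero_smul, add_zero] at hxg
      have := Finset.card_le_card (G'.ext_ri hf1 hg hx hxg.1)
      omega
    · apply hy' g hg hlt
      have h1 : (1 - c) • x + c • y ∈
          (affineSpan ℝ ((insert x g : Finset EE) : Set EE) : Set EE) := by
        have h2 := hull_spn (G'.ind hg) hxg.1
        rw [spn_eq (G'.ind hg)] at h2
        exact affineSpan_mono ℝ (by simp) h2
      have h3 : x ∈ (affineSpan ℝ ((insert x g : Finset EE) : Set EE) : Set EE) :=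
        subset_affineSpan ℝ _ (by simp)
      have := flat_line (affineSpan_flat _) (x := x) (y := y) (Ne.symm hc0) (by simpa using h3) h1 1
      simpa using this
  have hcov : ∀ c ∈ Set.Icc (0 : ℝ) 1, ∃ f ∈ G'.faces, s ⊆ f ∧ car h f = t ∧ f.card = n + 1 ∧
      (1 - c) • x + c • y ∈ hull f := by
    intro c hc
    obtain ⟨g, hg, hsg, eg, hcg, hxg⟩ := hseg c hc
    obtain ⟨f, hf, hgf, ef, hcf⟩ := sub_g1 h (Or.inl hg) ht (le_of_eq eg)
    exact ⟨f, hf, hsg.trans hgf, ef, hcf.trans htn, hull_mono hgf hxg.1⟩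
  by_contra hne
  let F : Finset (Finset EE) := G'.faces.filter fun f => s ⊆ f ∧ car h f = t ∧ f.card = n + 1
  have hF : ∀ f, f ∈ F ↔ f ∈ G'.faces ∧ s ⊆ f ∧ car h f = t ∧ f.card = n + 1 := by
    intro f; simp [F]
  let U : Finset (Finset EE) → Set ℝ := fun F' => ⋃ f ∈ F', {c : ℝ | (1 - c) • x + c • y ∈ hull f}
  have hUc : ∀ F' ⊆ F, IsClosed (U F') := by
    intro F' hF'
    refine Set.Finite.isClosed_biUnion (Finset.finite_toSet _) (fun f hf => ?_)
    exact hull_line_closed (G'.ind ((hF f).1 (hF' hf)).1) x y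
  have hpre := isPreconnected_closed_iff.1 (isPreconnected_Icc (a := (0 : ℝ)) (b := 1))
    (U (F.filter fun f => z f = z f1)) (U (F.filter fun f => z f ≠ z f1))
    (hUc _ (Finset.filter_subset _ _)) (hUc _ (Finset.filter_subset _ _)) (by
      intro c hc
      obtain ⟨f, hf, hsf, ef, hcf, hxf⟩ := hcov c hc
      have hfF := (hF f).2 ⟨hf, hsf, ef, hcf⟩
      by_cases hzf : z f = z f1
      · left
        exact Set.mem_biUnion (show f ∈ ((F.filter fun f => z f = z f1 : Finset _) : Set _) by
          simp [hfF, hzf]) hxf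
      · right
        exact Set.mem_biUnion (show f ∈ ((F.filter fun f => z f ≠ z f1 : Finset _) : Set _) by
          simp [hfF, hzf]) hxf)
    ⟨0, by simp, Set.mem_biUnion (show f1 ∈ ((F.filter fun f => z f = z f1 : Finset _) : Set _) by
          simp [(hF f1).2 ⟨hf1, hs1, e1, hc1⟩]) (by simpa using hx.1)⟩
    ⟨1, by simp, Set.mem_biUnion (show f2 ∈ ((F.filter fun f => z f ≠ z f1 : Finset _) : Set _) by
          simp [(hF f2).2 ⟨hf2, hs2, e2, hc2⟩, Ne.symm hne]) (by simpa using hy.1)⟩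
  obtain ⟨c, hc, hcU1, hcU2⟩ := hpre
  obtain ⟨f, hf, hxf⟩ := Set.mem_iUnion₂.1 hcU1
  obtain ⟨f', hf', hxf'⟩ := Set.mem_iUnion₂.1 hcU2
  obtain ⟨hfF, hzf⟩ := Finset.mem_filter.1 hf
  obtain ⟨hfF', hzf'⟩ := Finset.mem_filter.1 hf'
  obtain ⟨a1, a2, a3, a4⟩ := (hF f).1 hfF
  obtain ⟨b1, b2, b3, b4⟩ := (hF f').1 hfF'
  obtain ⟨g, hg, hsg, eg, hcg, hxg⟩ := hseg c hc
  have hgf := G'.ext_ri hg a1 hxg hxf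
  have hgf' := G'.ext_ri hg b1 hxg hxf'
  rcases hcg with hcg | hcg
  · exact hzf' ((hz g hg hsg hcg eg f' b1 f a1 hgf' hgf b4 a4 b3 a3).trans hzf)
  · have i1 := Finset.eq_of_subset_of_card_le hgf (by omega)
    have i2 := Finset.eq_of_subset_of_card_le hgf' (by omega)
    exact hzf' (by rw [← i2, i1, hzf])

lemma CSub_of {n : ℕ} (hdim : ∀ t ∈ G.faces, t.card ≤ n + 1) :
    CSub n G.faces G'.faces (car h) where
  emp := car_emp h
  mem f hf := (car_spec h hf).1
  mono g hg f hfg := car_mono h hg hfg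
  card f hf := car_card h hf
  dim := hdim
  g1 s hs t ht hst := sub_g1 h hs ht hst
  g2a r hr hrn hcn := sub_g2a h hdim hr hrn hcn
  g2b r hr hrn hcn t ht hrt htn f1 hf1 f2 hf2 hr1 hr2 hc1 hc2 e1 e2 :=
    sub_g2b h hr hrn hcn ht hrt htn hf1 hf2 hr1 hr2 hc1 hc2 e1 e2
  g3 s hs t ht htn z hz f1 hf1 f2 hf2 hs1 hs2 hc1 hc2 e1 e2 :=
    sub_g3 h hs ht htn z hz hf1 hf2 hs1 hs2 hc1 hc2 e1 e2

end Carrier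
section Local

variable {α β : Type*} [DecidableEq α] [DecidableEq β]

/-- Faces of `K` with `n + 1` vertices containing `r`. -/
def tops (K : Finset (Finset α)) (n : ℕ) (r : Finset α) : Finset (Finset α) :=
  K.filter fun t => r ⊆ t ∧ t.card = n + 1

lemma mem_tops {K : Finset (Finset α)} {n : ℕ} {r t : Finset α} :
    t ∈ tops K n r ↔ t ∈ K ∧ r ⊆ t ∧ t.card = n + 1 := by
  simp [tops]

/-- `z` satisfies the cycle condition at the ridges in `P`. -/
def LC (K : Finset (Finset α)) (n : ℕ) (P : Finset α → Prop) (z : Finset α → ZMod 2) : Prop :=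
  ∀ r, (r ∈ K ∨ r = ∅) → P r → r.card = n → ∑ t ∈ tops K n r, z t = 0

lemma LC.weaken {K : Finset (Finset α)} {n : ℕ} {P Q : Finset α → Prop} {z : Finset α → ZMod 2}
    (h : LC K n P z) (hPQ : ∀ r, (r ∈ K ∨ r = ∅) → Q r → P r) : LC K n Q z :=
  fun r hr hQ hn => h r hr (hPQ r hr hQ) hn

/-- Existence of a local cycle at `s` not vanishing on some top face containing `s`. -/
def NZ (K : Finset (Finset α)) (n : ℕ) (s : Finset α) : Prop :=
  ∃ z, LC K n (fun r => s ⊆ r) z ∧ ∃ t ∈ tops K n s, z t ≠ 0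

/-- `K` looks like a closed connected pseudomanifold at `s`. -/
def Good (K : Finset (Finset α)) (n : ℕ) (s : Finset α) : Prop :=
  (∃ t, t ∈ tops K n s) ∧ LC K n (fun r => s ⊆ r) (fun _ => 1) ∧
    ∀ z, LC K n (fun r => s ⊆ r) z → ∀ t1 ∈ tops K n s, ∀ t2 ∈ tops K n s, z t1 = z t2

variable {n : ℕ} {S : Finset (Finset α)} {S' : Finset (Finset β)} {φ : Finset β → Finset α}

lemma CSub.mem' (h : CSub n S S' φ) {f} (hf : f ∈ S' ∨ f = ∅) : φ f ∈ S ∨ φ f = ∅ := by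
  rcases hf with hf | rfl
  · exact Or.inl (h.mem f hf)
  · exact Or.inr h.emp

lemma CSub.top (h : CSub n S S' φ) {f} (hf : f ∈ S') (hc : f.card = n + 1) :
    (φ f).card = n + 1 := by
  have h1 := h.card f hf
  have h2 := h.dim _ (h.mem f hf)
  omega

lemma CSub.top_mem (h : CSub n S S' φ) {f s} (hf : f ∈ tops S' n s) : φ f ∈ tops S n (φ s) := by
  rw [mem_tops] at *
  exact ⟨h.mem f hf.1, h.mono f hf.1 s hf.2.1, h.top hf.1 hf.2.2⟩

lemma CSub.top_surj (h : CSub n S S' φ) {s} (hs : s ∈ S' ∨ s = ∅) {t} (ht : t ∈ tops S n (φ s)) :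
    ∃ f ∈ tops S' n s, φ f = t := by
  rw [mem_tops] at ht
  obtain ⟨f, hf, h1, h2, h3⟩ := h.g1 s hs t ht.1 ht.2.1
  exact ⟨f, mem_tops.2 ⟨hf, h1, h3.trans ht.2.2⟩, h2⟩

lemma CSub.sum_ridge (h : CSub n S S' φ) {r} (hr : r ∈ S' ∨ r = ∅) (hn : r.card = n)
    (hφ : (φ r).card = n) (z : Finset α → ZMod 2) :
    ∑ f ∈ tops S' n r, z (φ f) = ∑ t ∈ tops S n (φ r), z t := by
  refine Finset.sum_bij (fun f _ => φ f) (fun f hf => h.top_mem hf) ?_ ?_ (fun _ _ => rfl)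
  · intro f1 hf1 f2 hf2 he
    have h1 := h.top_mem hf1
    rw [mem_tops] at *
    exact h.g2b r hr hn hφ (φ f1) h1.1 h1.2.1 h1.2.2 f1 hf1.1 f2 hf2.1 hf1.2.1 hf2.2.1 hf1.2.2
      hf2.2.2 rfl he.symm
  · intro t ht
    obtain ⟨f, hf, he⟩ := h.top_surj hr ht
    exact ⟨f, hf, he⟩

lemma CSub.pull (h : CSub n S S' φ) {P : Finset α → Prop} {z : Finset α → ZMod 2}
    (hz : LC S n P z) : LC S' n (fun r => P (φ r)) (fun f => z (φ f)) := by
  intro r hr hP hn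
  by_cases hφ : (φ r).card = n
  · rw [h.sum_ridge hr hn hφ]
    exact hz _ (h.mem' hr) hP hφ
  · rcases hr with hr | rfl
    · have h1 := h.card r hr
      have h2 := h.dim _ (h.mem r hr)
      have h3 : (φ r).card = n + 1 := by omega
      obtain ⟨f1, f2, hne, hf⟩ := h.g2a r hr hn h3
      have e : tops S' n r = {f1, f2} := by
        ext f; rw [mem_tops, hf]; simp
      have key : ∀ f ∈ tops S' n r, φ f = φ r := by
        intro f hf
        have := h.top_mem hf
        rw [mem_tops] at this
        exact (Finset.eq_of_subset_of_card_le this.2.1 (by rw [this.2.2, h3])).symm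
      have e2 : ∑ f ∈ tops S' n r, z (φ f) = ∑ f ∈ tops S' n r, z (φ r) :=
        Finset.sum_congr rfl (fun f hf => by rw [key f hf])
      rw [e2, e, Finset.sum_pair hne]
      exact CharTwo.add_self_eq_zero _
    · rw [h.emp] at hφ
      simp at hn
      simp [← hn] at hφ

lemma CSub.const (h : CSub n S S' φ) {P' : Finset β → Prop} {z : Finset β → ZMod 2}
    (hz : LC S' n P' z) {s t} (hs : s ∈ S' ∨ s = ∅) (ht : t ∈ S) (htn : t.card = n + 1)
    (hP : ∀ r ∈ S', s ⊆ r → φ r = t → P' r) :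
    ∀ f1 ∈ tops S' n s, ∀ f2 ∈ tops S' n s, φ f1 = t → φ f2 = t → z f1 = z f2 := by
  intro f1 hf1 f2 hf2 e1 e2
  rw [mem_tops] at hf1 hf2
  refine h.g3 s hs t ht htn z ?_ f1 hf1.1 f2 hf2.1 hf1.2.1 hf2.2.1 hf1.2.2 hf2.2.2 e1 e2
  intro r hr hsr hrn hrt a ha b hb hra hrb hca hcb _ _
  obtain ⟨f1, f2, hne, hf⟩ := h.g2a r hr hrn (by rw [hrt, htn])
  have e : tops S' n r = {f1, f2} := by
    ext f; rw [mem_tops, hf]; simp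
  have h0 := hz r (Or.inl hr) (hP r hr hsr hrt) hrn
  rw [e, Finset.sum_pair hne] at h0
  have h12 : z f1 = z f2 := by
    rw [← sub_eq_zero, CharTwo.sub_eq_add]; exact h0
  rcases (hf a).1 ⟨ha, hra, hca⟩ with rfl | rfl <;> rcases (hf b).1 ⟨hb, hrb, hcb⟩ with rfl | rfl
  · rfl
  · exact h12
  · exact h12.symm
  · rfl

lemma CSub.desc (h : CSub n S S' φ) {s} (hs : s ∈ S' ∨ s = ∅) {z' : Finset β → ZMod 2}
    (hz : LC S' n (fun r => s ⊆ r) z') :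
    ∃ z, LC S n (fun r => φ s ⊆ r) z ∧ ∀ f ∈ tops S' n s, z (φ f) = z' f := by
  let z : Finset α → ZMod 2 := fun t =>
    if ht : ∃ f ∈ tops S' n s, φ f = t then z' ht.choose else 0
  have hzz : ∀ f ∈ tops S' n s, z (φ f) = z' f := by
    intro f hf
    have ht : ∃ f' ∈ tops S' n s, φ f' = φ f := ⟨f, hf, rfl⟩
    have e : z (φ f) = z' ht.choose := dif_pos ht
    have h1 := mem_tops.1 (h.top_mem hf)
    rw [e]
    exact h.const hz hs h1.1 h1.2.2 (fun r _ hr _ => hr) _ ht.choose_spec.1 _ hf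
      ht.choose_spec.2 rfl
  refine ⟨z, ?_, hzz⟩
  intro r hr hsr hrn
  obtain ⟨r', hr', hsr', e, hc⟩ : ∃ r', (r' ∈ S' ∨ r' = ∅) ∧ s ⊆ r' ∧ φ r' = r ∧ r'.card = n := by
    rcases hr with hr | rfl
    · obtain ⟨f, hf, h1, h2, h3⟩ := h.g1 s hs r hr hsr
      exact ⟨f, Or.inl hf, h1, h2, h3.trans hrn⟩
    · refine ⟨∅, Or.inr rfl, ?_, h.emp, hrn⟩
      rcases hs with hs | rfl
      · have h1 := h.card s hs
        rw [Finset.subset_empty.1 hsr] at h1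
        simp at h1
        simp [h1]
      · simp
  subst e
  rw [← h.sum_ridge hr' hc hrn z, ← hz r' hr' hsr' hc]
  refine Finset.sum_congr rfl (fun f hf => hzz f ?_)
  rw [mem_tops] at *
  exact ⟨hf.1, hsr'.trans hf.2.1, hf.2.2⟩

lemma CSub.pull_at (h : CSub n S S' φ) {s} (hs : s ∈ S' ∨ s = ∅) {z : Finset α → ZMod 2}
    (hz : LC S n (fun r => φ s ⊆ r) z) : LC S' n (fun r => s ⊆ r) (fun f => z (φ f)) := by
  refine (h.pull hz).weaken (fun r hr hsr => ?_)
  rcases hr with hr | rfl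
  · exact h.mono r hr s hsr
  · rw [Finset.subset_empty.1 hsr]

lemma CSub.NZ_iff (h : CSub n S S' φ) {s} (hs : s ∈ S' ∨ s = ∅) : NZ S n (φ s) ↔ NZ S' n s := by
  constructor
  · rintro ⟨z, hz, t, ht, hne⟩
    obtain ⟨f, hf, rfl⟩ := h.top_surj hs ht
    exact ⟨_, h.pull_at hs hz, f, hf, hne⟩
  · rintro ⟨z', hz', f, hf, hne⟩
    obtain ⟨z, hz, hzz⟩ := h.desc hs hz'
    exact ⟨z, hz, φ f, h.top_mem hf, by rwa [hzz f hf]⟩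

lemma CSub.Good_iff (h : CSub n S S' φ) {s} (hs : s ∈ S' ∨ s = ∅) :
    Good S n (φ s) ↔ Good S' n s := by
  constructor
  · rintro ⟨⟨t, ht⟩, h1, h2⟩
    refine ⟨?_, h.pull_at hs h1, ?_⟩
    · obtain ⟨f, hf, _⟩ := h.top_surj hs ht
      exact ⟨f, hf⟩
    · intro z' hz' f1 hf1 f2 hf2
      obtain ⟨z, hz, hzz⟩ := h.desc hs hz'
      rw [← hzz f1 hf1, ← hzz f2 hf2]
      exact h2 z hz _ (h.top_mem hf1) _ (h.top_mem hf2)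
  · rintro ⟨⟨t, ht⟩, h1, h2⟩
    refine ⟨⟨_, h.top_mem ht⟩, ?_, ?_⟩
    · obtain ⟨z, hz, hzz⟩ := h.desc hs h1
      intro r hr hsr hrn
      rw [← hz r hr hsr hrn]
      refine Finset.sum_congr rfl (fun t ht => ?_)
      have ht' : t ∈ tops S n (φ s) := by
        rw [mem_tops] at *
        exact ⟨ht.1, hsr.trans ht.2.1, ht.2.2⟩
      obtain ⟨f, hf, rfl⟩ := h.top_surj hs ht'
      exact (hzz f hf).symm
    · intro z hz t1 ht1 t2 ht2
      obtain ⟨f1, hf1, rfl⟩ := h.top_surj hs ht1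
      obtain ⟨f2, hf2, rfl⟩ := h.top_surj hs ht2
      exact h2 _ (h.pull_at hs hz) f1 hf1 f2 hf2

lemma CSub.surj (h : CSub n S S' φ) {t} (ht : t ∈ S ∨ t = ∅) :
    ∃ f, (f ∈ S' ∨ f = ∅) ∧ φ f = t := by
  rcases ht with ht | rfl
  · obtain ⟨f, hf, _, h2, _⟩ := h.g1 ∅ (Or.inr rfl) t ht (by rw [h.emp]; simp)
    exact ⟨f, Or.inl hf, h2⟩
  · exact ⟨∅, Or.inr rfl, h.emp⟩

def AllGood (K : Finset (Finset α)) (n : ℕ) : Prop :=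
  (∀ t ∈ K, t.card ≤ n + 1) ∧ ∀ s, (s ∈ K ∨ s = ∅) → Good K n s

lemma CSub.AllGood_iff (h : CSub n S S' φ) : AllGood S n ↔ AllGood S' n := by
  constructor
  · rintro ⟨h1, h2⟩
    exact ⟨fun t ht => (h.card t ht).trans (h1 _ (h.mem t ht)),
      fun s hs => (h.Good_iff hs).1 (h2 _ (h.mem' hs))⟩
  · rintro ⟨h1, h2⟩
    refine ⟨h.dim, fun s hs => ?_⟩
    obtain ⟨f, hf, rfl⟩ := h.surj hs
    exact (h.Good_iff hf).2 (h2 f hf)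

/-- Upward closedness of the set of interior faces, connectedness, existence of a top face. -/
def BallLike (K : Finset (Finset α)) (n : ℕ) : Prop :=
  (∀ t ∈ K, t.card ≤ n + 1) ∧
  (∀ s ∈ K, ∀ t ⊆ s, NZ K n t → NZ K n s) ∧
  (∀ z, LC K n (NZ K n) z → ∀ t1 ∈ tops K n ∅, ∀ t2 ∈ tops K n ∅, z t1 = z t2) ∧
  (∃ t, t ∈ tops K n ∅) ∧ (∃ s ∈ K, ¬ NZ K n s)

lemma CSub.BallLike_up (h : CSub n S S' φ) (hne : ∅ ∉ S) (hb : BallLike S' n)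
    (hdc : ∀ s ∈ S, ∀ t ⊆ s, t ≠ ∅ → t ∈ S) : BallLike S n := by
  obtain ⟨h1, h2, h3, h4, h5⟩ := hb
  refine ⟨h.dim, ?_, ?_, ?_, ?_⟩
  · intro s hs t hts ht
    obtain ⟨t', ht', rfl⟩ := h.surj (t := t) (by
      by_cases ht0 : t = ∅
      · exact Or.inr ht0
      · exact Or.inl (hdc s hs t hts ht0))
    obtain ⟨s', hs', hts', rfl, _⟩ := h.g1 t' ht' s hs hts
    rw [h.NZ_iff ht'] at ht
    rw [h.NZ_iff (Or.inl hs')]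
    exact h2 s' hs' t' hts' ht
  · intro z hz t1 ht1 t2 ht2
    rw [← h.emp] at ht1 ht2
    obtain ⟨f1, hf1, rfl⟩ := h.top_surj (Or.inr rfl) ht1
    obtain ⟨f2, hf2, rfl⟩ := h.top_surj (Or.inr rfl) ht2
    refine h3 (fun f => z (φ f)) ((h.pull hz).weaken ?_) f1 hf1 f2 hf2
    intro r hr hr2
    exact (h.NZ_iff hr).2 hr2
  · obtain ⟨t, ht⟩ := h4
    exact ⟨_, h.emp ▸ h.top_mem ht⟩
  · obtain ⟨s, hs, hn⟩ := h5
    exact ⟨_, h.mem s hs, by rwa [h.NZ_iff (Or.inl hs)]⟩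

lemma CSub_equiv {ψ : Finset α → Finset β} (hemp : φ ∅ = ∅) (hφ : ∀ f ∈ S', φ f ∈ S)
    (hψ : ∀ t ∈ S, ψ t ∈ S') (hφψ : ∀ t ∈ S, φ (ψ t) = t) (hψφ : ∀ f ∈ S', ψ (φ f) = f)
    (hψm : ∀ s t, s ⊆ t → ψ s ⊆ ψ t) (hφm : ∀ s t, s ⊆ t → φ s ⊆ φ t)
    (hc : ∀ f ∈ S', (φ f).card = f.card) (hdim : ∀ t ∈ S, t.card ≤ n + 1) : CSub n S S' φ where
  emp := hemp
  mem := hφ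
  mono g _ f hf := hφm f g hf
  card f hf := (hc f hf).ge
  dim := hdim
  g1 := by
    intro s' hs' t ht hst
    refine ⟨ψ t, hψ t ht, ?_, hφψ t ht, ?_⟩
    · rcases hs' with hs' | rfl
      · rw [← hψφ s' hs']; exact hψm _ _ hst
      · simp
    · rw [← hc _ (hψ t ht), hφψ t ht]
  g2a := by
    intro r hr h1 h2
    rw [hc r hr] at h2
    omega
  g2b := by
    intro r _ _ _ t _ _ _ f1 h1 f2 h2 _ _ _ _ e1 e2
    rw [← hψφ f1 h1, ← hψφ f2 h2, e1, e2]
  g3 := by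
    intro r _ t _ _ z _ f1 h1 f2 h2 _ _ _ _ e1 e2
    rw [← hψφ f1 h1, ← hψφ f2 h2, e1, e2]

lemma subset_verts {K : Finset (Finset α)} {s} (hs : s ∈ K) : s ⊆ verts K :=
  Finset.le_sup (f := id) hs

lemma image_image_of_left {f : α → β} {g : β → α} {A : Finset α} (hg : ∀ x ∈ A, g (f x) = x)
    {s : Finset α} (hs : s ⊆ A) : (s.image f).image g = s := by
  rw [Finset.image_image]
  conv_rhs => rw [← Finset.image_id (s := s)]
  exact Finset.image_congr (fun x hx => hg x (hs hx))

lemma CSub_image {f : α → β} {g : β → α} {K : Finset (Finset α)}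
    (hg : ∀ x ∈ verts K, g (f x) = x) (hdim : ∀ t ∈ K, t.card ≤ n + 1) :
    CSub n K (K.image (Finset.image f)) (Finset.image g) := by
  have key : ∀ t ∈ K, (t.image f).image g = t := fun t ht =>
    image_image_of_left hg (subset_verts ht)
  refine CSub_equiv (ψ := Finset.image f) (by simp) ?_ ?_ key ?_ ?_ ?_ ?_ hdim
  · intro f' hf
    obtain ⟨t, ht, rfl⟩ := Finset.mem_image.1 hf
    rwa [key t ht]
  · intro t ht; exact Finset.mem_image_of_mem _ ht
  · intro f' hf
    obtain ⟨t, ht, rfl⟩ := Finset.mem_image.1 hf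
    rw [key t ht]
  · intro s t h; exact Finset.image_subset_image h
  · intro s t h; exact Finset.image_subset_image h
  · intro f' hf
    obtain ⟨t, ht, rfl⟩ := Finset.mem_image.1 hf
    refine le_antisymm Finset.card_image_le ?_
    rw [key t ht]; exact Finset.card_image_le

lemma exists_left {f : α → β} {K : Finset (Finset α)} (hf : Set.InjOn f ↑(verts K))
    (hne : Nonempty α) : ∃ g : β → α, ∀ x ∈ verts K, g (f x) = x :=
  ⟨Function.invFunOn f ↑(verts K), fun _ hx => hf.leftInvOn_invFunOn hx⟩

end Local
section Std

variable {α β : Type*} [DecidableEq α] [DecidableEq β]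

lemma mem_stdBall {A s : Finset α} : s ∈ stdBall A ↔ s ≠ ∅ ∧ s ⊆ A := by
  simp [stdBall]

lemma mem_stdSphere {A s : Finset α} : s ∈ stdSphere A ↔ s ≠ A ∧ s ≠ ∅ ∧ s ⊆ A := by
  simp [stdSphere]

lemma tops_stdBall {n : ℕ} {B s : Finset α} (hB : B.card = n + 1) (hs : s ⊆ B) :
    tops (stdBall B) n s = {B} := by
  ext t
  rw [mem_tops, mem_stdBall, Finset.mem_singleton]
  constructor
  · rintro ⟨⟨_, h1⟩, _, h2⟩
    exact Finset.eq_of_subset_of_card_le h1 (by omega)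
  · rintro rfl
    refine ⟨⟨?_, le_rfl⟩, hs, hB⟩
    rintro rfl
    simp at hB

lemma NZ_stdBall {n : ℕ} (hn : 1 ≤ n) {B s : Finset α} (hB : B.card = n + 1) (hs : s ⊆ B) :
    NZ (stdBall B) n s ↔ s = B := by
  constructor
  · rintro ⟨z, hz, t, ht, hne⟩
    rw [tops_stdBall hB hs, Finset.mem_singleton] at ht
    subst ht
    by_contra hst
    have hlt := Finset.card_lt_card (Finset.ssubset_iff_subset_ne.2 ⟨hs, hst⟩)
    obtain ⟨r, hsr, hrt, hrn⟩ := Finset.exists_subsuperset_card_eq hs (n := n) (by omega) (by omega)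
    have := hz r (Or.inl (mem_stdBall.2 ⟨by rintro rfl; simp at hrn; omega, hrt⟩)) hsr hrn
    rw [tops_stdBall hB hrt, Finset.sum_singleton] at this
    exact hne this
  · rintro rfl
    refine ⟨fun _ => 1, ?_, s, ?_, one_ne_zero⟩
    · intro r _ h1 h2
      have := Finset.card_le_card h1
      omega
    · rw [tops_stdBall hB le_rfl]; simp

lemma CSub.BallLike_std {n : ℕ} (hn : 1 ≤ n) {B : Finset α} (hB : B.card = n + 1)
    {S' : Finset (Finset β)} {φ : Finset β → Finset α} (h : CSub n (stdBall B) S' φ)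
    (hdc : ∀ s ∈ S', ∀ t ⊆ s, t ≠ ∅ → t ∈ S') : BallLike S' n := by
  have hB0 : B ≠ ∅ := by rintro rfl; simp at hB
  have hBm : B ∈ stdBall B := mem_stdBall.2 ⟨hB0, le_rfl⟩
  have hsub : ∀ s, (s ∈ S' ∨ s = ∅) → φ s ⊆ B := by
    intro s hs
    rcases h.mem' hs with h1 | h1
    · exact (mem_stdBall.1 h1).2
    · simp [h1]
  have hNZ : ∀ s, (s ∈ S' ∨ s = ∅) → (NZ S' n s ↔ φ s = B) := by
    intro s hs
    rw [← h.NZ_iff hs, NZ_stdBall hn hB (hsub s hs)]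
  have htop : ∀ t ∈ tops S' n ∅, φ t = B := by
    intro t ht
    have := h.top_mem ht
    rw [h.emp, tops_stdBall hB (by simp)] at this
    simpa using this
  refine ⟨fun t ht => (h.card t ht).trans (h.dim _ (h.mem t ht)), ?_, ?_, ?_, ?_⟩
  · intro s hs t hts ht
    have ht' : t ∈ S' ∨ t = ∅ := by
      by_cases h0 : t = ∅
      · exact Or.inr h0
      · exact Or.inl (hdc s hs t hts h0)
    rw [hNZ t ht'] at ht
    rw [hNZ s (Or.inl hs)]
    exact Finset.Subset.antisymm (hsub s (Or.inl hs)) (ht ▸ h.mono s hs t hts)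
  · intro z hz t1 ht1 t2 ht2
    refine h.const hz (Or.inr rfl) hBm hB ?_ t1 ht1 t2 ht2 (htop t1 ht1) (htop t2 ht2)
    intro r hr _ e
    exact (hNZ r (Or.inl hr)).2 e
  · obtain ⟨f, hf, _⟩ := h.top_surj (s := ∅) (Or.inr rfl) (t := B) (by
      rw [h.emp, tops_stdBall hB (by simp)]; simp)
    exact ⟨f, hf⟩
  · obtain ⟨b, hb⟩ := Finset.nonempty_iff_ne_empty.2 hB0
    obtain ⟨f, hf, _, e, _⟩ := h.g1 ∅ (Or.inr rfl) {b} (mem_stdBall.2 ⟨by simp, by simpa using hb⟩)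
      (by simp [h.emp])
    refine ⟨f, hf, ?_⟩
    rw [hNZ f (Or.inl hf), e]
    rintro rfl
    simp at hB
    omega

lemma tops_stdSphere {n : ℕ} {B r : Finset α} {a b : α} (hB : B.card = n + 2) (hr : r.card = n)
    (hrB : r ⊆ B) (hab : a ≠ b) (e : B \ r = {a, b}) :
    tops (stdSphere B) n r = {B.erase a, B.erase b} := by
  have ha : a ∈ B \ r := by rw [e]; simp
  have hb : b ∈ B \ r := by rw [e]; simp
  rw [Finset.mem_sdiff] at ha hb
  have key : ∀ x ∈ B, x ∉ r → B.erase x ∈ tops (stdSphere B) n r := by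
    intro x hx hxr
    have hc : (B.erase x).card = n + 1 := by rw [Finset.card_erase_of_mem hx, hB]; rfl
    rw [mem_tops, mem_stdSphere]
    refine ⟨⟨fun h => ?_, fun h => ?_, Finset.erase_subset _ _⟩, ?_, hc⟩
    · rw [h] at hc; omega
    · rw [h] at hc; simp at hc
    · exact fun y hy => Finset.mem_erase.2 ⟨fun h => hxr (h ▸ hy), hrB hy⟩
  ext t
  rw [Finset.mem_insert, Finset.mem_singleton]
  constructor
  · intro ht
    rw [mem_tops, mem_stdSphere] at ht
    obtain ⟨⟨h1, h2, h3⟩, h4, h5⟩ := ht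
    have hc : (B \ t).card = 1 := by
      rw [Finset.card_sdiff_of_subset h3]; omega
    obtain ⟨x, hx⟩ := Finset.card_eq_one.1 hc
    have hxB : x ∈ B \ t := by rw [hx]; simp
    have hxr : x ∈ B \ r := Finset.sdiff_subset_sdiff le_rfl h4 hxB
    have ht : t = B.erase x := by
      rw [← Finset.sdiff_sdiff_eq_self h3, hx, Finset.sdiff_singleton_eq_erase]
    rw [e] at hxr
    simp only [Finset.mem_insert, Finset.mem_singleton] at hxr
    rcases hxr with rfl | rfl
    · exact Or.inl ht
    · exact Or.inr ht
  · rintro (rfl | rfl)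
    · exact key a ha.1 ha.2
    · exact key b hb.1 hb.2

lemma erase_ne {B : Finset α} {a b : α} (ha : a ∈ B) (hab : a ≠ b) : B.erase a ≠ B.erase b := by
  intro h
  have : a ∈ B.erase b := Finset.mem_erase.2 ⟨hab, ha⟩
  rw [← h] at this
  simp at this

lemma tops_sphere_mem {n : ℕ} {B s t : Finset α} (hB : B.card = n + 2)
    (h : t ∈ tops (stdSphere B) n s) : ∃ a ∈ B, a ∉ s ∧ t = B.erase a := by
  rw [mem_tops, mem_stdSphere] at h
  obtain ⟨⟨h1, h2, h3⟩, h4, h5⟩ := h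
  have hc : (B \ t).card = 1 := by
    rw [Finset.card_sdiff_of_subset h3]; omega
  obtain ⟨x, hx⟩ := Finset.card_eq_one.1 hc
  have hxB : x ∈ B \ t := by rw [hx]; simp
  rw [Finset.mem_sdiff] at hxB
  exact ⟨x, hxB.1, fun h => hxB.2 (h4 h), by
    rw [← Finset.sdiff_sdiff_eq_self h3, hx, Finset.sdiff_singleton_eq_erase]⟩

lemma AllGood_std {n : ℕ} {B : Finset α} (hB : B.card = n + 2) : AllGood (stdSphere B) n := by
  refine ⟨?_, ?_⟩
  · intro t ht
    rw [mem_stdSphere] at ht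
    have := Finset.card_lt_card (Finset.ssubset_iff_subset_ne.2 ⟨ht.2.2, ht.1⟩)
    omega
  · intro s hs
    have hsB : s ⊂ B := by
      rcases hs with hs | rfl
      · rw [mem_stdSphere] at hs
        exact Finset.ssubset_iff_subset_ne.2 ⟨hs.2.2, hs.1⟩
      · rw [Finset.ssubset_iff_subset_ne]
        refine ⟨by simp, ?_⟩
        rintro rfl
        simp at hB
    refine ⟨?_, ?_, ?_⟩
    · obtain ⟨a, ha, has⟩ := Finset.exists_of_ssubset hsB
      have hc : (B.erase a).card = n + 1 := by rw [Finset.card_erase_of_mem ha, hB]; rfl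
      refine ⟨B.erase a, ?_⟩
      rw [mem_tops, mem_stdSphere]
      refine ⟨⟨fun h => ?_, fun h => ?_, Finset.erase_subset _ _⟩, ?_, hc⟩
      · rw [h] at hc; omega
      · rw [h] at hc; simp at hc
      · exact fun y hy => Finset.mem_erase.2 ⟨fun h => has (h ▸ hy), hsB.1 hy⟩
    · intro r hr _ hrn
      have hrB : r ⊆ B := by
        rcases hr with hr | rfl
        · exact (mem_stdSphere.1 hr).2.2
        · simp
      obtain ⟨a, b, hab, e⟩ := Finset.card_eq_two.1 (show (B \ r).card = 2 by
        rw [Finset.card_sdiff_of_subset hrB]; omega)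
      have ha : a ∈ B \ r := by rw [e]; simp
      rw [tops_stdSphere hB hrn hrB hab e,
        Finset.sum_pair (erase_ne (Finset.mem_sdiff.1 ha).1 hab)]
      exact CharTwo.add_self_eq_zero _
    · intro z hz t1 ht1 t2 ht2
      obtain ⟨a, ha, has, rfl⟩ := tops_sphere_mem hB ht1
      obtain ⟨b, hb, hbs, rfl⟩ := tops_sphere_mem hB ht2
      by_cases hab : a = b
      · rw [hab]
      have hp : ({a, b} : Finset α) ⊆ B := by
        intro x; simp only [Finset.mem_insert, Finset.mem_singleton]
        rintro (rfl | rfl) <;> assumption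
      have hc : (B \ {a, b}).card = n := by
        rw [Finset.card_sdiff_of_subset hp, Finset.card_pair hab]; omega
      have h0 := hz (B \ {a, b}) (by
        by_cases h0 : B \ {a, b} = ∅
        · exact Or.inr h0
        · refine Or.inl (mem_stdSphere.2 ⟨fun h => ?_, h0, Finset.sdiff_subset⟩)
          rw [h] at hc; omega) (by
        intro x hx
        simp only [Finset.mem_sdiff, Finset.mem_insert, Finset.mem_singleton]
        refine ⟨hsB.1 hx, ?_⟩
        rintro (rfl | rfl)
        · exact has hx
        · exact hbs hx) hc
      rw [tops_stdSphere hB hc Finset.sdiff_subset hab (Finset.sdiff_sdiff_eq_self hp),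
        Finset.sum_pair (erase_ne ha hab)] at h0
      rw [← sub_eq_zero, CharTwo.sub_eq_add]; exact h0

lemma stdBall_image (f : α → β) (A : Finset α) :
    (stdBall A).image (Finset.image f) = stdBall (A.image f) := by
  ext s
  rw [Finset.mem_image, mem_stdBall, Finset.subset_image_iff]
  constructor
  · rintro ⟨t, ht, rfl⟩
    rw [mem_stdBall] at ht
    exact ⟨by simpa using ht.1, t, ht.2, rfl⟩
  · rintro ⟨h1, t, ht, rfl⟩
    exact ⟨t, mem_stdBall.2 ⟨by simpa using h1, ht⟩, rfl⟩

lemma stdSphere_image {f : α → β} {A : Finset α} (hf : Set.InjOn f ↑A) :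
    (stdSphere A).image (Finset.image f) = stdSphere (A.image f) := by
  ext s
  rw [Finset.mem_image, mem_stdSphere, Finset.subset_image_iff]
  have key : ∀ t ⊆ A, t.image f = A.image f → t = A := by
    intro t ht h
    refine Finset.eq_of_subset_of_card_le ht ?_
    rw [← Finset.card_image_of_injOn hf, ← h]
    exact Finset.card_image_le
  constructor
  · rintro ⟨t, ht, rfl⟩
    rw [mem_stdSphere] at ht
    exact ⟨fun h => ht.1 (key t ht.2.2 h), by simpa using ht.2.1, t, ht.2.2, rfl⟩
  · rintro ⟨h0, h1, t, ht, rfl⟩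
    exact ⟨t, mem_stdSphere.2 ⟨by rintro rfl; exact h0 rfl, by simpa using h1, ht⟩, rfl⟩

lemma verts_stdBall {A : Finset α} : A ⊆ verts (stdBall A) := by
  intro a ha
  exact subset_verts (s := {a}) (mem_stdBall.2 ⟨by simp, by simpa using ha⟩) (by simp)

lemma verts_stdSphere {A : Finset α} (hA : 2 ≤ A.card) : A ⊆ verts (stdSphere A) := by
  intro a ha
  refine subset_verts (s := {a}) (mem_stdSphere.2 ⟨?_, by simp, by simpa using ha⟩) (by simp)
  rintro rfl
  simp at hA

end Std
section Comb

variable {α β : Type*} [DecidableEq α] [DecidableEq β]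

/-- The boundary part (with the empty face). -/
def Bset (K : Finset (Finset α)) (n : ℕ) : Set (Finset α) :=
  {s | (s ∈ K ∧ ¬ NZ K n s) ∨ s = ∅}

lemma dims_image {f : α → β} {K : Finset (Finset α)} (hf : Set.InjOn f ↑(verts K)) {m : ℕ}
    (h : ∀ t ∈ K.image (Finset.image f), t.card ≤ m) : ∀ t ∈ K, t.card ≤ m := by
  intro t ht
  have := h _ (Finset.mem_image_of_mem _ ht)
  rwa [Finset.card_image_of_injOn (hf.mono (by exact_mod_cast subset_verts ht))] at this

lemma Hv_Bset_image {f : α → β} {g : β → α} {K : Finset (Finset α)} {n : ℕ}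
    (hg : ∀ x ∈ verts K, g (f x) = x) (hdim : ∀ t ∈ K, t.card ≤ n + 1) (m : ℕ) :
    Hv (Bset (K.image (Finset.image f)) n) m ↔ Hv (Bset K n) m := by
  have hc := CSub_image (n := n) hg hdim
  have e : Bset (K.image (Finset.image f)) n = Finset.image f '' Bset K n := by
    ext s
    constructor
    · rintro (⟨h1, h2⟩ | rfl)
      · rw [← hc.NZ_iff (Or.inl h1)] at h2
        obtain ⟨t, ht, rfl⟩ := Finset.mem_image.1 h1
        rw [image_image_of_left hg (subset_verts ht)] at h2
        exact ⟨t, Or.inl ⟨ht, h2⟩, rfl⟩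
      · exact ⟨∅, Or.inr rfl, by simp⟩
    · rintro ⟨t, (⟨h1, h2⟩ | rfl), rfl⟩
      · have h3 := Finset.mem_image_of_mem (Finset.image f) h1
        refine Or.inl ⟨h3, ?_⟩
        rw [← hc.NZ_iff (Or.inl h3), image_image_of_left hg (subset_verts h1)]
        exact h2
      · exact Or.inr (by simp)
  rw [e]
  refine Hv_push_iff (S := ↑(verts K)) (g := g) (fun x hx => hg x hx) ?_ m
  rintro s (⟨h1, _⟩ | rfl)
  · exact_mod_cast subset_verts h1
  · simp

lemma Hv_Bset_sub {G G' : GComplex} (h : Subdivides G' G) {n : ℕ}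
    (hdim : ∀ t ∈ G.faces, t.card ≤ n + 1)
    (hup : ∀ s ∈ G.faces, ∀ t ⊆ s, NZ G.faces n t → NZ G.faces n s)
    (hup' : ∀ s ∈ G'.faces, ∀ t ⊆ s, NZ G'.faces n t → NZ G'.faces n s)
    (hne : ∃ s ∈ G'.faces, ¬ NZ G'.faces n s) (m : ℕ) :
    Hv (Bset G.faces n) m ↔ Hv (Bset G'.faces n) m := by
  have hc := CSub_of h hdim
  have key := SUB G G' (G.faces.filter fun s => ¬ NZ G.faces n s)
    (G'.faces.filter fun s => ¬ NZ G'.faces n s) (Finset.filter_subset _ _)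
    (Finset.filter_subset _ _) ?_ ?_ ?_ ?_ ?_ ?_ m
  · have e1 : ∀ H : GComplex, {s | s ∈ H.faces.filter (fun s => ¬ NZ H.faces n s) ∨ s = ∅}
        = Bset H.faces n := by
      intro H
      ext s
      simp [Bset]
    rw [e1, e1] at key
    exact key
  · obtain ⟨s, hs, hn⟩ := hne
    exact ⟨car h s, Finset.mem_filter.2 ⟨hc.mem s hs, by rwa [hc.NZ_iff (Or.inl hs)]⟩⟩
  · obtain ⟨s, hs, hn⟩ := hne
    exact ⟨s, Finset.mem_filter.2 ⟨hs, hn⟩⟩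
  · intro s hs t hts htn
    rw [Finset.mem_filter] at hs ⊢
    exact ⟨G.down_closed s hs.1 t hts htn, fun h0 => hs.2 (hup s hs.1 t hts h0)⟩
  · intro s hs t hts htn
    rw [Finset.mem_filter] at hs ⊢
    exact ⟨G'.down_closed s hs.1 t hts htn, fun h0 => hs.2 (hup' s hs.1 t hts h0)⟩
  · intro s hs x hx
    rw [Finset.mem_filter] at hs
    obtain ⟨f, hf, hxf, hfs⟩ := car_cover h hs.1 hx
    refine ⟨f, Finset.mem_filter.2 ⟨hf, ?_⟩, hxf⟩
    rw [← hc.NZ_iff (Or.inl hf)]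
    exact fun h0 => hs.2 (hup s hs.1 _ hfs h0)
  · intro s hs x hx
    rw [Finset.mem_filter] at hs
    refine ⟨car h s, Finset.mem_filter.2 ⟨hc.mem s hs.1, by rw [hc.NZ_iff (Or.inl hs.1)]; exact hs.2⟩,
      hull_sub (hull_convex _) (car_spec h hs.1).2.1 hx⟩

lemma GComplex.dc (G : GComplex) : ∀ s ∈ G.faces, ∀ t ⊆ s, t ≠ ∅ → t ∈ G.faces :=
  fun s hs t hts h0 => G.down_closed s hs t hts (Finset.nonempty_iff_ne_empty.2 h0)

lemma GComplex.ne (G : GComplex) : Nonempty EE := ⟨fun _ => 0⟩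

lemma sub_dims {G G' : GComplex} (h : Subdivides G' G) {m : ℕ} (hd : ∀ t ∈ G'.faces, t.card ≤ m) :
    ∀ t ∈ G.faces, t.card ≤ m := by
  intro t ht
  obtain ⟨f, hf, _, _, hc⟩ := sub_g1 h (Or.inr rfl) ht (by rw [car_emp]; simp)
  rw [← hc]; exact hd f hf

lemma realizes_ne {G : GComplex} {K : Finset (Finset α)} {f : α → ℕ → ℝ}
    (h : G.faces = K.image (Finset.image f)) : Nonempty α := by
  obtain ⟨s, hs⟩ := G.nonempty
  have h1 := G.face_ne hs
  rw [h] at hs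
  obtain ⟨t, _, rfl⟩ := Finset.mem_image.1 hs
  obtain ⟨x, _⟩ := Finset.image_nonempty.1 h1
  exact ⟨x⟩

lemma sphere_AllGood {n : ℕ} {K : Finset (Finset α)} (h : IsCombSphere n K) : AllGood K n := by
  obtain ⟨A, hA, G1, G1', G2, G2', ⟨f1, hf1, e1⟩, ⟨f2, hf2, e2⟩, h1, h2, ⟨f, hf, e⟩⟩ := h
  have hinj : Set.InjOn f2 ↑A :=
    hf2.mono (by exact_mod_cast verts_stdSphere (by omega))
  rw [stdSphere_image hinj] at e2
  have hB : (A.image f2).card = n + 2 := by rw [Finset.card_image_of_injOn hinj, hA]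
  have g2 : AllGood G2.faces n := by rw [e2]; exact AllGood_std hB
  have g2' : AllGood G2'.faces n := (CSub_of h2 g2.1).AllGood_iff.1 g2
  have d1' : ∀ t ∈ G1'.faces, t.card ≤ n + 1 := dims_image hf (by rw [← e]; exact g2'.1)
  obtain ⟨g, hg⟩ := exists_left hf G1'.ne
  have g1' : AllGood G1'.faces n := (CSub_image hg d1').AllGood_iff.2 (by rw [← e]; exact g2')
  have d1 := sub_dims h1 d1'
  have g1 : AllGood G1.faces n := (CSub_of h1 d1).AllGood_iff.2 g1'
  have dK : ∀ t ∈ K, t.card ≤ n + 1 := dims_image hf1 (by rw [← e1]; exact d1)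
  obtain ⟨g', hg'⟩ := exists_left hf1 (realizes_ne e1)
  exact (CSub_image hg' dK).AllGood_iff.2 (by rw [← e1]; exact g1)

lemma Hv_Bset_std {n : ℕ} (hn : 1 ≤ n) {B : Finset α} (hB : B.card = n + 1) {m : ℕ} (hm : m < n) :
    Hv (Bset (stdBall B) n) m := by
  obtain ⟨b, hb⟩ : B.Nonempty := by rw [← Finset.card_pos]; omega
  refine Hv_cone b m ?_
  intro s hs hsm _
  have hsB : s ⊆ B := by
    rcases hs with ⟨h1, _⟩ | rfl
    · exact (mem_stdBall.1 h1).2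
    · simp
  have hi : insert b s ⊆ B := Finset.insert_subset hb hsB
  refine Or.inl ⟨mem_stdBall.2 ⟨by simp, hi⟩, ?_⟩
  rw [NZ_stdBall hn hB hi]
  intro h
  have h1 := Finset.card_insert_le b s
  rw [h] at h1
  omega

lemma ball_main {n : ℕ} (hn : 1 ≤ n) {K : Finset (Finset α)} (h : IsCombBall n K)
    (hK0 : ∅ ∉ K) (hKd : ∀ s ∈ K, ∀ t ⊆ s, t ≠ ∅ → t ∈ K) :
    BallLike K n ∧ ∀ m < n, Hv (Bset K n) m := by
  obtain ⟨A, hA, G1, G1', G2, G2', ⟨f1, hf1, e1⟩, ⟨f2, hf2, e2⟩, h1, h2, ⟨f, hf, e⟩⟩ := h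
  have hinj : Set.InjOn f2 ↑A := hf2.mono (by exact_mod_cast verts_stdBall)
  rw [stdBall_image] at e2
  have hB : (A.image f2).card = n + 1 := by rw [Finset.card_image_of_injOn hinj, hA]
  have d2 : ∀ t ∈ G2.faces, t.card ≤ n + 1 := by
    intro t ht
    rw [e2, mem_stdBall] at ht
    rw [← hB]; exact Finset.card_le_card ht.2
  have c2 := CSub_of h2 d2
  have g2' : BallLike G2'.faces n :=
    CSub.BallLike_std hn hB (φ := car h2) (by rw [← e2]; exact c2) G2'.dc
  have d1' : ∀ t ∈ G1'.faces, t.card ≤ n + 1 := dims_image hf (by rw [← e]; exact g2'.1)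
  obtain ⟨g, hg⟩ := exists_left hf G1'.ne
  have g1' : BallLike G1'.faces n :=
    (CSub_image hg d1').BallLike_up G1'.empty_not_mem (by rw [← e]; exact g2') G1'.dc
  have d1 := sub_dims h1 d1'
  have g1 : BallLike G1.faces n := (CSub_of h1 d1).BallLike_up G1.empty_not_mem g1' G1.dc
  have g2 : BallLike G2.faces n := c2.BallLike_up G2.empty_not_mem g2' G2.dc
  have dK : ∀ t ∈ K, t.card ≤ n + 1 := dims_image hf1 (by rw [← e1]; exact d1)
  obtain ⟨g', hg'⟩ := exists_left hf1 (realizes_ne e1)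
  refine ⟨(CSub_image hg' dK).BallLike_up hK0 (by rw [← e1]; exact g1) hKd, fun m hm => ?_⟩
  rw [← Hv_Bset_image hg' dK, ← e1, Hv_Bset_sub h1 d1 g1.2.1 g1'.2.1 g1'.2.2.2.2,
    ← Hv_Bset_image hg d1', ← e, ← Hv_Bset_sub h2 d2 g2.2.1 g2'.2.1 g2'.2.2.2.2, e2]
  exact Hv_Bset_std hn hB hm

end Comb
section Conv

variable {α : Type*} [DecidableEq α]

/-- Faces together with the empty face. -/
def aug (K : Finset (Finset α)) : Set (Finset α) := {s | s ∈ K ∨ s = ∅}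

lemma mem_Ch {K : Set (Finset α)} {n : ℕ} {c : Finset α →₀ ZMod 2} :
    c ∈ Ch K n ↔ ∀ s, c s ≠ 0 → s ∈ K ∧ s.card = n := by
  rw [Ch, Finsupp.mem_supported]
  constructor
  · intro h s hs
    exact h (by simpa using hs)
  · intro h s hs
    exact h s (by simpa using hs)

lemma bd_apply_sum (c : Finset α →₀ ZMod 2) (t : Finset α) :
    bd c t = ∑ s ∈ c.support, ∑ v ∈ s, if s.erase v = t then c s else 0 := by
  rw [bd, Finsupp.linearCombination_apply, Finsupp.sum, Finsupp.finsetSum_apply]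
  refine Finset.sum_congr rfl (fun s _ => ?_)
  rw [Finsupp.smul_apply, Finsupp.finsetSum_apply, Finset.smul_sum]
  refine Finset.sum_congr rfl (fun v _ => ?_)
  rw [Finsupp.single_apply]
  split_ifs <;> simp

lemma bd_apply (c : Finset α →₀ ZMod 2) {A : Finset α} (hA : ∀ s, c s ≠ 0 → s ⊆ A)
    (t : Finset α) : bd c t = ∑ v ∈ A \ t, c (insert v t) := by
  rw [bd_apply_sum]
  have h1 : ∀ s ∈ c.support, (∑ v ∈ s, if s.erase v = t then c s else 0) =
      ∑ v ∈ A \ t, if insert v t = s then c s else 0 := by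
    intro s hs
    have hsA := hA s (by simpa using hs)
    have h2 : (∑ v ∈ s, if s.erase v = t then c s else 0) =
        ∑ v ∈ A, if (v ∈ s ∧ s.erase v = t) then c s else 0 := by
      rw [← Finset.sum_filter, ← Finset.sum_filter]
      refine Finset.sum_congr ?_ (fun _ _ => rfl)
      ext v
      simp only [Finset.mem_filter]
      exact ⟨fun h => ⟨hsA h.1, h⟩, fun h => h.2⟩
    rw [h2, ← Finset.sum_filter, ← Finset.sum_filter]
    refine Finset.sum_congr ?_ (fun _ _ => rfl)
    ext v
    simp only [Finset.mem_filter, Finset.mem_sdiff]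
    constructor
    · rintro ⟨h3, h4, rfl⟩
      exact ⟨⟨h3, by simp⟩, Finset.insert_erase h4⟩
    · rintro ⟨⟨h3, h4⟩, rfl⟩
      exact ⟨h3, by simp, Finset.erase_insert h4⟩
  rw [Finset.sum_congr rfl h1, Finset.sum_comm]
  refine Finset.sum_congr rfl (fun v _ => ?_)
  rw [Finset.sum_ite_eq]
  split_ifs with h
  · rfl
  · simpa using Eq.symm (by simpa using h)

lemma bd_tops {K : Finset (Finset α)} {n : ℕ} {c : Finset α →₀ ZMod 2} (hc : c ∈ Ch (aug K) (n + 1))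
    {r : Finset α} (hr : r.card = n) : bd c r = ∑ t ∈ tops K n r, c t := by
  rw [mem_Ch] at hc
  rw [bd_apply_sum]
  have h1 : ∀ s ∈ c.support, (∑ v ∈ s, if s.erase v = r then c s else 0) =
      if r ⊆ s then c s else 0 := by
    intro s hs
    have hs' := hc s (by simpa using hs)
    split_ifs with h
    · obtain ⟨a, ha⟩ := Finset.card_eq_one.1 (show (s \ r).card = 1 by
        rw [Finset.card_sdiff_of_subset h]; omega)
      have has : a ∈ s \ r := by rw [ha]; simp
      rw [Finset.mem_sdiff] at has
      have hsr : s.erase a = r := by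
        rw [← Finset.sdiff_singleton_eq_erase, ← ha, Finset.sdiff_sdiff_eq_self h]
      rw [Finset.sum_eq_single_of_mem a has.1]
      · rw [if_pos hsr]
      · intro b hb hba
        rw [if_neg]
        intro he
        have : a ∈ s.erase b := Finset.mem_erase.2 ⟨fun h => hba h.symm, has.1⟩
        rw [he] at this
        exact has.2 this
    · refine Finset.sum_eq_zero (fun v _ => if_neg ?_)
      rintro rfl
      exact h (Finset.erase_subset _ _)
  rw [Finset.sum_congr rfl h1, ← Finset.sum_filter]
  refine Finset.sum_subset_zero_on_sdiff ?_ ?_ (fun _ _ => rfl)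
  · intro s hs
    rw [Finset.mem_filter] at hs
    have hs' := hc s (by simpa using hs.1)
    rw [mem_tops]
    refine ⟨?_, hs.2, hs'.2⟩
    rcases hs'.1 with h | rfl
    · exact h
    · simp at hs'
  · intro s hs
    rw [Finset.mem_sdiff, Finset.mem_filter, mem_tops] at hs
    by_contra h0
    exact hs.2 ⟨by simpa using h0, hs.1.2.1⟩

/-- A chain as a finitely supported function. -/
lemma to_fs {K : Finset (Finset α)} {n : ℕ} {c : Finset α → ZMod 2} (h : z2chainOK K n c) :
    ∃ C ∈ Ch (aug K) n, ⇑C = c ∧ ⇑(bd C) = z2bdry K c := by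
  let C : Finset α →₀ ZMod 2 := Finsupp.onFinset (insert ∅ K) c (by
    intro s hs
    rcases (h s hs).2 with h | h <;> simp [h])
  have hC : ⇑C = c := rfl
  refine ⟨C, mem_Ch.2 (fun s hs => ⟨(h s hs).2, (h s hs).1⟩), hC, ?_⟩
  funext t
  rw [bd_apply C (A := verts K)]
  · rfl
  · intro s hs
    rcases (h s hs).2 with h | rfl
    · exact subset_verts h
    · simp

lemma of_fs {K : Finset (Finset α)} {n : ℕ} {C : Finset α →₀ ZMod 2} (h : C ∈ Ch (aug K) n) :
    z2chainOK K n C ∧ z2bdry K C = bd C := by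
  have h' : z2chainOK K n C := fun s hs => ⟨(mem_Ch.1 h s hs).2, (mem_Ch.1 h s hs).1⟩
  obtain ⟨D, _, h1, h2⟩ := to_fs h'
  have : D = C := DFunLike.coe_injective h1
  rw [this] at h2
  exact ⟨h', h2.symm⟩

lemma Hv_iff {K : Finset (Finset α)} {n : ℕ} :
    (∀ c, z2chainOK K n c → z2bdry K c = 0 → ∃ c', z2chainOK K (n + 1) c' ∧ z2bdry K c' = c) ↔
      Hv (aug K) n := by
  constructor
  · intro h C hC h0
    obtain ⟨h1, h2⟩ := of_fs hC
    obtain ⟨c', h3, h4⟩ := h C h1 (by rw [h2, h0]; rfl)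
    obtain ⟨D, hD, h5, h6⟩ := to_fs h3
    exact ⟨D, hD, DFunLike.coe_injective (h6.trans h4)⟩
  · intro h c hc h0
    obtain ⟨C, hC, h1, h2⟩ := to_fs hc
    obtain ⟨D, hD, h3⟩ := h C hC (DFunLike.coe_injective (by rw [h2, h0]; rfl))
    obtain ⟨h4, h5⟩ := of_fs hD
    exact ⟨D, h4, by rw [h5, h3, h1]⟩

lemma sphere_top {K : Finset (Finset α)} {d : ℕ} (hdim : ∀ t ∈ K, t.card ≤ d + 1)
    (h : Z2HomologySphere d K) {a b : Finset α →₀ ZMod 2} (ha : a ∈ Ch (aug K) (d + 1))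
    (hb : b ∈ Ch (aug K) (d + 1)) (ha0 : bd a = 0) (hb0 : bd b = 0) (hne : a ≠ 0) (hbne : b ≠ 0) :
    a = b := by
  obtain ⟨_, z, hz, hz0, hzb, hzu⟩ := h
  have hno : ∀ c', z2chainOK K (d + 2) c' → z2bdry K c' = 0 := by
    intro c' hc'
    have : c' = 0 := by
      funext s
      by_contra h0
      obtain ⟨h1, h2⟩ := hc' s h0
      rcases h2 with h2 | rfl
      · have := hdim s h2; omega
      · simp at h1
    rw [this]
    funext t
    simp [z2bdry]
  have key : ∀ {x : Finset α →₀ ZMod 2}, x ∈ Ch (aug K) (d + 1) → bd x = 0 → x ≠ 0 → ⇑x = z := by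
    intro x hx hx0 hxn
    obtain ⟨h1, h2⟩ := of_fs hx
    rcases hzu x h1 (by rw [h2, hx0]; rfl) with ⟨c', hc', e⟩ | ⟨c', hc', e⟩
    · rw [hno c' hc'] at e
      exact absurd (DFunLike.coe_injective e.symm) hxn
    · rw [hno c' hc'] at e
      funext s
      have := congrFun e s
      simp only [Pi.zero_apply, Pi.add_apply] at this
      rw [← sub_eq_zero, CharTwo.sub_eq_add, add_comm, ← this]
  exact DFunLike.coe_injective ((key ha ha0 hne).trans (key hb hb0 hbne).symm)

end Conv

section Manifold

variable {α : Type*} [DecidableEq α]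

lemma mem_link_iff {X : Finset (Finset α)} (hX : IsComplex X) {v : α} {u : Finset α}
    (hu : u ≠ ∅) : u ∈ link X {v} ↔ v ∉ u ∧ insert v u ∈ X := by
  rw [link, Finset.mem_filter, Finset.disjoint_singleton_right, Finset.union_comm,
    ← Finset.insert_eq]
  constructor
  · exact fun h => h.2
  · exact fun h => ⟨hX.2.2 _ h.2 u (Finset.subset_insert _ _)
      (Finset.nonempty_iff_ne_empty.2 hu), h⟩

lemma link_sum {X : Finset (Finset α)} (hX : IsComplex X) {v : α} {n : ℕ} {r : Finset α}
    (hv : v ∈ r) (z : Finset α → ZMod 2) :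
    ∑ t ∈ tops X (n + 1) r, z t = ∑ u ∈ tops (link X {v}) n (r.erase v), z (insert v u) := by
  refine Finset.sum_bij' (fun t _ => t.erase v) (fun u _ => insert v u) ?_ ?_ ?_ ?_ ?_
  · intro t ht
    rw [mem_tops] at *
    have hvt := ht.2.1 hv
    have hc : (t.erase v).card = n + 1 := by rw [Finset.card_erase_of_mem hvt, ht.2.2]; rfl
    refine ⟨(mem_link_iff hX ?_).2 ⟨by simp, ?_⟩, Finset.erase_subset_erase _ ht.2.1, hc⟩
    · intro h0; rw [h0] at hc; simp at hc
    · rw [Finset.insert_erase hvt]; exact ht.1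
  · intro u hu
    rw [mem_tops] at *
    have hu' := (mem_link_iff hX (by intro h0; rw [h0] at hu; simp at hu)).1 hu.1
    refine ⟨hu'.2, ?_, ?_⟩
    · rw [← Finset.insert_erase hv]; exact Finset.insert_subset_insert _ hu.2.1
    · rw [Finset.card_insert_of_notMem hu'.1, hu.2.2]
  · intro t ht
    exact Finset.insert_erase ((mem_tops.1 ht).2.1 hv)
  · intro u hu
    rw [mem_tops] at hu
    have hu' := (mem_link_iff hX (by intro h0; rw [h0] at hu; simp at hu)).1 hu.1
    exact Finset.erase_insert hu'.1
  · intro t ht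
    rw [Finset.insert_erase ((mem_tops.1 ht).2.1 hv)]

lemma tops_link {X : Finset (Finset α)} (hX : IsComplex X) {v : α} {n : ℕ} {r t : Finset α}
    (hv : v ∈ r) (ht : t ∈ tops X (n + 1) r) : t.erase v ∈ tops (link X {v}) n (r.erase v) := by
  rw [mem_tops] at *
  have hvt := ht.2.1 hv
  have hc : (t.erase v).card = n + 1 := by rw [Finset.card_erase_of_mem hvt, ht.2.2]; rfl
  refine ⟨(mem_link_iff hX ?_).2 ⟨by simp, ?_⟩, Finset.erase_subset_erase _ ht.2.1, hc⟩
  · intro h0; rw [h0] at hc; simp at hc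
  · rw [Finset.insert_erase hvt]; exact ht.1

lemma man_good {X : Finset (Finset α)} (hX : IsComplex X) {n : ℕ}
    (h : ∀ v ∈ verts X, AllGood (link X {v}) n) :
    (∀ t ∈ X, t.card ≤ n + 2) ∧ ∀ s ∈ X, Good X (n + 1) s := by
  have hne : ∀ s ∈ X, s.Nonempty := by
    intro s hs
    rw [Finset.nonempty_iff_ne_empty]; rintro rfl; exact hX.2.1 hs
  have hlk : ∀ s ∈ X, ∀ v ∈ s, s.erase v ∈ link X {v} ∨ s.erase v = ∅ := by
    intro s hs v hv
    by_cases h0 : s.erase v = ∅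
    · exact Or.inr h0
    · refine Or.inl ((mem_link_iff hX h0).2 ⟨by simp, ?_⟩)
      rwa [Finset.insert_erase hv]
  constructor
  · intro t ht
    obtain ⟨v, hv⟩ := hne t ht
    have hc := Finset.card_erase_add_one hv
    rcases hlk t ht v hv with h1 | h1
    · have := (h v (subset_verts ht hv)).1 _ h1
      omega
    · rw [h1] at hc; simp at hc; omega
  · intro s hs
    obtain ⟨v, hv⟩ := hne s hs
    obtain ⟨g1, g2, g3⟩ := (h v (subset_verts hs hv)).2 _ (hlk s hs v hv)
    refine ⟨?_, ?_, ?_⟩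
    · obtain ⟨u, hu⟩ := g1
      rw [mem_tops] at hu
      have hu' := (mem_link_iff hX (by intro h0; rw [h0] at hu; simp at hu)).1 hu.1
      refine ⟨insert v u, mem_tops.2 ⟨hu'.2, ?_, ?_⟩⟩
      · rw [← Finset.insert_erase hv]; exact Finset.insert_subset_insert _ hu.2.1
      · rw [Finset.card_insert_of_notMem hu'.1, hu.2.2]
    · intro r hr hsr hrn
      have hrX : r ∈ X := by
        rcases hr with hr | rfl
        · exact hr
        · simp at hrn
      rw [link_sum hX (hsr hv)]
      refine g2 _ (hlk r hrX v (hsr hv)) (Finset.erase_subset_erase _ hsr) ?_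
      rw [Finset.card_erase_of_mem (hsr hv), hrn]; rfl
    · intro z hz t1 ht1 t2 ht2
      have h1 := tops_link hX hv ht1
      have h2 := tops_link hX hv ht2
      have := g3 (fun u => z (insert v u)) ?_ _ h1 _ h2
      · rwa [Finset.insert_erase ((mem_tops.1 ht1).2.1 hv),
          Finset.insert_erase ((mem_tops.1 ht2).2.1 hv)] at this
      · intro u hu hsu hun
        have hu' : v ∉ u ∧ insert v u ∈ X := by
          rcases hu with hu | rfl
          · refine (mem_link_iff hX ?_).1 hu
            rintro rfl
            exact hX.2.1 (Finset.mem_filter.1 hu).1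
          · exact ⟨by simp, hX.2.2 s hs _ (by simpa using hv) (by simp)⟩
        have h3 := hz (insert v u) (Or.inl hu'.2) ?_ ?_
        · rw [link_sum hX (Finset.mem_insert_self v u), Finset.erase_insert hu'.1] at h3
          exact h3
        · rw [← Finset.insert_erase hv]; exact Finset.insert_subset_insert _ hsu
        · rw [Finset.card_insert_of_notMem hu'.1, hun]

/-- The fundamental cycle. -/
lemma exists_fund {X : Finset (Finset α)} (hX : IsComplex X) {d : ℕ} (hd : 1 ≤ d)
    (hg : ∀ s ∈ X, Good X d s) :
    ∃ F ∈ Ch (aug X) (d + 1), bd F = 0 ∧ (∀ t ∈ X, t.card = d + 1 → F t = 1) ∧ F ≠ 0 := by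
  let F : Finset α →₀ ZMod 2 := Finsupp.onFinset X
    (fun t => if t ∈ X ∧ t.card = d + 1 then 1 else 0) (by
      intro s hs
      by_contra h0
      simp [h0] at hs)
  have hF : ∀ t, F t = if t ∈ X ∧ t.card = d + 1 then 1 else 0 := fun _ => rfl
  have hFc : F ∈ Ch (aug X) (d + 1) := by
    rw [mem_Ch]
    intro s hs
    rw [hF] at hs
    by_cases h : s ∈ X ∧ s.card = d + 1
    · exact ⟨Or.inl h.1, h.2⟩
    · simp [h] at hs
  have hF1 : ∀ t ∈ X, t.card = d + 1 → F t = 1 := fun t h1 h2 => by rw [hF, if_pos ⟨h1, h2⟩]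
  have hdc : DC (aug X) := by
    rintro s (hs | rfl) t hts
    · by_cases h0 : t = ∅
      · exact Or.inr h0
      · exact Or.inl (hX.2.2 s hs t hts (Finset.nonempty_iff_ne_empty.2 h0))
    · exact Or.inr (Finset.subset_empty.1 hts)
  refine ⟨F, hFc, ?_, hF1, ?_⟩
  · ext r
    by_contra h0
    obtain ⟨h1, h2⟩ := mem_Ch.1 (bd_mem hdc hFc) r h0
    have hrX : r ∈ X := by
      rcases h1 with h1 | rfl
      · exact h1
      · simp at h2; omega
    apply h0
    rw [bd_tops hFc h2, Finsupp.zero_apply, ← (hg r hrX).2.1 r (Or.inl hrX) le_rfl h2]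
    refine Finset.sum_congr rfl (fun t ht => ?_)
    rw [mem_tops] at ht
    exact hF1 t ht.1 ht.2.2
  · intro h0
    obtain ⟨s, hs⟩ := hX.1
    obtain ⟨t, ht⟩ := (hg s hs).1
    rw [mem_tops] at ht
    have := hF1 t ht.1 ht.2.2
    rw [h0] at this
    simp at this

end Manifold
section Final

variable {α : Type*} [DecidableEq α]

lemma DC_aug {X : Finset (Finset α)} (hX : ∀ s ∈ X, ∀ t ⊆ s, t ≠ ∅ → t ∈ X) : DC (aug X) := by
  rintro s (hs | rfl) t hts
  · by_cases h0 : t = ∅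
    · exact Or.inr h0
    · exact Or.inl (hX s hs t hts h0)
  · exact Or.inr (Finset.subset_empty.1 hts)

lemma final {X X₁ X₂ : Finset (Finset α)} (hX : IsComplex X) {d : ℕ} (hd : 1 ≤ d)
    (hdim : ∀ t ∈ X, t.card ≤ d + 1) (hg : ∀ s ∈ X, Good X d s) (hsph : Z2HomologySphere d X)
    (h1X : X₁ ⊆ X) (h1d : ∀ s ∈ X₁, ∀ t ⊆ s, t ≠ ∅ → t ∈ X₁)
    (hb : BallLike X₁ d) (hH : ∀ m < d, Hv (Bset X₁ d) m)
    (h2 : ∀ s, s ∈ X₂ ↔ s ∈ X ∧ ∃ t ∈ tops X d s, t ∉ X₁) : Z2Acyclic X₂ := by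
  have hne : ∀ s ∈ X, s ≠ ∅ := by rintro s hs rfl; exact hX.2.1 hs
  have h2X : X₂ ⊆ X := fun s hs => ((h2 s).1 hs).1
  have h2d : ∀ s ∈ X₂, ∀ t ⊆ s, t ≠ ∅ → t ∈ X₂ := by
    intro s hs t hts ht0
    obtain ⟨h3, u, hu, hu1⟩ := (h2 s).1 hs
    refine (h2 t).2 ⟨hX.2.2 s h3 t hts (Finset.nonempty_iff_ne_empty.2 ht0), u, ?_, hu1⟩
    rw [mem_tops] at *
    exact ⟨hu.1, hts.trans hu.2.1, hu.2.2⟩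
  have hsubtop : ∀ {s r : Finset α}, s ⊆ r → tops X d r ⊆ tops X d s := by
    intro s r hsr t ht
    rw [mem_tops] at *
    exact ⟨ht.1, hsr.trans ht.2.1, ht.2.2⟩
  have htop1 : ∀ {s t : Finset α}, t ∈ tops X₁ d s → t ∈ tops X d s := by
    intro s t ht
    rw [mem_tops] at *
    exact ⟨h1X ht.1, ht.2⟩
  have hF4 : ∀ s ∈ X₁, (s ∈ X₂ ↔ ¬ NZ X₁ d s) := by
    intro s hs
    have hsX := h1X hs
    constructor
    · rintro hs2 ⟨z, hz, t0, ht0, hzt0⟩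
      obtain ⟨_, t, ht, ht1⟩ := (h2 s).1 hs2
      have hlc : LC X d (fun r => s ⊆ r) (fun t => if t ∈ X₁ then z t else 0) := by
        intro r hr hsr hrn
        by_cases hr1 : r ∈ X₁
        · refine Eq.trans ?_ (hz r (Or.inl hr1) hsr hrn)
          rw [← Finset.sum_filter]
          refine Finset.sum_congr ?_ (fun _ _ => rfl)
          ext u
          rw [Finset.mem_filter, mem_tops, mem_tops]
          exact ⟨fun h => ⟨h.2, h.1.2⟩, fun h => ⟨⟨h1X h.1, h.2⟩, h.1⟩⟩
        · refine Finset.sum_eq_zero (fun u hu => if_neg (fun hu1 => hr1 ?_))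
          refine h1d u hu1 r (mem_tops.1 hu).2.1 ?_
          rintro rfl
          exact hne s hsX (Finset.subset_empty.1 hsr)
      have := (hg s hsX).2.2 _ hlc t0 (htop1 ht0) t ht
      rw [if_pos (mem_tops.1 ht0).1, if_neg ht1] at this
      exact hzt0 this
    · intro hn
      by_contra hs2
      apply hn
      have hall : ∀ t ∈ tops X d s, t ∈ X₁ := by
        intro t ht
        by_contra ht1
        exact hs2 ((h2 s).2 ⟨hsX, t, ht, ht1⟩)
      obtain ⟨⟨t, ht⟩, h3, _⟩ := hg s hsX
      refine ⟨fun _ => 1, ?_, t, ?_, one_ne_zero⟩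
      · intro r hr hsr hrn
        have hrX : r ∈ X ∨ r = ∅ := hr.imp (fun h => h1X h) id
        rw [← h3 r hrX hsr hrn]
        refine Finset.sum_congr ?_ (fun _ _ => rfl)
        refine Finset.Subset.antisymm (fun u hu => htop1 hu) (fun u hu => ?_)
        have := hall u (hsubtop hsr hu)
        rw [mem_tops] at *
        exact ⟨this, hu.2⟩
      · rw [mem_tops]
        exact ⟨hall t ht, (mem_tops.1 ht).2⟩
  have hF5 : ∀ s ∈ X, s ∈ X₁ ∨ s ∈ X₂ := by
    intro s hs
    obtain ⟨t, ht⟩ := (hg s hs).1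
    by_cases ht1 : t ∈ X₁
    · exact Or.inl (h1d t ht1 s (mem_tops.1 ht).2.1 (hne s hs))
    · exact Or.inr ((h2 s).2 ⟨hs, t, ht, ht1⟩)
  have hF6 : ∀ t ∈ X₁, t.card = d + 1 → t ∉ X₂ := by
    intro t ht htn ht2
    obtain ⟨_, u, hu, hu1⟩ := (h2 t).1 ht2
    rw [mem_tops] at hu
    have : t = u := Finset.eq_of_subset_of_card_le hu.2.1 (by omega)
    exact hu1 (this ▸ ht)
  have hB : Bset X₁ d = aug X₁ ∩ aug X₂ := by
    ext s
    constructor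
    · rintro (⟨h3, h4⟩ | rfl)
      · exact ⟨Or.inl h3, Or.inl ((hF4 s h3).2 h4)⟩
      · exact ⟨Or.inr rfl, Or.inr rfl⟩
    · rintro ⟨h3 | rfl, h4⟩
      · rcases h4 with h4 | rfl
        · exact Or.inl ⟨h3, (hF4 s h3).1 h4⟩
        · exact Or.inr rfl
      · exact Or.inr rfl
  have hU : aug X ⊆ aug X₁ ∪ aug X₂ := by
    rintro s (hs | rfl)
    · exact (hF5 s hs).imp Or.inl Or.inl
    · exact Or.inl (Or.inr rfl)
  have hdc1 : DC (aug X₁) := DC_aug h1d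
  have hdc2 : DC (aug X₂) := DC_aug h2d
  have ha2 : aug X₂ ⊆ aug X := fun s hs => hs.imp (fun h => h2X h) id
  obtain ⟨F, hF, hF0, hF1, hFne⟩ := exists_fund hX hd hg
  obtain ⟨t0, ht0⟩ := hb.2.2.2.1
  rw [mem_tops] at ht0
  intro m
  rw [Hv_iff]
  intro c hc hc0
  by_cases hm : m = d + 1
  · subst hm
    have hcz : c = 0 := by
      by_contra hcn
      have := sphere_top hdim hsph (Ch_mono ha2 _ hc) hF hc0 hF0 hcn hFne
      have h3 : c t0 = 1 := by rw [this]; exact hF1 t0 (h1X ht0.1) ht0.2.2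
      have h4 := mem_Ch.1 hc t0 (by rw [h3]; exact one_ne_zero)
      rcases h4.1 with h5 | h5
      · exact hF6 t0 ht0.1 ht0.2.2 h5
      · exact hne t0 (h1X ht0.1) h5
    exact ⟨0, Submodule.zero_mem _, by rw [hcz, map_zero]⟩
  · obtain ⟨e, he, hec⟩ := (Hv_iff.1 (fun c => hsph.1 m c hm)) c (Ch_mono ha2 _ hc) hc0
    obtain ⟨e1, he1, e2, he2, rfl⟩ := Ch_split (Ch_mono hU _ he)
    have hbd1 : bd e1 = c + bd e2 := by
      rw [← hec, map_add, add_assoc, two_add, add_zero]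
    have hbd2 : bd e1 ∈ Ch (aug X₂) m := by
      rw [hbd1]; exact Submodule.add_mem _ hc (bd_mem hdc2 he2)
    rcases lt_trichotomy m d with hlt | rfl | hgt
    · obtain ⟨f, hf, hfe⟩ := hH m hlt (bd e1) (by
        rw [hB]; exact Ch_inter (bd_mem hdc1 he1) hbd2) (bd_bd _)
      refine ⟨f + e2, Submodule.add_mem _ (Ch_mono ?_ _ hf) he2, ?_⟩
      · rw [hB]; exact Set.inter_subset_right
      · rw [map_add, hfe, ← map_add, hec]
    · have hlc : LC X₁ m (NZ X₁ m) e1 := by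
        intro r hr hrz hrn
        have hr1 : r ∈ X₁ := by
          rcases hr with hr | rfl
          · exact hr
          · simp at hrn; omega
        rw [← bd_tops he1 hrn]
        by_contra h0
        rcases (mem_Ch.1 hbd2 r h0).1 with h5 | h5
        · exact (hF4 r hr1).1 h5 hrz
        · exact hne r (h1X hr1) h5
      have hcon := hb.2.2.1 e1 hlc
      have hcon' : ∀ t ∈ X₁, t.card = m + 1 → e1 t = e1 t0 := by
        intro t ht htn
        exact hcon t (mem_tops.2 ⟨ht, by simp, htn⟩) t0 (mem_tops.2 ⟨ht0.1, by simp, ht0.2.2⟩)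
      have h01 : ∀ x : ZMod 2, x = 0 ∨ x = 1 := by decide
      rcases h01 (e1 t0) with h0 | h0
      · have : e1 = 0 := by
          ext t
          by_contra h3
          obtain ⟨h4, h5⟩ := mem_Ch.1 he1 t h3
          rcases h4 with h4 | rfl
          · exact h3 ((hcon' t h4 h5).trans h0)
          · simp at h5
        rw [this, zero_add] at hec
        exact ⟨e2, he2, hec⟩
      · refine ⟨e1 + e2 + F, ?_, by rw [map_add, hec, hF0, add_zero]⟩
        rw [mem_Ch]
        intro t ht
        obtain ⟨h3, h4⟩ := mem_Ch.1 (Submodule.add_mem _ he hF) t ht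
        refine ⟨?_, h4⟩
        by_contra h5
        have h6 : t ∈ X := by
          rcases h3 with h3 | rfl
          · exact h3
          · exact absurd (Or.inr rfl) h5
        have h7 : t ∈ X₁ := (hF5 t h6).resolve_right (fun h => h5 (Or.inl h))
        have h8 : e2 t = 0 := by
          by_contra h9
          exact h5 (mem_Ch.1 he2 t h9).1
        apply ht
        rw [Finsupp.add_apply, Finsupp.add_apply, h8, hcon' t h7 h4, h0, hF1 t h6 h4]
        decide
    · have : e1 = 0 := by
        ext t
        by_contra h3
        obtain ⟨h4, h5⟩ := mem_Ch.1 he1 t h3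
        rcases h4 with h4 | rfl
        · have := hdim t (h1X h4); omega
        · simp at h5
      rw [this, zero_add] at hec
      exact ⟨e2, he2, hec⟩

lemma nbhd_iff {X X₁ : Finset (Finset α)} (hX : IsComplex X) {d : ℕ}
    (hdim : ∀ t ∈ X, t.card ≤ d + 1) (hg : ∀ s ∈ X, Good X d s) (hind : IsInduced X X₁)
    (s : Finset α) :
    s ∈ simpNbhd (simpComplement X₁ X) X ↔ s ∈ X ∧ ∃ t ∈ tops X d s, t ∉ X₁ := by
  have hv : ∀ v, v ∈ verts (simpComplement X₁ X) ↔ v ∈ verts X ∧ v ∉ verts X₁ := by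
    intro v
    constructor
    · intro h
      rw [verts, Finset.mem_sup] at h
      obtain ⟨t, ht, hvt⟩ := h
      rw [simpComplement, Finset.mem_filter] at ht
      exact Finset.mem_sdiff.1 (ht.2 hvt)
    · rintro ⟨h1, h2⟩
      have h3 := h1
      rw [verts, Finset.mem_sup] at h3
      obtain ⟨t, ht, hvt⟩ := h3
      refine subset_verts (s := {v}) ?_ (by simp)
      rw [simpComplement, Finset.mem_filter]
      refine ⟨hX.2.2 t ht {v} (by simpa using hvt) (by simp), ?_⟩
      rw [Finset.singleton_subset_iff, Finset.mem_sdiff]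
      exact ⟨h1, h2⟩
  rw [simpNbhd, Finset.mem_filter]
  refine and_congr_right (fun hs => ?_)
  constructor
  · rintro ⟨t, ht, hst, v, hvt⟩
    rw [facets, Finset.mem_filter] at ht
    obtain ⟨u, hu⟩ := (hg t ht.1).1
    rw [mem_tops] at hu
    have := ht.2 u hu.1 hu.2.1
    subst this
    rw [Finset.mem_inter, hv] at hvt
    exact ⟨u, mem_tops.2 ⟨hu.1, hst, hu.2.2⟩, fun h => hvt.2.2 (subset_verts h hvt.1)⟩
  · rintro ⟨t, ht, ht1⟩
    rw [mem_tops] at ht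
    have h1 : ¬ t ⊆ verts X₁ := fun h => ht1 (hind.2 t ht.1 h)
    obtain ⟨v, hvt, hv1⟩ := Finset.not_subset.1 h1
    refine ⟨t, ?_, ht.2.1, v, ?_⟩
    · rw [facets, Finset.mem_filter]
      refine ⟨ht.1, fun u hu htu => (Finset.eq_of_subset_of_card_le htu ?_).symm⟩
      have := hdim u hu
      omega
    · rw [Finset.mem_inter, hv]
      exact ⟨hvt, subset_verts ht.1 hvt, hv1⟩

end Final
/-- Lemma 4.3: for a combinatorial triangulation `X` of a
`ℤ/2`-homology `d`-sphere and an induced subcomplex `X₁` which is a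
combinatorial `d`-ball, with `L = C(X₁, X)` and `X₂ = N(L, X)`, the complex
`X₂` is `ℤ/2`-acyclic. -/
theorem neighbourhood_of_complement_acyclic {V : Type*} [DecidableEq V]
    (d : ℕ) (X X₁ : Finset (Finset V))
    (hX : IsCombManifold d X) (hsph : Z2HomologySphere d X)
    (hind : IsInduced X X₁) (hball : IsCombBall d X₁) :
    Z2Acyclic (simpNbhd (simpComplement X₁ X) X) := by
  have hgood := man_good hX.1 (fun v hv => sphere_AllGood (hX.2 v hv))
  rcases Nat.eq_zero_or_pos d with rfl | hd
  · exfalso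
    obtain ⟨F, hF, hF0, hF1, hFne⟩ := exists_fund hX.1 (d := 0 - 1 + 1) le_rfl hgood.2
    obtain ⟨e, he, hec⟩ := (Hv_iff.1 (fun c => hsph.1 2 c (by decide))) F hF hF0
    apply hFne
    have : e = 0 := by
      ext t
      by_contra h3
      obtain ⟨h4, h5⟩ := mem_Ch.1 he t h3
      rcases h4 with h4 | rfl
      · have := hgood.1 t h4
        omega
      · simp at h5
    rw [← hec, this, map_zero]
  · have hd' : d - 1 + 1 = d := by omega
    have hdim : ∀ t ∈ X, t.card ≤ d + 1 := by
      intro t ht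
      have := hgood.1 t ht
      omega
    have hg : ∀ s ∈ X, Good X d s := by
      have := hgood.2
      rwa [hd'] at this
    have h1d : ∀ s ∈ X₁, ∀ t ⊆ s, t ≠ ∅ → t ∈ X₁ := by
      intro s hs t hts ht0
      exact hind.2 t (hX.1.2.2 s (hind.1 hs) t hts (Finset.nonempty_iff_ne_empty.2 ht0))
        (hts.trans (subset_verts hs))
    obtain ⟨hb, hH⟩ := ball_main hd hball (fun h => hX.1.2.1 (hind.1 h)) h1d
    exact final hX.1 hd hdim hg hsph hind.1 h1d hb hH (nbhd_iff hX.1 hdim hg hind)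

end HomologySpheres
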